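/- Assume the nondegeneracy and curvature conditions, and let W₃ be a nowhere vanishing real analytic vector field on B̃ with W₃(φ₃) ≡ 0. Assume that for every τ ∈ ℝ, any pair (h₁,h₂) of real analytic functions satisfying a₁(x)·|W₃(φ₁)(x)|^τ·h₁(φ₁(x)) + a₂(x)·|W₃(φ₂)(x)|^τ·h₂(φ₂(x)) = 0 on some nonempty open subset U of B vanishes identically on the corresponding images φ₁(U), φ₂(U). Then for every σ > 0 there exist c, C ∈ (0,∞) with the following property: for every ε > 0, every triple f = (f₁,f₂,f₃) of Lebesgue measurable functions with ‖f_j‖_{L∞} ≤ 2 for each j, and every measurable 𝒮 ⊆ S(f,ε), either |𝒮| ≤ C·ε^c, or there exist a function f₁* : ℝ → ℝ that is constant on intervals of length ε and a measurable set S' ⊆ 𝒮 satisfying |S'| ≥ c·|𝒮|^C and |f₁*(φ₁(x)) − f₁(φ₁(x))| ≤ C·ε^{1−σ} for every x ∈ S'. -/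

import Mathlib

open MeasureTheory Set
open scoped ENNReal

noncomputable section

/-- `g` is constant on the intervals of a partition of `ℝ` into intervals of length `δ`. -/
def ConstOnIntervals (g : ℝ → ℝ) (δ : ℝ) : Prop :=
  ∃ b : ℝ, ∀ n : ℤ, ∃ c : ℝ,
    ∀ y ∈ Set.Ico (b + (n : ℝ) * δ) (b + ((n : ℝ) + 1) * δ), g y = c

theorem vol_image_le {A : Set ℝ} {g : ℝ → ℝ} {K : ℝ} (hK : 0 ≤ K)
    (h : ∀ s ∈ A, ∀ t ∈ A, |g s - g t| ≤ K * |s - t|) :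
    volume (g '' A) ≤ ENNReal.ofReal K * volume A := by
  have hL : LipschitzOnWith (Real.toNNReal K) g A := by
    apply LipschitzOnWith.of_dist_le_mul
    intro x hx y hy
    simpa [Real.dist_eq, hK] using h x hx y hy
  have := hL.hausdorffMeasure_image_le (d := 1) zero_le_one
  simpa [hausdorffMeasure_real, ENNReal.ofReal] using this

theorem vol_le_image2 {A : Set (ℝ × ℝ)} {F : ℝ × ℝ → ℝ × ℝ} {L : ℝ} (hL : 0 ≤ L)
    (h : ∀ s ∈ A, ∀ t ∈ A, dist s t ≤ L * dist (F s) (F t)) :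
    volume A ≤ ENNReal.ofReal L ^ (2 : ℝ) * volume (F '' A) := by
  have hinj : InjOn F A := by
    intro x hx y hy hxy
    have := h x hx y hy
    rw [hxy, dist_self, mul_zero] at this
    exact dist_le_zero.1 this
  have hLip : LipschitzOnWith (Real.toNNReal L) (Function.invFunOn F A) (F '' A) := by
    apply LipschitzOnWith.of_dist_le_mul
    rintro _ ⟨x, hx, rfl⟩ _ ⟨y, hy, rfl⟩
    rw [hinj.leftInvOn_invFunOn hx, hinj.leftInvOn_invFunOn hy]
    simpa [hL] using h x hx y hy
  have := hLip.hausdorffMeasure_image_le (d := 2) zero_le_two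
  rw [hinj.leftInvOn_invFunOn.image_image] at this
  simpa [hausdorffMeasure_prod_real, ENNReal.ofReal] using this

theorem mvt_lower {I : Set ℝ} (hI : I.OrdConnected) {g g' : ℝ → ℝ}
    (hg : ∀ t ∈ I, HasDerivAt g (g' t) t) (h1 : ∀ t ∈ I, 1 ≤ g' t) :
    ∀ s ∈ I, ∀ t ∈ I, s ≤ t → t - s ≤ g t - g s := by
  intro s hs t ht hst
  rcases hst.eq_or_lt with rfl | hlt
  · simp
  have hsub : Icc s t ⊆ I := hI.out hs ht
  obtain ⟨c, hc, hc'⟩ := exists_hasDerivAt_eq_slope g g' hlt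
    (fun x hx => (hg x (hsub hx)).continuousAt.continuousWithinAt)
    (fun x hx => hg x (hsub (Ioo_subset_Icc_self hx)))
  have := h1 c (hsub (Ioo_subset_Icc_self hc))
  rw [hc', le_div_iff₀ (by linarith)] at this
  linarith

theorem vol_small {I : Set ℝ} (hI : I.OrdConnected) {g g' : ℝ → ℝ}
    (hg : ∀ t ∈ I, HasDerivAt g (g' t) t) (h1 : ∀ t ∈ I, 1 ≤ g' t) (δ : ℝ) (hδ : 0 < δ) :
    volume {t ∈ I | |g t| < δ} ≤ ENNReal.ofReal (2 * δ) := by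
  refine (Real.volume_le_diam _).trans ?_
  apply Metric.ediam_le
  have key : ∀ x ∈ {t ∈ I | |g t| < δ}, ∀ y ∈ {t ∈ I | |g t| < δ}, x ≤ y → |x - y| ≤ 2 * δ := by
    rintro x ⟨hx, hx'⟩ y ⟨hy, hy'⟩ hxy
    have := mvt_lower hI hg h1 x hx y hy hxy
    rw [abs_lt] at hx' hy'
    rw [abs_le]
    constructor <;> linarith
  intro x hx y hy
  rw [edist_dist, Real.dist_eq]
  apply ENNReal.ofReal_le_ofReal
  rcases le_total x y with hxy | hxy
  · exact key x hx y hy hxy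
  · rw [abs_sub_comm]; exact key y hy x hx hxy

theorem sublevel1 : ∀ k : ℕ, ∃ C : ℝ, 0 < C ∧ ∀ I : Set ℝ, I.OrdConnected → ∀ g : ℕ → ℝ → ℝ,
    (∀ i, ∀ t ∈ I, HasDerivAt (g i) (g (i+1) t) t) → (∀ t ∈ I, 1 ≤ g (k+1) t) →
    ∀ δ : ℝ, 0 < δ → volume {t ∈ I | |g 0 t| < δ} ≤
      ENNReal.ofReal (C * δ ^ ((1:ℝ) / (k+1))) := by
  intro k
  induction k with
  | zero =>
    refine ⟨2, by norm_num, ?_⟩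
    intro I hI g hg h1 δ hδ
    simpa using vol_small hI (hg 0) h1 δ hδ
  | succ k ih =>
    obtain ⟨C, hC, ih⟩ := ih
    refine ⟨2 + 2 * C, by positivity, ?_⟩
    intro I hI g hg h1 δ hδ
    set α : ℝ := δ ^ ((1:ℝ) / (k+1+1)) with hα
    have hα0 : 0 < α := Real.rpow_pos_of_pos hδ _
    have hmono : ∀ s ∈ I, ∀ t ∈ I, s ≤ t → g (k+1) s ≤ g (k+1) t := by
      intro s hs t ht hst
      have := mvt_lower hI (hg (k+1)) h1 s hs t ht hst
      linarith
    have hpow : (δ / α) ^ ((1:ℝ) / (k+1)) = α := by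
      have : δ / α = δ ^ ((k+1:ℝ) / (k+1+1)) := by
        rw [hα, div_eq_mul_inv, ← Real.rpow_neg hδ.le]
        nth_rewrite 1 [← Real.rpow_one δ]
        rw [← Real.rpow_add hδ]
        congr 1
        field_simp
        ring
      rw [this, ← Real.rpow_mul hδ.le, hα]
      congr 1
      field_simp
    have hsub : {t ∈ I | |g 0 t| < δ} ⊆ {t ∈ I | |g (k+1) t| < α} ∪
        ({t ∈ {t ∈ I | α ≤ g (k+1) t} | |g 0 t / α| < δ / α} ∪
         {t ∈ {t ∈ I | α ≤ - g (k+1) t} | |- g 0 t / α| < δ / α}) := by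
      rintro t ⟨ht, ht'⟩
      by_cases h : |g (k+1) t| < α
      · exact Or.inl ⟨ht, h⟩
      · right
        have h2 : |g 0 t / α| < δ / α := by
          rw [abs_div, abs_of_pos hα0]
          gcongr
        rw [not_lt, le_abs] at h
        rcases h with h | h
        · exact Or.inl ⟨⟨ht, h⟩, h2⟩
        · refine Or.inr ⟨⟨ht, h⟩, ?_⟩
          rw [neg_div, abs_neg]; exact h2
    have e1 := vol_small hI (hg (k+1)) h1 α hα0
    have e2 := ih {t ∈ I | α ≤ g (k+1) t} (by
        constructor
        rintro x ⟨hx, hx'⟩ y ⟨hy, hy'⟩ z hz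
        have hz' := hI.out hx hy hz
        exact ⟨hz', hx'.trans (hmono x hx z hz' hz.1)⟩) (fun i t => g i t / α)
        (fun i t ht => (hg i t ht.1).div_const α)
        (fun t ht => by rw [le_div_iff₀ hα0, one_mul]; exact ht.2) (δ / α) (by positivity)
    have e3 := ih {t ∈ I | α ≤ - g (k+1) t} (by
        constructor
        rintro x ⟨hx, hx'⟩ y ⟨hy, hy'⟩ z hz
        have hz' := hI.out hx hy hz
        refine ⟨hz', hy'.trans ?_⟩
        have := hmono z hz' y hy hz.2
        linarith) (fun i t => - g i t / α)
        (fun i t ht => (hg i t ht.1).neg.div_const α)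
        (fun t ht => by rw [le_div_iff₀ hα0, one_mul]; exact ht.2) (δ / α) (by positivity)
    rw [hpow] at e2 e3
    refine (measure_mono hsub).trans ((measure_union_le _ _).trans ?_)
    refine (add_le_add e1 ((measure_union_le _ _).trans (add_le_add e2 e3))).trans ?_
    rw [← ENNReal.ofReal_add (by positivity) (by positivity),
      ← ENNReal.ofReal_add (by positivity) (by positivity)]
    apply ENNReal.ofReal_le_ofReal
    push_cast
    rw [← hα]
    linarith

/-- iterated directional derivative -/
def dirD {E : Type*} [NormedAddCommGroup E] [NormedSpace ℝ E] (h : E → ℝ) (v : E) : ℕ → E → ℝ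
  | 0 => h
  | (i+1) => fun w => fderiv ℝ (dirD h v i) w v

theorem dirD_analytic {E : Type*} [NormedAddCommGroup E] [NormedSpace ℝ E] {h : E → ℝ}
    {U : Set E} (hh : AnalyticOnNhd ℝ h U) (v : E) (i : ℕ) : AnalyticOnNhd ℝ (dirD h v i) U := by
  induction i with
  | zero => exact hh
  | succ i ih =>
    intro x hx
    have := (ih x hx).fderiv
    exact ((ContinuousLinearMap.apply ℝ ℝ v).analyticAt _).comp this

theorem dirD_hasDerivAt {E : Type*} [NormedAddCommGroup E] [NormedSpace ℝ E] {h : E → ℝ}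
    {U : Set E} (hh : AnalyticOnNhd ℝ h U) (v z : E) (i : ℕ) (s : ℝ) (hs : z + s • v ∈ U) :
    HasDerivAt (fun s : ℝ => dirD h v i (z + s • v)) (dirD h v (i+1) (z + s • v)) s := by
  have h1 := ((dirD_analytic hh v i) _ hs).differentiableAt.hasFDerivAt
  have h2 : HasDerivAt (fun s : ℝ => z + s • v) v s := by
    simpa using ((hasDerivAt_id s).smul_const v).const_add z
  exact h1.comp_hasDerivAt s h2

theorem exists_dirD_ne {E : Type*} [NormedAddCommGroup E] [NormedSpace ℝ E]
    {h : E → ℝ} {z₀ : E} {R : ℝ} (hR : 0 < R) (hh : AnalyticOnNhd ℝ h (Metric.ball z₀ R))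
    (hne : ¬ ∀ᶠ z in nhds z₀, h z = 0) : ∃ v : E, ∃ k : ℕ, dirD h v k z₀ ≠ 0 := by
  by_contra! hcon
  apply hne
  filter_upwards [Metric.ball_mem_nhds z₀ hR] with z hz
  set y := z - z₀ with hy
  set g : ℝ → ℝ := fun s => h (z₀ + s • y) with hg
  set V : Set ℝ := {s | z₀ + s • y ∈ Metric.ball z₀ R} with hV
  have hcont : Continuous (fun s : ℝ => z₀ + s • y) := by fun_prop
  have hVo : IsOpen V := Metric.isOpen_ball.preimage hcont
  have hVc : Convex ℝ V := by
    intro s hs t ht a b ha hb hab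
    have := (convex_ball z₀ R) hs ht ha hb hab
    simp only [hV, mem_ofPred_eq]
    convert this using 1
    have : z₀ = a • z₀ + b • z₀ := by rw [← add_smul, hab, one_smul]
    nth_rewrite 1 [this]
    simp only [smul_eq_mul, add_smul, smul_add, mul_smul]
    abel
  have h0 : (0:ℝ) ∈ V := by simp [hV, hR]
  have h1 : (1:ℝ) ∈ V := by simpa [hV, hy, dist_eq_norm] using hz
  have hga : AnalyticOnNhd ℝ g V := by
    intro s hs
    have : AnalyticAt ℝ (fun s : ℝ => z₀ + s • y) s := by fun_prop
    exact AnalyticAt.fun_comp (hh _ hs) this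
  have hit : ∀ i : ℕ, ∀ s ∈ V, iteratedDeriv i g s = dirD h y i (z₀ + s • y) := by
    intro i
    induction i with
    | zero => intro s hs; simp [hg, dirD]
    | succ i ih =>
      intro s hs
      rw [iteratedDeriv_succ]
      have : iteratedDeriv i g =ᶠ[nhds s] fun s => dirD h y i (z₀ + s • y) := by
        filter_upwards [hVo.mem_nhds hs] with t ht using ih t ht
      rw [this.deriv_eq]
      exact (dirD_hasDerivAt hh y z₀ i s hs).deriv
  have hord : analyticOrderAt g 0 = ⊤ := by
    rw [ENat.eq_top_iff_forall_ge]
    intro n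
    rw [natCast_le_analyticOrderAt_iff_iteratedDeriv_eq_zero (hga 0 h0)]
    intro i _
    rw [hit i 0 h0]
    simpa using hcon y i
  rw [analyticOrderAt_eq_top] at hord
  have := hga.eqOn_zero_of_preconnected_of_eventuallyEq_zero hVc.isPreconnected h0 hord h1
  simpa [hg, hy] using this

theorem sublevel_avg {E : Type*} [NormedAddCommGroup E] [NormedSpace ℝ E] [FiniteDimensional ℝ E]
    [MeasurableSpace E] [BorelSpace E] (μ : Measure E) [μ.IsAddHaarMeasure]
    (A : Set E) (hA : IsOpen A) (z₀ : E) (ρ : ℝ) (hAρ : A ⊆ Metric.ball z₀ ρ)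
    (v : E) (X : ℝ≥0∞)
    (hX : ∀ z, volume {s : ℝ | s ∈ Icc (0:ℝ) 1 ∧ z + s • v ∈ A} ≤ X) :
    μ A ≤ μ (Metric.closedBall z₀ (ρ + ‖v‖)) * X := by
  have hmeas : MeasurableSet {p : ℝ × E | p.2 + p.1 • v ∈ A} :=
    (hA.preimage (by fun_prop : Continuous fun p : ℝ × E => p.2 + p.1 • v)).measurableSet
  have e1 : μ A = ∫⁻ s in Icc (0:ℝ) 1, ∫⁻ z, A.indicator 1 (z + s • v) ∂μ := by
    have : ∀ s : ℝ, ∫⁻ z, A.indicator 1 (z + s • v) ∂μ = μ A := by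
      intro s
      rw [lintegral_add_right_eq_self (μ := μ) (fun z => A.indicator (1 : E → ℝ≥0∞) z) (s • v)]
      rw [lintegral_indicator hA.measurableSet]; simp
    simp [this]
  rw [e1, lintegral_lintegral_swap]
  · have : ∀ z, ∫⁻ s in Icc (0:ℝ) 1, A.indicator 1 (z + s • v) ≤
        (Metric.closedBall z₀ (ρ + ‖v‖)).indicator (fun _ => X) z := by
      intro z
      have hm : MeasurableSet {s : ℝ | z + s • v ∈ A} :=
        (hA.preimage (by fun_prop : Continuous fun s : ℝ => z + s • v)).measurableSet
      have e2 : ∫⁻ s in Icc (0:ℝ) 1, A.indicator (1 : E → ℝ≥0∞) (z + s • v)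
          = volume {s : ℝ | s ∈ Icc (0:ℝ) 1 ∧ z + s • v ∈ A} := by
        have : (fun s : ℝ => A.indicator (1 : E → ℝ≥0∞) (z + s • v)) =
          {s : ℝ | z + s • v ∈ A}.indicator 1 := by
          ext s; simp [indicator]
        rw [this, lintegral_indicator_one hm, Measure.restrict_apply hm]
        congr 1; ext s; simp [and_comm]
      rw [e2]
      by_cases hz : z ∈ Metric.closedBall z₀ (ρ + ‖v‖)
      · rw [indicator_of_mem hz]; exact hX z
      · rw [indicator_of_notMem hz]
        have : {s : ℝ | s ∈ Icc (0:ℝ) 1 ∧ z + s • v ∈ A} = ∅ := by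
          ext s
          simp only [mem_ofPred_eq, mem_empty_iff_false, iff_false, not_and]
          intro hs hsA
          apply hz
          have h1 := hAρ hsA
          rw [Metric.mem_ball, dist_eq_norm] at h1
          rw [Metric.mem_closedBall, dist_eq_norm]
          have : z - z₀ = (z + s • v - z₀) - s • v := by abel
          rw [this]
          refine (norm_sub_le _ _).trans ?_
          have : ‖s • v‖ ≤ ‖v‖ := by
            rw [norm_smul, Real.norm_eq_abs, abs_of_nonneg hs.1]
            exact mul_le_of_le_one_left (norm_nonneg _) hs.2
          linarith
        rw [this]; simp
    refine (lintegral_mono this).trans ?_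
    rw [lintegral_indicator Metric.isClosed_closedBall.measurableSet]
    simp [mul_comm]
  · apply Measurable.aemeasurable
    have : (Function.uncurry fun (s : ℝ) (z : E) => A.indicator (1 : E → ℝ≥0∞) (z + s • v)) =
      {p : ℝ × E | p.2 + p.1 • v ∈ A}.indicator 1 := by
      ext ⟨s, z⟩; simp [indicator, Function.uncurry]
    rw [this]
    exact measurable_one.indicator hmeas

theorem sublevel_analytic {E : Type*} [NormedAddCommGroup E] [NormedSpace ℝ E]
    [FiniteDimensional ℝ E]
    [MeasurableSpace E] [BorelSpace E] (μ : Measure E) [μ.IsAddHaarMeasure]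
    {h : E → ℝ} {z₀ : E} (hh : AnalyticAt ℝ h z₀)
    (hne : ¬ ∀ᶠ z in nhds z₀, h z = 0) :
    ∃ ρ C γ : ℝ, 0 < ρ ∧ 0 < C ∧ 0 < γ ∧ ∀ s : ℝ, 0 < s →
      μ (Metric.ball z₀ ρ ∩ {z | |h z| < s}) ≤ ENNReal.ofReal (C * s ^ γ) := by
  obtain ⟨R, hR, hhR⟩ := Metric.eventually_nhds_iff_ball.1 hh.eventually_analyticAt
  have hhR' : AnalyticOnNhd ℝ h (Metric.ball z₀ R) := hhR
  by_cases h0 : h z₀ = 0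
  swap
  · -- nonvanishing case
    have hc : ∀ᶠ z in nhds z₀, |h z₀| / 2 < |h z| := by
      have : ContinuousAt (fun z => |h z|) z₀ := hh.continuousAt.abs
      exact this.eventually (lt_mem_nhds (by have := abs_pos.2 h0; linarith))
    obtain ⟨ρ, hρ, hρ'⟩ := Metric.eventually_nhds_iff_ball.1 hc
    have hpos := abs_pos.2 h0
    set m := (μ (Metric.ball z₀ ρ)).toReal
    have hm : 0 ≤ m := ENNReal.toReal_nonneg
    refine ⟨ρ, (m + 1) * (2 / |h z₀|), 1, hρ, by positivity, one_pos, ?_⟩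
    intro s hs
    by_cases hs' : s ≤ |h z₀| / 2
    · have : Metric.ball z₀ ρ ∩ {z | |h z| < s} = ∅ := by
        ext z
        simp only [mem_inter_iff, mem_ofPred_eq, mem_empty_iff_false, iff_false, not_and, not_lt]
        intro hz
        have := hρ' z hz
        linarith
      rw [this]; simp
    · refine (measure_mono inter_subset_left).trans ?_
      rw [← ENNReal.ofReal_toReal (measure_ball_lt_top (μ := μ) (x := z₀) (r := ρ)).ne]
      apply ENNReal.ofReal_le_ofReal
      change m ≤ _
      push Not at hs'
      rw [Real.rpow_one, mul_assoc]
      have : 1 ≤ 2 / |h z₀| * s := by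
        rw [div_mul_eq_mul_div, le_div_iff₀ hpos]; linarith
      nlinarith
  · obtain ⟨v, k, hk⟩ := exists_dirD_ne hR hhR' hne
    obtain ⟨k, rfl⟩ : ∃ j, k = j + 1 := by
      cases k with
      | zero => exact absurd h0 hk
      | succ j => exact ⟨j, rfl⟩
    set b := dirD h v (k+1) z₀ with hb
    have hcont : ContinuousAt (fun z => dirD h v (k+1) z / b) z₀ :=
      ((dirD_analytic hhR' v (k+1)) z₀ (Metric.mem_ball_self hR)).continuousAt.div_const b
    have hev : ∀ᶠ z in nhds z₀, 1/2 < dirD h v (k+1) z / b :=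
      hcont.eventually (lt_mem_nhds (by show 1/2 < dirD h v (k+1) z₀ / b; rw [← hb, div_self hk]; norm_num))
    obtain ⟨ρ0, hρ0, hρ0'⟩ := Metric.eventually_nhds_iff_ball.1 hev
    set ρ := min ρ0 R
    have hρ : 0 < ρ := lt_min hρ0 hR
    obtain ⟨C, hC, hsub⟩ := sublevel1 k
    have hbpos := abs_pos.2 hk
    set m := (μ (Metric.closedBall z₀ (ρ + ‖v‖))).toReal
    have hm : 0 ≤ m := ENNReal.toReal_nonneg
    refine ⟨ρ, (m + 1) * (C * (2 / |b|) ^ ((1:ℝ) / (k+1))), (1:ℝ) / (k+1), hρ, by positivity,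
      by positivity, ?_⟩
    intro s hs
    have hopen : IsOpen (Metric.ball z₀ ρ ∩ {z | |h z| < s}) := by
      have hco : ContinuousOn (fun z => |h z|) (Metric.ball z₀ ρ) := by
        intro z hz
        exact ((hhR' z (Metric.ball_subset_ball (min_le_right _ _) hz)).continuousAt.abs
          ).continuousWithinAt
      exact hco.isOpen_inter_preimage Metric.isOpen_ball isOpen_Iio
    have := sublevel_avg μ _ hopen z₀ ρ inter_subset_left v
      (ENNReal.ofReal (C * (2 / |b| * s) ^ ((1:ℝ) / (k+1)))) (by
        intro z
        have hoc : ({t : ℝ | t ∈ Icc (0:ℝ) 1 ∧ z + t • v ∈ Metric.ball z₀ ρ}).OrdConnected := by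
          have : Convex ℝ {t : ℝ | t ∈ Icc (0:ℝ) 1 ∧ z + t • v ∈ Metric.ball z₀ ρ} := by
            intro s hs t ht a b ha hb hab
            refine ⟨convex_Icc 0 1 hs.1 ht.1 ha hb hab, ?_⟩
            have := (convex_ball z₀ ρ) hs.2 ht.2 ha hb hab
            convert this using 1
            have : z = a • z + b • z := by rw [← add_smul, hab, one_smul]
            nth_rewrite 1 [this]
            simp only [smul_eq_mul, add_smul, smul_add, mul_smul]
            abel
          exact this.ordConnected
        have hin : ∀ t ∈ {t : ℝ | t ∈ Icc (0:ℝ) 1 ∧ z + t • v ∈ Metric.ball z₀ ρ},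
            z + t • v ∈ Metric.ball z₀ R := fun t ht =>
          Metric.ball_subset_ball (min_le_right _ _) ht.2
        have := hsub _ hoc (fun i t => dirD h v i (z + t • v) * (2 / b))
          (fun i t ht => (dirD_hasDerivAt hhR' v z i t (hin t ht)).mul_const _)
          (fun t ht => by
            have := hρ0' _ (Metric.ball_subset_ball (min_le_left _ _) ht.2)
            have e : dirD h v (k+1) (z + t • v) * (2 / b) = 2 * (dirD h v (k+1) (z + t • v) / b) := by
              ring
            change 1 ≤ dirD h v (k+1) (z + t • v) * (2 / b)
            rw [e]; linarith) (2 / |b| * s) (by positivity)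
        refine le_trans (measure_mono ?_) this
        rintro t ⟨ht1, ht2, ht3⟩
        refine ⟨⟨ht1, ht2⟩, ?_⟩
        change |h (z + t • v) * (2 / b)| < _
        rw [abs_mul, abs_div, abs_two, mul_comm]
        have : 0 < 2 / |b| := by positivity
        exact mul_lt_mul_of_pos_left ht3 this)
    refine this.trans ?_
    rw [← ENNReal.ofReal_toReal (measure_closedBall_lt_top (μ := μ) (x := z₀) (r := ρ + ‖v‖)).ne,
      ← ENNReal.ofReal_mul hm]
    apply ENNReal.ofReal_le_ofReal
    rw [Real.mul_rpow (by positivity) hs.le]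
    change m * _ ≤ _
    have : 0 ≤ (C * ((2 / |b|) ^ ((1:ℝ) / (k+1)) * s ^ ((1:ℝ) / (k+1)))) := by positivity
    nlinarith

section generic
variable {X Y Z : Type*} [MeasureSpace X] [MeasureSpace Y] [MeasureSpace Z]
  [SFinite (volume : Measure X)] [SFinite (volume : Measure Y)] [SFinite (volume : Measure Z)]

theorem prod_lower {P : Set (X × Y)} (hP : MeasurableSet P) {A : Set X}
    (hA : MeasurableSet A) {s : ℝ≥0∞} (h : ∀ x ∈ A, s ≤ volume (Prod.mk x ⁻¹' P)) :
    s * volume A ≤ volume P := by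
  rw [Measure.volume_eq_prod, Measure.prod_apply hP, ← setLIntegral_const]
  exact (setLIntegral_mono' hA h).trans (setLIntegral_le_lintegral _ _)

theorem prod_upper {P : Set (X × Y)} (hP : MeasurableSet P) {A : Set X}
    (hA : MeasurableSet A) (hPA : ∀ p ∈ P, p.1 ∈ A)
    {s : ℝ≥0∞} (h : ∀ x ∈ A, volume (Prod.mk x ⁻¹' P) ≤ s) :
    volume P ≤ s * volume A := by
  rw [Measure.volume_eq_prod, Measure.prod_apply hP, ← setLIntegral_const,
    ← lintegral_indicator hA]
  apply lintegral_mono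
  intro x
  by_cases hx : x ∈ A
  · simpa [indicator, hx] using h x hx
  · have : Prod.mk x ⁻¹' P = ∅ := by
      ext y; simp only [mem_preimage, mem_empty_iff_false, iff_false]
      exact fun hy => hx (hPA _ hy)
    simp [this]

theorem prod_slice_le {P P' : Set (X × Y)} (hP : MeasurableSet P) (hP' : MeasurableSet P')
    {K : ℝ≥0∞} (h : ∀ x, volume (Prod.mk x ⁻¹' P) ≤ K * volume (Prod.mk x ⁻¹' P')) :
    volume P ≤ K * volume P' := by
  rw [Measure.volume_eq_prod, Measure.prod_apply hP, Measure.prod_apply hP',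
    ← lintegral_const_mul _ (measurable_measure_prodMk_left hP')]
  exact lintegral_mono h

/-- swap the last two coordinates -/
def rsw : (X × Y) × Z → (X × Z) × Y := fun p => ((p.1.1, p.2), p.1.2)

theorem mp_rsw : MeasurePreserving (rsw : (X × Y) × Z → (X × Z) × Y) volume volume := by
  have h1 : MeasurePreserving (MeasurableEquiv.prodAssoc : (X × Y) × Z ≃ᵐ X × Y × Z)
    volume volume := volume_preserving_prodAssoc
  have h2 : MeasurePreserving (Prod.map id Prod.swap : X × Y × Z → X × Z × Y) volume volume :=
    (MeasurePreserving.id volume).prod Measure.measurePreserving_swap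
  have h3 : MeasurePreserving (MeasurableEquiv.prodAssoc : (X × Z) × Y ≃ᵐ X × Z × Y).symm
    volume volume := (volume_preserving_prodAssoc).symm _
  exact h3.comp (h2.comp h1)

theorem mp_rsw_id {W : Type*} [MeasureSpace W] [SFinite (volume : Measure W)] :
    MeasurePreserving (Prod.map rsw id : ((X × Y) × Z) × W → ((X × Z) × Y) × W) volume volume :=
  mp_rsw.prod (MeasurePreserving.id volume)

end generic

theorem floor_close {x y ε : ℝ} (hε : 0 < ε) (h : ⌊x / ε⌋ = ⌊y / ε⌋) : |x - y| ≤ ε := by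
  have := Int.abs_sub_lt_one_of_floor_eq_floor h
  rw [← sub_div, abs_div, abs_of_pos hε, div_lt_one hε] at this
  exact this.le

theorem floor_card {α β ε : ℝ} (hε : 0 < ε) (hε1 : ε ≤ 1) (hαβ : α ≤ β) (hl : β - α ≤ 1) :
    ((Finset.Icc ⌊α / ε⌋ ⌊β / ε⌋).card : ℝ≥0∞) ≤ ENNReal.ofReal (3 / ε) := by
  rw [Int.card_Icc]
  have h1 : ⌊α / ε⌋ ≤ ⌊β / ε⌋ := Int.floor_le_floor (by gcongr)
  have h2 : ((⌊β / ε⌋ + 1 - ⌊α / ε⌋).toNat : ℝ) ≤ 3 / ε := by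
    have e : (((⌊β / ε⌋ + 1 - ⌊α / ε⌋).toNat : ℤ) : ℝ) = ((⌊β / ε⌋ + 1 - ⌊α / ε⌋ : ℤ) : ℝ) := by
      rw [Int.toNat_of_nonneg (by linarith)]
    rw [Int.cast_natCast] at e
    rw [e]; push_cast
    have a1 := Int.floor_le (β / ε)
    have a2 := Int.lt_floor_add_one (α / ε)
    have a3 : β / ε - α / ε ≤ 1 / ε := by rw [← sub_div]; gcongr
    have a4 : 1 ≤ 1 / ε := by rw [le_div_iff₀ hε]; linarith
    have a5 : 3 / ε = 3 * (1 / ε) := by ring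
    rw [a5]; linarith
  rw [← ENNReal.ofReal_natCast]
  exact ENNReal.ofReal_le_ofReal h2

theorem prune1 {α β ε : ℝ} (hε : 0 < ε) (hε1 : ε ≤ 1) (hαβ : α ≤ β) (hl : β - α ≤ 1)
    (A : Set ℝ) (hA : A ⊆ Icc α β) (s : ℝ≥0∞) :
    volume {x ∈ A | volume {x' ∈ A | ⌊x / ε⌋ = ⌊x' / ε⌋} < s} ≤ ENNReal.ofReal (3 / ε) * s := by
  have hsub : {x ∈ A | volume {x' ∈ A | ⌊x / ε⌋ = ⌊x' / ε⌋} < s} ⊆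
      ⋃ n ∈ Finset.Icc ⌊α / ε⌋ ⌊β / ε⌋,
        {x ∈ A | ⌊x / ε⌋ = n ∧ volume {x' ∈ A | n = ⌊x' / ε⌋} < s} := by
    rintro x ⟨hx, hx'⟩
    simp only [mem_iUnion]
    refine ⟨⌊x / ε⌋, ?_, hx, rfl, hx'⟩
    have := hA hx
    rw [Finset.mem_Icc]
    exact ⟨Int.floor_le_floor (by have := this.1; gcongr),
      Int.floor_le_floor (by have := this.2; gcongr)⟩
  refine (measure_mono hsub).trans ((measure_biUnion_finset_le _ _).trans ?_)
  have : ∀ n ∈ Finset.Icc ⌊α / ε⌋ ⌊β / ε⌋,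
      volume {x ∈ A | ⌊x / ε⌋ = n ∧ volume {x' ∈ A | n = ⌊x' / ε⌋} < s} ≤ s := by
    intro n _
    by_cases h : volume {x' ∈ A | n = ⌊x' / ε⌋} < s
    · refine (measure_mono ?_).trans h.le
      rintro x ⟨hx, hx', _⟩
      exact ⟨hx, hx'.symm⟩
    · have : {x ∈ A | ⌊x / ε⌋ = n ∧ volume {x' ∈ A | n = ⌊x' / ε⌋} < s} = ∅ := by
        ext x; simp [h]
      rw [this]; simp
  refine (Finset.sum_le_sum this).trans ?_
  rw [Finset.sum_const, nsmul_eq_mul]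
  gcongr
  exact floor_card hε hε1 hαβ hl

/-- pair counting -/
theorem pair_count {α β ε : ℝ} (hε : 0 < ε) (hε1 : ε ≤ 1) (hαβ : α ≤ β) (hl : β - α ≤ 1)
    (S : Set (ℝ × ℝ)) (hS : MeasurableSet S) (Yv : Set ℝ) (hY : MeasurableSet Yv)
    (hSY : ∀ p ∈ S, p.1 ∈ Icc α β ∧ p.2 ∈ Yv) (s W : ℝ≥0∞) (hW : volume Yv ≤ W)
    (hs : ENNReal.ofReal (3 / ε) * s * W ≤ volume S / 2) (hfin : volume S ≠ ∞) :
    s * (volume S / 2) ≤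
      volume {p : (ℝ × ℝ) × ℝ | (p.1.1, p.2) ∈ S ∧ (p.1.2, p.2) ∈ S ∧
        ⌊p.1.1 / ε⌋ = ⌊p.1.2 / ε⌋} := by
  -- Z = ((x,y),x')
  set Z : Set ((ℝ × ℝ) × ℝ) := {p | p.1 ∈ S ∧ (p.2, p.1.2) ∈ S ∧ ⌊p.1.1 / ε⌋ = ⌊p.2 / ε⌋} with hZ
  have hmZ : MeasurableSet Z := by
    apply MeasurableSet.inter (measurable_fst hS)
    apply MeasurableSet.inter
    · exact (by fun_prop : Measurable fun p : (ℝ × ℝ) × ℝ => (p.2, p.1.2)) hS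
    · exact measurableSet_eq_fun (by fun_prop) (by fun_prop)
  have hmN : Measurable fun q : ℝ × ℝ => volume (Prod.mk q ⁻¹' Z) := measurable_measure_prodMk_left hmZ
  set Bd : Set (ℝ × ℝ) := S ∩ {q | volume (Prod.mk q ⁻¹' Z) < s} with hBd
  have hmB : MeasurableSet Bd := hS.inter (measurableSet_lt hmN measurable_const)
  have hBd_le : volume Bd ≤ volume S / 2 := by
    have h1 : volume Bd = volume (Prod.swap ⁻¹' Bd : Set (ℝ × ℝ)) := by
      exact ((Measure.measurePreserving_swap (μ := (volume : Measure ℝ))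
        (ν := (volume : Measure ℝ))).measure_preimage hmB.nullMeasurableSet).symm
    rw [h1]
    have h2 := prod_upper (P := (Prod.swap ⁻¹' Bd : Set (ℝ × ℝ))) (measurable_swap hmB) hY
      (s := ENNReal.ofReal (3 / ε) * s) (fun p hp => (hSY _ hp.1).2) (by
        intro y hy
        refine le_trans (measure_mono ?_) (prune1 hε hε1 hαβ hl {x | (x, y) ∈ S}
          (fun x hx => (hSY _ hx).1) s)
        rintro x ⟨hx, hx'⟩
        refine ⟨hx, lt_of_eq_of_lt ?_ hx'⟩
        congr 1
        ext x'
        constructor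
        · rintro ⟨h1, h2⟩; exact ⟨hx, h1, h2⟩
        · rintro ⟨_, h1, h2⟩; exact ⟨h1, h2⟩)
    refine h2.trans (le_trans ?_ hs)
    gcongr
  have hgood : volume S / 2 ≤ volume (S \ Bd) := by
    have := le_measure_sdiff (μ := volume) (s₁ := S) (s₂ := Bd)
    refine le_trans ?_ this
    calc volume S / 2 = volume S - volume S / 2 := (ENNReal.sub_half hfin).symm
      _ ≤ _ := by gcongr
  have hlow := prod_lower hmZ (hS.diff hmB) (s := s) (by
    rintro q ⟨hq, hq'⟩
    by_contra hlt
    exact hq' ⟨hq, not_le.1 hlt⟩)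
  have hfinal : volume Z = volume {p : (ℝ × ℝ) × ℝ | (p.1.1, p.2) ∈ S ∧ (p.1.2, p.2) ∈ S ∧
        ⌊p.1.1 / ε⌋ = ⌊p.1.2 / ε⌋} := by
    rw [← (mp_rsw (X := ℝ) (Y := ℝ) (Z := ℝ)).measure_preimage hmZ.nullMeasurableSet]
    rfl
  rw [← hfinal]
  refine le_trans ?_ hlow
  gcongr

/-- planar local-injectivity counting lemma -/
theorem count2 {α β α' β' ρ : ℝ} (hρ : 0 < ρ) (hρ1 : ρ ≤ 1) (hαβ : α ≤ β) (hl : β - α ≤ 1)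
    (hαβ' : α' ≤ β') (hl' : β' - α' ≤ 1) (A : Set (ℝ × ℝ)) (hA : A ⊆ Icc α β ×ˢ Icc α' β')
    (F : ℝ × ℝ → ℝ × ℝ) (L : ℝ) (hL : 0 ≤ L)
    (hF : ∀ z ∈ A, ∀ z' ∈ A, dist z z' ≤ ρ → dist z z' ≤ L * dist (F z) (F z'))
    (g : ℝ → ℝ) (hg : Measurable g) (K κ : ℝ) (hK : 0 ≤ K) (hκ : 0 ≤ κ)
    (hFA : ∀ z ∈ A, |(F z).1| ≤ K ∧ |(F z).2 - g (F z).1| ≤ κ) :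
    volume A ≤ ENNReal.ofReal (3 / ρ) * ENNReal.ofReal (3 / ρ) *
      (ENNReal.ofReal L ^ (2 : ℝ) * (ENNReal.ofReal (2 * κ) * ENNReal.ofReal (2 * K))) := by
  set Zs : Set (ℝ × ℝ) := {p | p.1 ∈ Icc (-K) K ∧ |p.2 - g p.1| ≤ κ} with hZs
  have hmZ : MeasurableSet Zs := by
    apply MeasurableSet.inter (measurable_fst measurableSet_Icc)
    exact measurableSet_le (f := fun p : ℝ × ℝ => |p.2 - g p.1|) (by fun_prop) measurable_const
  have hZv : volume Zs ≤ ENNReal.ofReal (2 * κ) * ENNReal.ofReal (2 * K) := by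
    have := prod_upper hmZ measurableSet_Icc (A := Icc (-K) K) (s := ENNReal.ofReal (2 * κ))
      (fun p hp => hp.1) (by
        intro x hx
        have : Prod.mk x ⁻¹' Zs ⊆ Icc (g x - κ) (g x + κ) := by
          rintro y ⟨_, hy⟩
          have hy : |y - g x| ≤ κ := hy
          rw [abs_le] at hy
          constructor <;> linarith
        refine (measure_mono this).trans ?_
        rw [Real.volume_Icc]
        apply ENNReal.ofReal_le_ofReal; linarith)
    refine this.trans ?_
    rw [Real.volume_Icc]
    gcongr; linarith
  set T1 := Finset.Icc ⌊α / ρ⌋ ⌊β / ρ⌋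
  set T2 := Finset.Icc ⌊α' / ρ⌋ ⌊β' / ρ⌋
  have hsub : A ⊆ ⋃ n ∈ T1 ×ˢ T2, {z ∈ A | ⌊z.1 / ρ⌋ = n.1 ∧ ⌊z.2 / ρ⌋ = n.2} := by
    intro z hz
    simp only [mem_iUnion]
    have := hA hz
    refine ⟨(⌊z.1 / ρ⌋, ⌊z.2 / ρ⌋), ?_, hz, rfl, rfl⟩
    rw [Finset.mem_product, Finset.mem_Icc, Finset.mem_Icc]
    exact ⟨⟨Int.floor_le_floor (by have := this.1.1; gcongr),
      Int.floor_le_floor (by have := this.1.2; gcongr)⟩,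
      ⟨Int.floor_le_floor (by have := this.2.1; gcongr),
      Int.floor_le_floor (by have := this.2.2; gcongr)⟩⟩
  refine (measure_mono hsub).trans ((measure_biUnion_finset_le _ _).trans ?_)
  have : ∀ n ∈ T1 ×ˢ T2, volume {z ∈ A | ⌊z.1 / ρ⌋ = n.1 ∧ ⌊z.2 / ρ⌋ = n.2} ≤
      ENNReal.ofReal L ^ (2 : ℝ) * (ENNReal.ofReal (2 * κ) * ENNReal.ofReal (2 * K)) := by
    intro n _
    refine (vol_le_image2 hL (F := F) ?_).trans ?_
    · rintro s ⟨hs, hs1, hs2⟩ t ⟨ht, ht1, ht2⟩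
      refine hF s hs t ht ?_
      rw [Prod.dist_eq]
      exact max_le (floor_close hρ (hs1.trans ht1.symm)) (floor_close hρ (hs2.trans ht2.symm))
    · gcongr
      refine (measure_mono ?_).trans hZv
      rintro _ ⟨z, ⟨hz, _⟩, rfl⟩
      have := hFA z hz
      exact ⟨abs_le.1 this.1, this.2⟩
  refine (Finset.sum_le_sum this).trans ?_
  rw [Finset.sum_const, nsmul_eq_mul, Finset.card_product]
  push_cast
  gcongr
  · exact floor_card hρ hρ1 hαβ hl
  · exact floor_card hρ hρ1 hαβ' hl'

structure Pkg where
  c1 : ℝ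
  c2 : ℝ
  δ : ℝ
  K : ℝ
  γ : ℝ
  φ : ℝ × ℝ → ℝ
  ξ : ℝ × ℝ → ℝ
  ζ : ℝ × ℝ → ℝ
  A1 : ℝ × ℝ → ℝ
  A2 : ℝ × ℝ → ℝ
  J : ((ℝ × ℝ) × ℝ) × ℝ → ℝ
  hδ : 0 < δ
  hδ1 : δ ≤ 1 / 2
  hK : 1 ≤ K
  hγ : 0 < γ
  mφ : Measurable φ
  mξ : Measurable ξ
  mζ : Measurable ζ
  mJ : Measurable J
  lip1 : ∀ x1 ∈ Icc (c1 - δ) (c1 + δ), ∀ x1' ∈ Icc (c1 - δ) (c1 + δ),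
    ∀ x2 ∈ Icc (c2 - δ) (c2 + δ), |φ (x1, x2) - φ (x1', x2)| ≤ K * |x1 - x1'| ∧
      |x1 - x1'| ≤ K * |φ (x1, x2) - φ (x1', x2)|
  lip2 : ∀ x1 ∈ Icc (c1 - δ) (c1 + δ), ∀ x2 ∈ Icc (c2 - δ) (c2 + δ),
    ∀ x2' ∈ Icc (c2 - δ) (c2 + δ), |φ (x1, x2) - φ (x1, x2')| ≤ K * |x2 - x2'| ∧
      |x2 - x2'| ≤ K * |φ (x1, x2) - φ (x1, x2')|
  hξ : ∀ x1 ∈ Icc (c1 - δ) (c1 + δ), ∀ x2 ∈ Icc (c2 - δ) (c2 + δ), ξ (x1, φ (x1, x2)) = x2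
  hζ : ∀ x1 ∈ Icc (c1 - δ) (c1 + δ), ∀ x2 ∈ Icc (c2 - δ) (c2 + δ), ζ (x2, φ (x1, x2)) = x1
  hζ2 : ∀ x1 ∈ Icc (c1 - δ) (c1 + δ), ∀ x2 ∈ Icc (c2 - δ) (c2 + δ),
    ∀ x2' ∈ Icc (c2 - δ) (c2 + δ), φ (ζ (x2', φ (x1, x2)), x2') = φ (x1, x2)
  hA1 : ∀ x ∈ Icc (c1 - δ) (c1 + δ) ×ˢ Icc (c2 - δ) (c2 + δ), |A1 x| ≤ K ∧ K⁻¹ ≤ |A1 x|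
  hA2 : ∀ x ∈ Icc (c1 - δ) (c1 + δ) ×ˢ Icc (c2 - δ) (c2 + δ), |A2 x| ≤ K ∧ K⁻¹ ≤ |A2 x|
  lA1 : ∀ x ∈ Icc (c1 - δ) (c1 + δ) ×ˢ Icc (c2 - δ) (c2 + δ),
    ∀ y ∈ Icc (c1 - δ) (c1 + δ) ×ˢ Icc (c2 - δ) (c2 + δ), |A1 x - A1 y| ≤ K * dist x y
  lA2 : ∀ x ∈ Icc (c1 - δ) (c1 + δ) ×ˢ Icc (c2 - δ) (c2 + δ),
    ∀ y ∈ Icc (c1 - δ) (c1 + δ) ×ˢ Icc (c2 - δ) (c2 + δ), |A2 x - A2 y| ≤ K * dist x y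
  tlip : ∀ x1 ∈ Icc (c1 - δ) (c1 + δ), ∀ x1' ∈ Icc (c1 - δ) (c1 + δ), x1 ≠ x1' →
    ∀ d ∈ Icc (c2 - δ) (c2 + δ),
    ∀ a ∈ Icc (c2 - δ) (c2 + δ), ∀ b ∈ Icc (c1 - δ) (c1 + δ),
    ∀ u ∈ Icc (c2 - δ) (c2 + δ), ∀ v ∈ Icc (c1 - δ) (c1 + δ), ∀ s : ℝ, 0 < s →
    s ≤ |J (((x1, a), b), d)| → K * (|x1' - x1| + dist (a, b) (u, v)) ≤ s →
    s * dist (a, b) (u, v) ≤ K * max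
      (|ξ (ζ (ξ (x1', φ (x1, a)), φ (b, a)), φ (b, d)) -
        ξ (ζ (ξ (x1', φ (x1, u)), φ (v, u)), φ (v, d))| / |x1' - x1|)
      |A1 (x1, a) / A2 (x1, a) * (A1 (b, d) / A2 (b, d)) / (A1 (b, a) / A2 (b, a)) -
        A1 (x1, u) / A2 (x1, u) * (A1 (v, d) / A2 (v, d)) / (A1 (v, u) / A2 (v, u))|
  sub : ∀ s : ℝ, 0 < s → volume {p : ((ℝ × ℝ) × ℝ) × ℝ |
    p.1.1.1 ∈ Icc (c1 - δ) (c1 + δ) ∧ p.1.1.2 ∈ Icc (c2 - δ) (c2 + δ) ∧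
    p.1.2 ∈ Icc (c1 - δ) (c1 + δ) ∧ p.2 ∈ Icc (c2 - δ) (c2 + δ) ∧ |J p| < s} ≤
    ENNReal.ofReal (K * s ^ γ)

namespace Pkg
variable (P : Pkg)

def I1 : Set ℝ := Icc (P.c1 - P.δ) (P.c1 + P.δ)
def I2 : Set ℝ := Icc (P.c2 - P.δ) (P.c2 + P.δ)

theorem vI1 : volume P.I1 ≤ 1 := by
  rw [I1, Real.volume_Icc, ← ENNReal.ofReal_one]
  exact ENNReal.ofReal_le_ofReal (by linarith [P.hδ1])
theorem vI2 : volume P.I2 ≤ 1 := by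
  rw [I2, Real.volume_Icc, ← ENNReal.ofReal_one]
  exact ENNReal.ofReal_le_ofReal (by linarith [P.hδ1])
theorem mI1 : MeasurableSet P.I1 := measurableSet_Icc
theorem mI2 : MeasurableSet P.I2 := measurableSet_Icc

/-- edges -/
def E0 (S : Set (ℝ × ℝ)) (ε : ℝ) : Set ((ℝ × ℝ) × ℝ) :=
  {e | (e.1.1, e.2) ∈ S ∧ (e.1.2, P.ξ (e.1.2, P.φ (e.1.1, e.2))) ∈ S ∧
    P.φ (e.1.2, P.ξ (e.1.2, P.φ (e.1.1, e.2))) = P.φ (e.1.1, e.2) ∧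
    ⌊e.1.1 / ε⌋ = ⌊e.1.2 / ε⌋}

theorem mE0 {S : Set (ℝ × ℝ)} (hS : MeasurableSet S) (ε : ℝ) : MeasurableSet (P.E0 S ε) := by
  have := P.mφ
  have := P.mξ
  apply MeasurableSet.inter
  · exact (by fun_prop : Measurable fun e : (ℝ × ℝ) × ℝ => (e.1.1, e.2)) hS
  apply MeasurableSet.inter
  · exact (by fun_prop : Measurable fun e : (ℝ × ℝ) × ℝ =>
      (e.1.2, P.ξ (e.1.2, P.φ (e.1.1, e.2)))) hS
  apply MeasurableSet.inter
  · exact measurableSet_eq_fun (by fun_prop) (by fun_prop)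
  · exact measurableSet_eq_fun (by fun_prop) (by fun_prop)

theorem step1 {S : Set (ℝ × ℝ)} (hS : MeasurableSet S) (hSQ : S ⊆ P.I1 ×ˢ P.I2)
    {ε η : ℝ} (hε : 0 < ε) (hε1 : ε ≤ 1) (hη : 0 ≤ η) (hηS : ENNReal.ofReal η ≤ volume S) :
    ENNReal.ofReal (η ^ 2 * ε / (24 * P.K ^ 4)) ≤ volume (P.E0 S ε) := by
  have hK := P.hK
  have hK0 : 0 < P.K := by linarith
  have hδ := P.hδ
  have := P.mφ
  have := P.mξ
  set Sh : Set (ℝ × ℝ) := {p | (p.1, P.ξ p) ∈ S ∧ P.φ (p.1, P.ξ p) = p.2} with hSh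
  have mSh : MeasurableSet Sh := by
    apply MeasurableSet.inter
    · exact (by fun_prop : Measurable fun e : ℝ × ℝ => (e.1, P.ξ e)) hS
    · exact measurableSet_eq_fun (by fun_prop) (by fun_prop)
  have h1 : volume S ≤ ENNReal.ofReal P.K * volume Sh := by
    apply prod_slice_le hS mSh
    intro x1
    refine (measure_mono ?_).trans (vol_image_le (g := fun y => P.ξ (x1, y)) hK0.le ?_)
    · intro x2 hx2
      have hx2 : (x1, x2) ∈ S := hx2
      have hQ := hSQ hx2
      have e := P.hξ x1 hQ.1 x2 hQ.2
      refine ⟨P.φ (x1, x2), ?_, e⟩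
      show (x1, P.ξ (x1, P.φ (x1, x2))) ∈ S ∧ P.φ (x1, P.ξ (x1, P.φ (x1, x2))) = P.φ (x1, x2)
      rw [e]; exact ⟨hx2, rfl⟩
    · rintro y ⟨hy, hy'⟩ z ⟨hz, hz'⟩
      have := (P.lip2 x1 (hSQ hy).1 _ (hSQ hy).2 _ (hSQ hz).2).2
      simp only at hy' hz'
      rw [hy', hz'] at this
      exact this
  have hc1 : P.c1 ∈ P.I1 := by constructor <;> linarith
  have hc2 : P.c2 ∈ P.I2 := by constructor <;> linarith
  set Y := Icc (P.φ (P.c1, P.c2) - P.K) (P.φ (P.c1, P.c2) + P.K) with hY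
  have hSY : ∀ p ∈ Sh, p.1 ∈ Icc (P.c1 - P.δ) (P.c1 + P.δ) ∧ p.2 ∈ Y := by
    rintro ⟨x1, y⟩ ⟨hy, hy'⟩
    have hQ := hSQ hy
    refine ⟨hQ.1, ?_⟩
    simp only at hy' hQ ⊢
    have a1 := (P.lip2 x1 hQ.1 _ hQ.2 _ hc2).1
    have a2 := (P.lip1 x1 hQ.1 _ hc1 _ hc2).1
    rw [hy'] at a1
    have b1 : |P.ξ (x1, y) - P.c2| ≤ 1 / 2 := by
      have := P.hδ1
      rw [abs_le]; constructor <;> linarith [hQ.2.1, hQ.2.2]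
    have b2 : |x1 - P.c1| ≤ 1 / 2 := by
      have := P.hδ1
      rw [abs_le]; constructor <;> linarith [hQ.1.1, hQ.1.2]
    have a1' : |y - P.φ (x1, P.c2)| ≤ P.K * (1 / 2) := a1.trans (by gcongr)
    have a2' : |P.φ (x1, P.c2) - P.φ (P.c1, P.c2)| ≤ P.K * (1 / 2) := a2.trans (by gcongr)
    rw [abs_le] at a1' a2'
    constructor <;> linarith
  have hWY : volume Y ≤ ENNReal.ofReal (2 * P.K) := by
    rw [Real.volume_Icc]; apply ENNReal.ofReal_le_ofReal; linarith
  have hfin : volume Sh ≠ ∞ := by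
    have : volume Sh ≤ volume (P.I1 ×ˢ Y) := measure_mono fun p hp => hSY p hp
    refine ne_top_of_le_ne_top ?_ this
    rw [Measure.volume_eq_prod, Measure.prod_prod]
    exact ENNReal.mul_ne_top (ne_top_of_le_ne_top ENNReal.one_ne_top P.vI1)
      (ne_top_of_le_ne_top ENNReal.ofReal_ne_top hWY)
  have hShη : ENNReal.ofReal (η / P.K) ≤ volume Sh := by
    rw [ENNReal.ofReal_div_of_pos hK0]
    apply ENNReal.div_le_of_le_mul'
    exact hηS.trans h1
  have hhalf : ENNReal.ofReal (η / P.K / 2) ≤ volume Sh / 2 := by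
    rw [ENNReal.ofReal_div_of_pos (by norm_num : (0:ℝ) < 2)]
    rw [ENNReal.ofReal_ofNat]
    gcongr
  have h2 := pair_count hε hε1 (by linarith : P.c1 - P.δ ≤ P.c1 + P.δ) (by linarith [P.hδ1])
    Sh mSh Y measurableSet_Icc hSY (ENNReal.ofReal (η * ε / (12 * P.K ^ 2)))
    (ENNReal.ofReal (2 * P.K)) hWY (by
      rw [← ENNReal.ofReal_mul (by positivity), ← ENNReal.ofReal_mul (by positivity)]
      refine le_trans (le_of_eq ?_) hhalf
      congr 1; field_simp; ring) hfin
  have h3 : volume {p : (ℝ × ℝ) × ℝ | (p.1.1, p.2) ∈ Sh ∧ (p.1.2, p.2) ∈ Sh ∧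
        ⌊p.1.1 / ε⌋ = ⌊p.1.2 / ε⌋} ≤ ENNReal.ofReal P.K * volume (P.E0 S ε) := by
    refine prod_slice_le ?_ (P.mE0 hS ε) ?_
    · apply MeasurableSet.inter
      · exact (by fun_prop : Measurable fun e : (ℝ × ℝ) × ℝ => (e.1.1, e.2)) mSh
      apply MeasurableSet.inter
      · exact (by fun_prop : Measurable fun e : (ℝ × ℝ) × ℝ => (e.1.2, e.2)) mSh
      · exact measurableSet_eq_fun (by fun_prop) (by fun_prop)
    rintro ⟨x1, x1'⟩
    refine (measure_mono ?_).trans (vol_image_le (g := fun x2 => P.φ (x1, x2)) hK0.le ?_)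
    · rintro y ⟨⟨h1, h2⟩, ⟨h3, h4⟩, h5⟩
      simp only at h1 h2 h3 h4 h5
      refine ⟨P.ξ (x1, y), ?_, h2⟩
      show _ ∧ _
      simp only
      rw [h2]
      exact ⟨h1, h3, h4, h5⟩
    · rintro y ⟨hy, hy'⟩ z ⟨hz, hz'⟩
      exact (P.lip2 x1 (hSQ hy).1 _ (hSQ hy).2 _ (hSQ hz).2).1
  have h4 : ENNReal.ofReal (η ^ 2 * ε / (24 * P.K ^ 3)) ≤ ENNReal.ofReal P.K * volume (P.E0 S ε) := by
    refine le_trans ?_ (h2.trans h3)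
    refine le_trans ?_ (mul_le_mul_right hhalf _)
    rw [← ENNReal.ofReal_mul (by positivity)]
    apply le_of_eq; congr 1; field_simp; ring
  have : η ^ 2 * ε / (24 * P.K ^ 4) = η ^ 2 * ε / (24 * P.K ^ 3) / P.K := by field_simp
  rw [this, ENNReal.ofReal_div_of_pos hK0]
  exact ENNReal.div_le_of_le_mul' h4

end Pkg

/-- choosing representatives by averaging -/
theorem choose_reps {ε : ℝ} (hε : 0 < ε) (S : Set (ℝ × ℝ))
    (G : Set ((ℝ × ℝ) × ℝ)) (hG : MeasurableSet G) (f : ℝ → ℝ) (κ : ℝ)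
    (hGS : ∀ e ∈ G, (e.1.1, e.2) ∈ S ∧ ⌊e.1.1 / ε⌋ = ⌊e.1.2 / ε⌋ ∧ |f e.1.1 - f e.1.2| ≤ κ)
    (hfin : volume G ≠ ∞) (hS : MeasurableSet S) (hf : Measurable f)
    {M : ℝ} (hM : ENNReal.ofReal (M * ε) ≤ volume G) :
    ∃ y : ℤ → ℝ, ENNReal.ofReal M ≤ volume {x ∈ S | |f (y ⌊x.1 / ε⌋) - f x.1| ≤ κ} := by
  -- G' = ((x1,x2),x1'), then swapped: (x1',(x1,x2))
  set G' : Set (ℝ × (ℝ × ℝ)) := {p | ((p.2.1, p.1), p.2.2) ∈ G} with hG'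
  have mG' : MeasurableSet G' :=
    (by fun_prop : Measurable fun p : ℝ × (ℝ × ℝ) => ((p.2.1, p.1), p.2.2)) hG
  have hvG : volume G = volume G' := by
    have h1 : MeasurePreserving (fun p : (ℝ × ℝ) × ℝ => (p.1.2, (p.1.1, p.2))) volume volume := by
      have := (Measure.measurePreserving_swap (μ := (volume : Measure (ℝ × ℝ)))
        (ν := (volume : Measure ℝ))).comp (mp_rsw (X := ℝ) (Y := ℝ) (Z := ℝ))
      exact this
    rw [← h1.measure_preimage mG'.nullMeasurableSet]; rfl
  set h : ℝ → ℝ≥0∞ := fun x => volume (Prod.mk x ⁻¹' G') with hh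
  have mh : Measurable h := measurable_measure_prodMk_left mG'
  have hinteg : volume G = ∫⁻ x, h x := by
    rw [hvG, Measure.volume_eq_prod, Measure.prod_apply mG']
  set In : ℤ → Set ℝ := fun n => {x | ⌊x / ε⌋ = n} with hIn
  have mIn : ∀ n, MeasurableSet (In n) := fun n =>
    measurableSet_eq_fun (by fun_prop) measurable_const
  have hInIco : ∀ n : ℤ, In n = Ico (n * ε) ((n + 1) * ε) := by
    intro n; ext x
    simp only [hIn, mem_setOf_eq, mem_Ico, Int.floor_eq_iff, le_div_iff₀ hε, div_lt_iff₀ hε]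
  have vIn : ∀ n, volume (In n) = ENNReal.ofReal ε := by
    intro n; rw [hInIco, Real.volume_Ico]; congr 1; ring
  have hy : ∀ n, ∃ y ∈ In n, ∫⁻ x in In n, h x ≤ ENNReal.ofReal ε * h y := by
    intro n
    obtain ⟨y, hy, hy'⟩ := exists_setLAverage_le (μ := volume) (s := In n) (f := h)
      (by rw [vIn]; simpa using hε) (mIn n).nullMeasurableSet
      (ne_top_of_le_ne_top (hinteg ▸ hfin) (setLIntegral_le_lintegral _ _))
    refine ⟨y, hy, ?_⟩
    rw [setLAverage_eq, vIn] at hy'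
    rw [mul_comm]
    exact (ENNReal.div_le_iff (by simpa using hε) ENNReal.ofReal_ne_top).1 hy'
  choose y hyI hy using hy
  refine ⟨y, ?_⟩
  set S' := {x ∈ S | |f (y ⌊x.1 / ε⌋) - f x.1| ≤ κ} with hS'
  set Sn : ℤ → Set (ℝ × ℝ) := fun n => {x ∈ S | ⌊x.1 / ε⌋ = n ∧ |f (y n) - f x.1| ≤ κ} with hSn
  have mSn : ∀ n, MeasurableSet (Sn n) := by
    intro n
    apply hS.inter
    apply MeasurableSet.inter
    · exact measurableSet_eq_fun (f := fun x : ℝ × ℝ => ⌊x.1 / ε⌋) (by fun_prop) measurable_const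
    · exact measurableSet_le (f := fun x : ℝ × ℝ => |f (y n) - f x.1|) (by fun_prop) measurable_const
  have hle : ∑' n, volume (Sn n) ≤ volume S' := by
    rw [← measure_iUnion _ mSn]
    · apply measure_mono
      intro x hx
      obtain ⟨n, h1, h2, h3⟩ := mem_iUnion.1 hx
      refine ⟨h1, ?_⟩
      rw [h2]; exact h3
    · intro m n hmn
      rw [Function.onFun, Set.disjoint_left]
      rintro x ⟨_, h1, _⟩ ⟨_, h2, _⟩
      exact hmn (h1.symm.trans h2)
  have hSnh : ∀ n, h (y n) ≤ volume (Sn n) := by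
    intro n
    apply measure_mono
    intro x hx
    obtain ⟨h1, h2, h3⟩ := hGS _ hx
    simp only at h1 h2 h3
    refine ⟨h1, h2.trans (hyI n), ?_⟩
    rw [abs_sub_comm]; exact h3
  have htot : ∫⁻ x, h x = ∑' n, ∫⁻ x in In n, h x := by
    rw [← lintegral_iUnion mIn]
    · have : ⋃ n, In n = univ := by
        ext x; simp [hIn]
      rw [this, setLIntegral_univ]
    · intro m n hmn
      rw [Function.onFun, Set.disjoint_left]
      intro x h1 h2
      exact hmn (Eq.trans (Eq.symm h1) h2)
  have : ENNReal.ofReal (M * ε) ≤ ENNReal.ofReal ε * volume S' := by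
    refine hM.trans ?_
    rw [hinteg, htot]
    calc _ ≤ ∑' n, ENNReal.ofReal ε * volume (Sn n) :=
          ENNReal.tsum_le_tsum fun n => (hy n).trans (by gcongr; exact hSnh n)
      _ = ENNReal.ofReal ε * ∑' n, volume (Sn n) := ENNReal.tsum_mul_left
      _ ≤ _ := by gcongr
  have e : M = M * ε / ε := by field_simp
  rw [e, ENNReal.ofReal_div_of_pos hε]
  exact ENNReal.div_le_of_le_mul' this

theorem vStrip {I : Set ℝ} (hI : MeasurableSet I) (hI1 : volume I ≤ 1) {ε : ℝ} :
    MeasurableSet {p : ℝ × ℝ | p.1 ∈ I ∧ |p.1 - p.2| ≤ ε} ∧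
    volume {p : ℝ × ℝ | p.1 ∈ I ∧ |p.1 - p.2| ≤ ε} ≤ ENNReal.ofReal (2 * ε) := by
  have hm : MeasurableSet {p : ℝ × ℝ | p.1 ∈ I ∧ |p.1 - p.2| ≤ ε} :=
    (measurable_fst hI).inter (measurableSet_le (f := fun p : ℝ × ℝ => |p.1 - p.2|)
      (by fun_prop) measurable_const)
  refine ⟨hm, ?_⟩
  have := prod_upper hm hI (s := ENNReal.ofReal (2 * ε)) (fun p hp => hp.1) (by
    intro x _
    refine (measure_mono (t := Icc (x - ε) (x + ε)) ?_).trans ?_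
    · rintro y ⟨_, hy⟩
      simp only [abs_le] at hy
      constructor <;> linarith
    · rw [Real.volume_Icc]; apply ENNReal.ofReal_le_ofReal; linarith)
  refine this.trans ?_
  calc _ ≤ ENNReal.ofReal (2 * ε) * 1 := by gcongr
    _ = _ := mul_one _

namespace Pkg
variable (P : Pkg)

theorem e0facts {S : Set (ℝ × ℝ)} (hSQ : S ⊆ P.I1 ×ˢ P.I2) {ε : ℝ} (hε : 0 < ε)
    {x1 x1' a : ℝ} (h : ((x1, x1'), a) ∈ P.E0 S ε) :
    x1 ∈ P.I1 ∧ x1' ∈ P.I1 ∧ a ∈ P.I2 ∧ P.ξ (x1', P.φ (x1, a)) ∈ P.I2 ∧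
    P.φ (x1', P.ξ (x1', P.φ (x1, a))) = P.φ (x1, a) ∧ |x1 - x1'| ≤ ε ∧
    P.ζ (P.ξ (x1', P.φ (x1, a)), P.φ (x1, a)) = x1' ∧
    |a - P.ξ (x1', P.φ (x1, a))| ≤ P.K ^ 2 * |x1 - x1'| := by
  obtain ⟨h1, h2, h3, h4⟩ := h
  simp only at h1 h2 h3 h4
  have hK := P.hK
  refine ⟨(hSQ h1).1, (hSQ h2).1, (hSQ h1).2, (hSQ h2).2, h3, floor_close hε h4, ?_, ?_⟩
  · have := P.hζ _ (hSQ h2).1 _ (hSQ h2).2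
    simp only [h3] at this
    exact this
  · have a1 := (P.lip2 x1 (hSQ h1).1 a (hSQ h1).2 _ (hSQ h2).2).2
    have a2 := (P.lip1 x1 (hSQ h1).1 x1' (hSQ h2).1 _ (hSQ h2).2).1
    simp only [h3] at a1 a2
    rw [abs_sub_comm (P.φ (x1, P.ξ (x1', P.φ (x1, a))))] at a2
    calc _ ≤ _ := a1
      _ ≤ P.K * (P.K * |x1 - x1'|) := by gcongr
      _ = _ := by ring

/-- paths -/
def paths (E : Set ((ℝ × ℝ) × ℝ)) : Set ((((ℝ × ℝ) × ℝ) × ℝ) × ℝ) :=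
  {w | w.1.1 ∈ E ∧
    ((w.1.2, P.ζ (P.ξ (w.1.1.1.2, P.φ (w.1.1.1.1, w.1.1.2)), P.φ (w.1.2, w.1.1.2))), w.1.1.2) ∈ E ∧
    ((w.1.2, P.ζ (P.ξ (w.1.1.1.2, P.φ (w.1.1.1.1, w.1.1.2)), P.φ (w.1.2, w.1.1.2))), w.2) ∈ E}

theorem m_paths {E : Set ((ℝ × ℝ) × ℝ)} (hE : MeasurableSet E) : MeasurableSet (P.paths E) := by
  have := P.mφ
  have := P.mξ
  have := P.mζ
  apply MeasurableSet.inter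
  · exact (by fun_prop : Measurable fun w : (((ℝ × ℝ) × ℝ) × ℝ) × ℝ => w.1.1) hE
  apply MeasurableSet.inter
  · exact (by fun_prop : Measurable fun w : (((ℝ × ℝ) × ℝ) × ℝ) × ℝ =>
      ((w.1.2, P.ζ (P.ξ (w.1.1.1.2, P.φ (w.1.1.1.1, w.1.1.2)), P.φ (w.1.2, w.1.1.2))), w.1.1.2)) hE
  · exact (by fun_prop : Measurable fun w : (((ℝ × ℝ) × ℝ) × ℝ) × ℝ =>
      ((w.1.2, P.ζ (P.ξ (w.1.1.1.2, P.φ (w.1.1.1.1, w.1.1.2)), P.φ (w.1.2, w.1.1.2))), w.2)) hE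

theorem step3 {S : Set (ℝ × ℝ)} (hSQ : S ⊆ P.I1 ×ˢ P.I2)
    {ε M : ℝ} (hε : 0 < ε) (hM : 0 ≤ M)
    {E : Set ((ℝ × ℝ) × ℝ)} (hE : MeasurableSet E) (hES : E ⊆ P.E0 S ε)
    (hEM : ENNReal.ofReal (M * ε) ≤ volume E) :
    ENNReal.ofReal (M ^ 3 * ε / (128 * P.K ^ 8)) ≤ volume (P.paths E) := by
  have := P.mφ
  have := P.mξ
  have := P.mζ
  have hK := P.hK
  have hK0 : 0 < P.K := by linarith
  obtain ⟨mst, vst⟩ := vStrip P.mI1 P.vI1 (ε := ε)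
  set st := {p : ℝ × ℝ | p.1 ∈ P.I1 ∧ |p.1 - p.2| ≤ ε} with hst
  set s : ℝ := M / (8 * P.K ^ 4) with hs
  have hs0 : 0 ≤ s := by positivity
  set Eb : Set ((ℝ × ℝ) × ℝ) := E ∩ {e | ENNReal.ofReal s ≤ volume (Prod.mk e.1 ⁻¹' E)} with hEb
  have mDp : Measurable fun p : ℝ × ℝ => volume (Prod.mk p ⁻¹' E) := measurable_measure_prodMk_left hE
  have mEb : MeasurableSet Eb :=
    hE.inter (measurableSet_le measurable_const (mDp.comp measurable_fst))
  have hr1 : volume (E \ Eb) ≤ ENNReal.ofReal s * ENNReal.ofReal (2 * ε) := by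
    refine (prod_upper (hE.diff mEb) mst (s := ENNReal.ofReal s) ?_ ?_).trans (by gcongr)
    · rintro ⟨⟨x, x'⟩, a⟩ he
      have := P.e0facts hSQ hε (hES he.1)
      exact ⟨this.1, this.2.2.2.2.2.1⟩
    · intro p _
      by_cases h : ENNReal.ofReal s ≤ volume (Prod.mk p ⁻¹' E)
      · have : Prod.mk p ⁻¹' (E \ Eb) = ∅ := by
          ext y; simp only [mem_preimage, mem_empty_iff_false, iff_false]
          rintro ⟨h1, h2⟩; exact h2 ⟨h1, h⟩
        rw [this]; simp
      · refine (measure_mono ?_).trans (not_le.1 h).le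
        intro y hy; exact hy.1
  -- q pruning
  set Zb : Set ((ℝ × ℝ) × ℝ) := {w | ((w.2, P.ζ (w.1.2, P.φ (w.2, w.1.1))), w.1.1) ∈ Eb} with hZb
  have mZb : MeasurableSet Zb :=
    (by fun_prop : Measurable fun w : (ℝ × ℝ) × ℝ => ((w.2, P.ζ (w.1.2, P.φ (w.2, w.1.1))), w.1.1)) mEb
  have mDq : Measurable fun q : ℝ × ℝ => volume (Prod.mk q ⁻¹' Zb) := measurable_measure_prodMk_left mZb
  set qe : (ℝ × ℝ) × ℝ → ℝ × ℝ := fun e => (e.2, P.ξ (e.1.2, P.φ (e.1.1, e.2))) with hqe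
  have mqe : Measurable qe := by fun_prop
  set Ea : Set ((ℝ × ℝ) × ℝ) := Eb ∩ {e | ENNReal.ofReal s ≤ volume (Prod.mk (qe e) ⁻¹' Zb)} with hEa
  have mEa : MeasurableSet Ea :=
    mEb.inter (measurableSet_le measurable_const (mDq.comp mqe))
  have hr2 : volume (Eb \ Ea) ≤ ENNReal.ofReal (P.K ^ 2) *
      (ENNReal.ofReal s * ENNReal.ofReal (2 * (P.K ^ 2 * ε))) := by
    -- R1 : ((a,x1),x1')
    set R1 : Set ((ℝ × ℝ) × ℝ) := {w | ((w.1.2, w.2), w.1.1) ∈ Eb \ Ea} with hR1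
    have mR1 : MeasurableSet R1 :=
      (by fun_prop : Measurable fun w : (ℝ × ℝ) × ℝ => ((w.1.2, w.2), w.1.1)) (mEb.diff mEa)
    have v1 : volume (Eb \ Ea) = volume R1 := by
      have h1 : MeasurePreserving (fun p : (ℝ × ℝ) × ℝ => ((p.2, p.1.1), p.1.2)) volume volume := by
        have h2 : MeasurePreserving (Prod.map Prod.swap id : (ℝ × ℝ) × ℝ → (ℝ × ℝ) × ℝ)
          volume volume := (Measure.measurePreserving_swap).prod (MeasurePreserving.id volume)
        exact h2.comp (mp_rsw (X := ℝ) (Y := ℝ) (Z := ℝ))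
      rw [← h1.measure_preimage mR1.nullMeasurableSet]; rfl
    obtain ⟨mst2, vst2⟩ := vStrip P.mI2 P.vI2 (ε := P.K ^ 2 * ε)
    set st2 := {p : ℝ × ℝ | p.1 ∈ P.I2 ∧ |p.1 - p.2| ≤ P.K ^ 2 * ε} with hst2
    -- R2 : ((a,x1),a')
    set R2 : Set ((ℝ × ℝ) × ℝ) := {w | (w.1.1, w.2) ∈ st2 ∧
      ((w.1.2, P.ζ (w.2, P.φ (w.1.2, w.1.1))), w.1.1) ∈ Eb \ Ea ∧
      P.ξ (P.ζ (w.2, P.φ (w.1.2, w.1.1)), P.φ (w.1.2, w.1.1)) = w.2} with hR2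
    have mR2 : MeasurableSet R2 := by
      apply MeasurableSet.inter
      · exact (by fun_prop : Measurable fun w : (ℝ × ℝ) × ℝ => (w.1.1, w.2)) mst2
      apply MeasurableSet.inter
      · exact (by fun_prop : Measurable fun w : (ℝ × ℝ) × ℝ =>
          ((w.1.2, P.ζ (w.2, P.φ (w.1.2, w.1.1))), w.1.1)) (mEb.diff mEa)
      · exact measurableSet_eq_fun (by fun_prop) (by fun_prop)
    have v2 : volume R1 ≤ ENNReal.ofReal (P.K ^ 2) * volume R2 := by
      refine prod_slice_le mR1 mR2 ?_
      rintro ⟨a, x1⟩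
      refine (measure_mono ?_).trans
        (vol_image_le (g := fun a' => P.ζ (a', P.φ (x1, a))) (by positivity) ?_)
      · intro x1' hx
        have hx : ((x1, x1'), a) ∈ Eb \ Ea := hx
        have hf := P.e0facts hSQ hε (hES hx.1.1)
        refine ⟨P.ξ (x1', P.φ (x1, a)), ?_, hf.2.2.2.2.2.2.1⟩
        refine ⟨⟨hf.2.2.1, hf.2.2.2.2.2.2.2.trans ?_⟩, ?_, ?_⟩
        · have := hf.2.2.2.2.2.1; gcongr
        · simp only; rw [hf.2.2.2.2.2.2.1]; exact hx
        · simp only; rw [hf.2.2.2.2.2.2.1]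
      · rintro y ⟨_, hy, hy'⟩ z ⟨_, hz, hz'⟩
        simp only at hy hy' hz hz'
        have fy := P.e0facts hSQ hε (hES hy.1.1)
        have fz := P.e0facts hSQ hε (hES hz.1.1)
        rw [hy'] at fy
        rw [hz'] at fz
        have a1 := (P.lip1 _ fy.2.1 _ fz.2.1 y fy.2.2.2.1).2
        have a2 := (P.lip2 _ fz.2.1 z fz.2.2.2.1 y fy.2.2.2.1).1
        rw [fy.2.2.2.2.1] at a1
        rw [fz.2.2.2.2.1, abs_sub_comm z] at a2
        calc _ ≤ _ := a1
          _ ≤ P.K * (P.K * |y - z|) := by gcongr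
          _ = _ := by ring
    -- R3 : ((a,a'),x1)
    have v3 : volume R2 = volume (rsw ⁻¹' R2 : Set ((ℝ × ℝ) × ℝ)) :=
      ((mp_rsw (X := ℝ) (Y := ℝ) (Z := ℝ)).measure_preimage mR2.nullMeasurableSet).symm
    have v4 : volume (rsw ⁻¹' R2 : Set ((ℝ × ℝ) × ℝ)) ≤ ENNReal.ofReal s * volume st2 := by
      refine prod_upper ((mp_rsw (X := ℝ) (Y := ℝ) (Z := ℝ)).measurable mR2) mst2 ?_ ?_
      · rintro ⟨⟨a, a'⟩, x⟩ hw; exact hw.1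
      · rintro ⟨a, a'⟩ _
        by_cases h : ENNReal.ofReal s ≤ volume (Prod.mk (a, a') ⁻¹' Zb)
        · have : Prod.mk (a, a') ⁻¹' (rsw ⁻¹' R2 : Set ((ℝ × ℝ) × ℝ)) = ∅ := by
            ext x; simp only [mem_preimage, mem_empty_iff_false, iff_false]
            rintro ⟨_, h1, h2⟩
            simp only [rsw] at h1 h2
            apply h1.2
            refine ⟨h1.1, ?_⟩
            have : qe ((x, P.ζ (a', P.φ (x, a))), a) = (a, a') := by
              simp only [hqe]; rw [h2]
            show ENNReal.ofReal s ≤ volume (Prod.mk (qe _) ⁻¹' Zb)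
            rw [this]; exact h
          rw [this]; simp
        · refine (measure_mono ?_).trans (not_le.1 h).le
          rintro x ⟨_, h1, h2⟩
          exact h1.1
    rw [v1]
    refine v2.trans ?_
    rw [v3]
    gcongr
    exact v4.trans (by gcongr)
  have hEfin : volume E ≠ ∞ := by
    have : volume E ≤ volume ((P.I1 ×ˢ P.I1) ×ˢ P.I2) := by
      apply measure_mono
      rintro ⟨⟨x, x'⟩, a⟩ he
      have := P.e0facts hSQ hε (hES he)
      exact ⟨⟨this.1, this.2.1⟩, this.2.2.1⟩
    refine ne_top_of_le_ne_top ?_ this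
    rw [Measure.volume_eq_prod, Measure.prod_prod, Measure.volume_eq_prod, Measure.prod_prod]
    have h1 := ne_top_of_le_ne_top ENNReal.one_ne_top P.vI1
    exact ENNReal.mul_ne_top (ENNReal.mul_ne_top h1 h1)
      (ne_top_of_le_ne_top ENNReal.one_ne_top P.vI2)
  have hEa : ENNReal.ofReal (M * ε / 2) ≤ volume Ea := by
    have hsub : E ⊆ Ea ∪ ((E \ Eb) ∪ (Eb \ Ea)) := by
      intro e he
      by_cases h1 : e ∈ Eb
      · by_cases h2 : e ∈ Ea
        · exact Or.inl h2
        · exact Or.inr (Or.inr ⟨h1, h2⟩)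
      · exact Or.inr (Or.inl ⟨he, h1⟩)
    have h1 : volume E ≤ volume Ea + ENNReal.ofReal (M * ε / 2) := by
      refine (measure_mono hsub).trans ((measure_union_le _ _).trans ?_)
      gcongr
      refine (measure_union_le _ _).trans ((add_le_add hr1 hr2).trans ?_)
      rw [← ENNReal.ofReal_mul hs0, ← ENNReal.ofReal_mul hs0, ← ENNReal.ofReal_mul (by positivity),
        ← ENNReal.ofReal_add (by positivity) (by positivity)]
      apply ENNReal.ofReal_le_ofReal
      have e1 : P.K ^ 2 * (s * (2 * (P.K ^ 2 * ε))) = 2 * M * ε / 8 := by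
        rw [hs]; field_simp
      have e2 : s ≤ M / 8 := by
        rw [hs]; apply div_le_div_of_nonneg_left hM (by norm_num)
        have : 1 ≤ P.K ^ 4 := one_le_pow₀ hK
        linarith
      rw [e1]
      nlinarith
    have h2 : ENNReal.ofReal (M * ε / 2) + ENNReal.ofReal (M * ε / 2) ≤
        volume Ea + ENNReal.ofReal (M * ε / 2) := by
      rw [← ENNReal.ofReal_add (by positivity) (by positivity), add_halves]
      exact hEM.trans h1
    exact (ENNReal.add_le_add_iff_right ENNReal.ofReal_ne_top).1 h2
  -- paths
  set bb : ((ℝ × ℝ) × ℝ) × ℝ → ℝ × ℝ := fun w =>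
    (w.2, P.ζ (P.ξ (w.1.1.2, P.φ (w.1.1.1, w.1.2)), P.φ (w.2, w.1.2))) with hbb
  have mbb : Measurable bb := by fun_prop
  set P1 : Set (((ℝ × ℝ) × ℝ) × ℝ) := {w | w.1 ∈ Ea ∧ (bb w, w.1.2) ∈ Eb} with hP1
  have mP1 : MeasurableSet P1 := (measurable_fst mEa).inter
    ((by fun_prop : Measurable fun w : ((ℝ × ℝ) × ℝ) × ℝ => (bb w, w.1.2)) mEb)
  have l1 : ENNReal.ofReal s * volume Ea ≤ volume P1 := by
    refine prod_lower mP1 mEa ?_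
    intro e he
    refine he.2.trans (measure_mono ?_)
    intro b hb
    exact ⟨he, hb⟩
  have l2 : ENNReal.ofReal s * volume P1 ≤ volume (P.paths E) := by
    refine prod_lower (P.m_paths hE) mP1 ?_
    intro w hw
    refine (hw.2.2).trans (measure_mono ?_)
    intro d hd
    exact ⟨hw.1.1.1, hw.2.1, hd⟩
  refine le_trans ?_ l2
  refine le_trans ?_ (mul_le_mul_right l1 _)
  refine le_trans ?_ (mul_le_mul_right (mul_le_mul_right hEa _) _)
  rw [← ENNReal.ofReal_mul hs0, ← ENNReal.ofReal_mul hs0]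
  apply le_of_eq; congr 1
  rw [hs]; field_simp; ring

end Pkg

namespace Pkg
variable (P : Pkg)

theorem edge {S : Set (ℝ × ℝ)} (hSQ : S ⊆ P.I1 ×ˢ P.I2) {ε K0 : ℝ} (hε : 0 < ε)
    {f1 f2 f3 : ℝ → ℝ} (b1 : ∀ y, |f1 y| ≤ 2) (b2 : ∀ y, |f2 y| ≤ 2)
    (hS : ∀ x ∈ S, |P.A1 x * f1 x.1 + P.A2 x * f2 x.2 + f3 (P.φ x)| ≤ K0 * ε)
    {x1 x1' a : ℝ} (h : ((x1, x1'), a) ∈ P.E0 S ε) :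
    |P.A1 (x1, a) / P.A2 (x1, a) * (f1 x1' - f1 x1) + (f2 (P.ξ (x1', P.φ (x1, a))) - f2 a)| ≤
      P.K * (4 * P.K ^ 3 + 2 * K0) * ε := by
  have hf := P.e0facts hSQ hε h
  obtain ⟨h1, h2, h3, h4⟩ := h
  simp only at h1 h2 h3 h4
  set a' := P.ξ (x1', P.φ (x1, a)) with ha'
  have hK := P.hK
  have hK0 : 0 < P.K := by linarith
  have e1 := hS _ h1
  have e2 := hS _ h2
  simp only [h3] at e1 e2
  have hd : dist (x1, a) (x1', a') ≤ P.K ^ 2 * ε := by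
    rw [Prod.dist_eq]
    have h6 := hf.2.2.2.2.2.1
    apply max_le
    · have : 1 ≤ P.K ^ 2 := one_le_pow₀ hK
      calc _ ≤ 1 * ε := by rw [one_mul]; exact h6
        _ ≤ _ := by gcongr
    · refine hf.2.2.2.2.2.2.2.trans ?_
      gcongr
  have d1 := (P.lA1 _ (hSQ h1) _ (hSQ h2)).trans (mul_le_mul_of_nonneg_left hd hK0.le)
  have d2 := (P.lA2 _ (hSQ h1) _ (hSQ h2)).trans (mul_le_mul_of_nonneg_left hd hK0.le)
  have hA := (P.hA2 _ (hSQ h1)).2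
  have hA0 : P.A2 (x1, a) ≠ 0 := by
    intro h0; rw [h0, abs_zero] at hA
    have : 0 < P.K⁻¹ := by positivity
    linarith
  set u := P.A1 (x1, a)
  set v := P.A2 (x1, a)
  set u' := P.A1 (x1', a')
  set v' := P.A2 (x1', a')
  have key : |u * (f1 x1' - f1 x1) + v * (f2 a' - f2 a)| ≤ (4 * P.K ^ 3 + 2 * K0) * ε := by
    have : u * (f1 x1' - f1 x1) + v * (f2 a' - f2 a) = (u - u') * f1 x1' + (v - v') * f2 a' +
      (u' * f1 x1' + v' * f2 a' + f3 (P.φ (x1, a))) - (u * f1 x1 + v * f2 a + f3 (P.φ (x1, a))) := by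
      ring
    rw [this]
    have t1 : |(u - u') * f1 x1'| ≤ P.K * (P.K ^ 2 * ε) * 2 := by
      rw [abs_mul]; gcongr; exact b1 _
    have t2 : |(v - v') * f2 a'| ≤ P.K * (P.K ^ 2 * ε) * 2 := by
      rw [abs_mul]; gcongr; exact b2 _
    rw [abs_le] at t1 t2 e1 e2 ⊢
    constructor <;> nlinarith
  have : u / v * (f1 x1' - f1 x1) + (f2 a' - f2 a) =
      (u * (f1 x1' - f1 x1) + v * (f2 a' - f2 a)) / v := by field_simp
  rw [this, abs_div, div_le_iff₀ (abs_pos.2 hA0)]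
  have hv : 1 ≤ P.K * |v| := by
    calc 1 = P.K * P.K⁻¹ := by field_simp
      _ ≤ _ := by gcongr
  have h0 : 0 ≤ (4 * P.K ^ 3 + 2 * K0) * ε := (abs_nonneg _).trans key
  calc _ ≤ _ := key
    _ ≤ (4 * P.K ^ 3 + 2 * K0) * ε * (P.K * |v|) := le_mul_of_one_le_right h0 hv
    _ = _ := by ring

theorem ratio {x : ℝ × ℝ} (hx : x ∈ P.I1 ×ˢ P.I2) :
    |P.A1 x / P.A2 x| ≤ P.K ^ 2 ∧ (P.K ^ 2)⁻¹ ≤ |P.A1 x / P.A2 x| := by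
  have hK := P.hK
  have hK0 : 0 < P.K := by linarith
  obtain ⟨a, b⟩ := P.hA1 x hx
  obtain ⟨c, d⟩ := P.hA2 x hx
  have hi : 0 < P.K⁻¹ := by positivity
  have hp : 0 < |P.A2 x| := by linarith
  rw [abs_div]
  constructor
  · calc _ ≤ P.K / P.K⁻¹ := by gcongr
      _ = _ := by field_simp
  · calc (P.K ^ 2)⁻¹ = P.K⁻¹ / P.K := by field_simp
      _ ≤ _ := by gcongr

/-- edges with large increment -/
def EL (S : Set (ℝ × ℝ)) (ε : ℝ) (f1 : ℝ → ℝ) (σ : ℝ) : Set ((ℝ × ℝ) × ℝ) :=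
  P.E0 S ε ∩ {e | ε ^ (1 - σ) < |f1 e.1.1 - f1 e.1.2|}

theorem mEL {S : Set (ℝ × ℝ)} (hS : MeasurableSet S) (ε : ℝ) {f1 : ℝ → ℝ} (hf : Measurable f1)
    (σ : ℝ) : MeasurableSet (P.EL S ε f1 σ) :=
  (P.mE0 hS ε).inter (measurableSet_lt measurable_const (by fun_prop))

set_option maxHeartbeats 1000000 in
theorem pathfacts {S : Set (ℝ × ℝ)} (hSQ : S ⊆ P.I1 ×ˢ P.I2) {ε K0 σ : ℝ} (hε : 0 < ε)
    {f1 f2 f3 : ℝ → ℝ} (b1 : ∀ y, |f1 y| ≤ 2) (b2 : ∀ y, |f2 y| ≤ 2)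
    (hS : ∀ x ∈ S, |P.A1 x * f1 x.1 + P.A2 x * f2 x.2 + f3 (P.φ x)| ≤ K0 * ε)
    {x1 x1' a b d : ℝ} (h : ((((x1, x1'), a), b), d) ∈ P.paths (P.EL S ε f1 σ)) :
    x1 ∈ P.I1 ∧ x1' ∈ P.I1 ∧ a ∈ P.I2 ∧ b ∈ P.I1 ∧ d ∈ P.I2 ∧ |x1 - x1'| ≤ ε ∧ x1 ≠ x1' ∧
    |P.ξ (P.ζ (P.ξ (x1', P.φ (x1, a)), P.φ (b, a)), P.φ (b, d)) - d| ≤ P.K ^ 6 * |x1' - x1| ∧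
    |P.A1 (x1, a) / P.A2 (x1, a) * (P.A1 (b, d) / P.A2 (b, d)) / (P.A1 (b, a) / P.A2 (b, a)) -
      (-(f2 (P.ξ (P.ζ (P.ξ (x1', P.φ (x1, a)), P.φ (b, a)), P.φ (b, d))) - f2 d) /
        (f1 x1' - f1 x1))| ≤
      (2 * P.K ^ 4 + 1) * (P.K * (4 * P.K ^ 3 + 2 * K0)) * ε ^ σ := by
  obtain ⟨h1, h2, h3⟩ := h
  simp only at h1 h2 h3
  have hK := P.hK
  have hK0 : 0 < P.K := by linarith
  set a' := P.ξ (x1', P.φ (x1, a)) with ha'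
  set b' := P.ζ (a', P.φ (b, a)) with hb'
  set d' := P.ξ (b', P.φ (b, d)) with hd'
  have g1 := P.e0facts hSQ hε h1.1
  have g2 := P.e0facts hSQ hε h2.1
  have g3 := P.e0facts hSQ hε h3.1
  have i1 := P.edge hSQ hε b1 b2 hS h1.1
  have i2 := P.edge hSQ hε b1 b2 hS h2.1
  have i3 := P.edge hSQ hε b1 b2 hS h3.1
  have hba : P.ξ (b', P.φ (b, a)) = a' := by
    have q1 := P.hζ2 b g2.1 a g2.2.2.1 a' g1.2.2.2.1
    have q2 := P.hξ b' g2.2.1 a' g1.2.2.2.1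
    rw [q1] at q2
    exact q2
  rw [hba] at i2 g2
  have hne : f1 x1' - f1 x1 ≠ 0 := by
    intro h0
    have := h1.2
    simp only [mem_setOf_eq] at this
    rw [abs_sub_comm, h0, abs_zero] at this
    have : 0 < ε ^ (1 - σ) := by positivity
    linarith
  refine ⟨g1.1, g1.2.1, g1.2.2.1, g2.1, g3.2.2.1, g1.2.2.2.2.2.1, ?_, ?_, ?_⟩
  · rintro rfl; simp at hne
  · have t1 : |b - b'| ≤ P.K ^ 2 * |a - a'| := by
      have q1 := (P.lip1 b g2.1 b' g2.2.1 a' g1.2.2.2.1).2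
      have q2 := (P.lip2 b g2.1 a g2.2.2.1 a' g1.2.2.2.1).1
      rw [g2.2.2.2.2.1, abs_sub_comm] at q1
      have q1 : |b' - b| ≤ P.K * |P.φ (b, a') - P.φ (b, a)| := by
        rw [abs_sub_comm (P.φ (b, a')), abs_sub_comm b']; rwa [abs_sub_comm b', abs_sub_comm (P.φ (b, a'))] at q1
      rw [abs_sub_comm b, abs_sub_comm (P.φ (b, a)) ] at *
      calc _ ≤ _ := q1
        _ ≤ P.K * (P.K * |a - a'|) := by gcongr
        _ = _ := by ring
    have t2 := g3.2.2.2.2.2.2.2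
    have t3 := g1.2.2.2.2.2.2.2
    rw [abs_sub_comm d', abs_sub_comm x1']
    calc _ ≤ _ := t2
      _ ≤ P.K ^ 2 * (P.K ^ 2 * (P.K ^ 2 * |x1 - x1'|)) := by
        have := t1.trans (mul_le_mul_of_nonneg_left t3 (by positivity))
        gcongr
      _ = _ := by ring
  · obtain ⟨r1, -⟩ := P.ratio (x := (x1, a)) ⟨g1.1, g1.2.2.1⟩
    obtain ⟨r2, r2'⟩ := P.ratio (x := (b, a)) ⟨g2.1, g2.2.2.1⟩
    obtain ⟨r3, -⟩ := P.ratio (x := (b, d)) ⟨g3.1, g3.2.2.1⟩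
    set ra := P.A1 (x1, a) / P.A2 (x1, a)
    set rb := P.A1 (b, a) / P.A2 (b, a)
    set rd := P.A1 (b, d) / P.A2 (b, d)
    set F1 := f1 x1' - f1 x1
    set κ := P.K * (4 * P.K ^ 3 + 2 * K0)
    have hrb : 0 < |rb| := lt_of_lt_of_le (by positivity) r2'
    have hrb0 : rb ≠ 0 := abs_pos.1 hrb
    have hq : |rd / rb| ≤ P.K ^ 4 := by
      rw [abs_div]
      calc _ ≤ P.K ^ 2 / (P.K ^ 2)⁻¹ := by gcongr
        _ = _ := by field_simp
    have e : (ra * rd / rb) * F1 + (f2 d' - f2 d) = rd / rb * (ra * F1 + (f2 a' - f2 a)) -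
        rd / rb * (rb * (f1 b' - f1 b) + (f2 a' - f2 a)) +
        (rd * (f1 b' - f1 b) + (f2 d' - f2 d)) := by field_simp; ring
    have hb : |(ra * rd / rb) * F1 + (f2 d' - f2 d)| ≤ (2 * P.K ^ 4 + 1) * κ * ε := by
      rw [e]
      have q1 : |rd / rb * (ra * F1 + (f2 a' - f2 a))| ≤ P.K ^ 4 * (κ * ε) := by
        rw [abs_mul]; gcongr
      have q2 : |rd / rb * (rb * (f1 b' - f1 b) + (f2 a' - f2 a))| ≤ P.K ^ 4 * (κ * ε) := by
        rw [abs_mul]; gcongr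
      rw [abs_le] at q1 q2 i3 ⊢
      constructor <;> nlinarith
    have e2 : ra * rd / rb - (-(f2 d' - f2 d) / F1) = ((ra * rd / rb) * F1 + (f2 d' - f2 d)) / F1 := by
      field_simp; ring
    have hF : ε ^ (1 - σ) ≤ |F1| := by
      have := h1.2
      simp only [mem_setOf_eq] at this
      rw [abs_sub_comm] at this; exact this.le
    have hεσ : ε ^ σ * ε ^ (1 - σ) = ε := by
      rw [← Real.rpow_add hε]; norm_num
    have h0 : 0 ≤ (2 * P.K ^ 4 + 1) * κ := by
      have := (abs_nonneg _).trans hb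
      by_contra hneg
      push Not at hneg
      nlinarith
    rw [e2, abs_div, div_le_iff₀ (abs_pos.2 hne)]
    calc _ ≤ _ := hb
      _ = (2 * P.K ^ 4 + 1) * κ * ε ^ σ * ε ^ (1 - σ) := by
          conv_rhs => rw [mul_assoc, hεσ]
      _ ≤ _ := by gcongr

set_option maxHeartbeats 1000000 in
theorem step4 {S : Set (ℝ × ℝ)} (hSm : MeasurableSet S) (hSQ : S ⊆ P.I1 ×ˢ P.I2) {ε K0 σ : ℝ}
    (hε : 0 < ε) (hK00 : 0 ≤ K0)
    {f1 f2 f3 : ℝ → ℝ} (m1 : Measurable f1) (m2 : Measurable f2)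
    (b1 : ∀ y, |f1 y| ≤ 2) (b2 : ∀ y, |f2 y| ≤ 2)
    (hS : ∀ x ∈ S, |P.A1 x * f1 x.1 + P.A2 x * f2 x.2 + f3 (P.φ x)| ≤ K0 * ε)
    {s : ℝ} (hs : 0 < s) (hs1 : s ≤ 1) (hsε : 2 * P.K * ε ≤ s) :
    volume (P.paths (P.EL S ε f1 σ)) ≤ ENNReal.ofReal (2 * P.K * s ^ P.γ * ε) +
      ENNReal.ofReal (288 * P.K ^ 10 * ((2 * P.K ^ 4 + 1) * (P.K * (4 * P.K ^ 3 + 2 * K0))) *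
        ε ^ σ / s ^ 4 * ε) := by
  have hK := P.hK
  have hK0 : 0 < P.K := by linarith
  have := P.mJ
  have mE := P.mEL hSm ε m1 σ
  have mP := P.m_paths mE
  have hpf := fun {x1 x1' a b d : ℝ} => P.pathfacts (x1 := x1) (x1' := x1') (a := a) (b := b)
    (d := d) hSQ hε b1 b2 hS (σ := σ)
  set Pa := P.paths (P.EL S ε f1 σ) with hPa
  set κ := (2 * P.K ^ 4 + 1) * (P.K * (4 * P.K ^ 3 + 2 * K0)) with hκ
  have hκ0 : 0 ≤ κ := by positivity
  set Bad : Set ((((ℝ × ℝ) × ℝ) × ℝ) × ℝ) :=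
    Pa ∩ {w | |P.J (((w.1.1.1.1, w.1.1.2), w.1.2), w.2)| < s} with hBad
  set Good : Set ((((ℝ × ℝ) × ℝ) × ℝ) × ℝ) :=
    Pa ∩ {w | s ≤ |P.J (((w.1.1.1.1, w.1.1.2), w.1.2), w.2)|} with hGood
  have mGood : MeasurableSet Good := mP.inter (measurableSet_le measurable_const (by fun_prop))
  have hsplit : Pa ⊆ Bad ∪ Good := by
    intro w hw
    rcases lt_or_ge |P.J (((w.1.1.1.1, w.1.1.2), w.1.2), w.2)| s with h | h
    · exact Or.inl ⟨hw, h⟩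
    · exact Or.inr ⟨hw, h⟩
  refine (measure_mono hsplit).trans ((measure_union_le _ _).trans (add_le_add ?_ ?_))
  · -- bad part
    set B4 : Set (((ℝ × ℝ) × ℝ) × ℝ) := {p : ((ℝ × ℝ) × ℝ) × ℝ |
      p.1.1.1 ∈ P.I1 ∧ p.1.1.2 ∈ P.I2 ∧ p.1.2 ∈ P.I1 ∧ p.2 ∈ P.I2 ∧ |P.J p| < s} with hB4
    have mB4 : MeasurableSet B4 := by
      apply MeasurableSet.inter
      · exact (by fun_prop : Measurable fun p : ((ℝ × ℝ) × ℝ) × ℝ => p.1.1.1) P.mI1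
      apply MeasurableSet.inter
      · exact (by fun_prop : Measurable fun p : ((ℝ × ℝ) × ℝ) × ℝ => p.1.1.2) P.mI2
      apply MeasurableSet.inter
      · exact (by fun_prop : Measurable fun p : ((ℝ × ℝ) × ℝ) × ℝ => p.1.2) P.mI1
      apply MeasurableSet.inter
      · exact (by fun_prop : Measurable fun p : ((ℝ × ℝ) × ℝ) × ℝ => p.2) P.mI2
      · exact measurableSet_lt (f := fun p : ((ℝ × ℝ) × ℝ) × ℝ => |P.J p|) (by fun_prop) measurable_const
    set Z : Set ((((ℝ × ℝ) × ℝ) × ℝ) × ℝ) := {w | w.1 ∈ B4 ∧ |w.1.1.1.1 - w.2| ≤ ε} with hZ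
    have mZ : MeasurableSet Z := (measurable_fst mB4).inter
      (measurableSet_le (f := fun w : (((ℝ × ℝ) × ℝ) × ℝ) × ℝ => |w.1.1.1.1 - w.2|)
        (by fun_prop) measurable_const)
    have vZ : volume Z ≤ ENNReal.ofReal (2 * ε) * volume B4 := by
      refine prod_upper mZ mB4 (fun w hw => hw.1) ?_
      intro p _
      refine (measure_mono (t := Icc (p.1.1.1 - ε) (p.1.1.1 + ε)) ?_).trans ?_
      · rintro y ⟨_, hy⟩
        simp only [abs_le] at hy
        constructor <;> linarith
      · rw [Real.volume_Icc]; apply ENNReal.ofReal_le_ofReal; linarith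
    have mp : MeasurePreserving (fun w : (((ℝ × ℝ) × ℝ) × ℝ) × ℝ =>
        ((((w.1.1.1.1, w.1.1.2), w.1.2), w.2), w.1.1.1.2)) volume volume := by
      have q1 : MeasurePreserving (Prod.map (Prod.map (rsw : (ℝ × ℝ) × ℝ → (ℝ × ℝ) × ℝ)
        (id : ℝ → ℝ)) (id : ℝ → ℝ)) volume volume := mp_rsw_id.prod (MeasurePreserving.id volume)
      have q2 := mp_rsw_id (X := ℝ × ℝ) (Y := ℝ) (Z := ℝ) (W := ℝ)
      have q3 := mp_rsw (X := (ℝ × ℝ) × ℝ) (Y := ℝ) (Z := ℝ)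
      exact q3.comp (q2.comp q1)
    calc volume Bad ≤ volume ((fun w : (((ℝ × ℝ) × ℝ) × ℝ) × ℝ =>
        ((((w.1.1.1.1, w.1.1.2), w.1.2), w.2), w.1.1.1.2)) ⁻¹' Z) := by
          apply measure_mono
          rintro ⟨⟨⟨⟨x1, x1'⟩, a⟩, b⟩, d⟩ ⟨hw, hw'⟩
          have := hpf hw
          exact ⟨⟨this.1, this.2.2.1, this.2.2.2.1, this.2.2.2.2.1, hw'⟩, this.2.2.2.2.2.1⟩
      _ = volume Z := mp.measure_preimage mZ.nullMeasurableSet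
      _ ≤ ENNReal.ofReal (2 * ε) * ENNReal.ofReal (P.K * s ^ P.γ) := by
          refine vZ.trans ?_
          gcongr
          exact P.sub s hs
      _ = _ := by
          rw [← ENNReal.ofReal_mul (by positivity)]; congr 1; ring
  · -- good part
    obtain ⟨mst, vst⟩ := vStrip P.mI1 P.vI1 (ε := ε)
    set st := {p : ℝ × ℝ | p.1 ∈ P.I1 ∧ |p.1 - p.2| ≤ ε} with hst
    set back : ((ℝ × ℝ) × ℝ) × (ℝ × ℝ) → (((ℝ × ℝ) × ℝ) × ℝ) × ℝ :=
      fun w => (((w.1.1, w.2.1), w.2.2), w.1.2) with hback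
    have mback : Measurable back := by fun_prop
    set Z := back ⁻¹' Good with hZ
    have mZ : MeasurableSet Z := mback mGood
    have mp : MeasurePreserving (fun w : (((ℝ × ℝ) × ℝ) × ℝ) × ℝ =>
        ((w.1.1.1, w.2), (w.1.1.2, w.1.2))) volume volume := by
      have q1 := mp_rsw (X := (ℝ × ℝ) × ℝ) (Y := ℝ) (Z := ℝ)
      have q2 := mp_rsw_id (X := ℝ × ℝ) (Y := ℝ) (Z := ℝ) (W := ℝ)
      have q3 : MeasurePreserving (MeasurableEquiv.prodAssoc :
        (((ℝ × ℝ) × ℝ) × ℝ) × ℝ ≃ᵐ ((ℝ × ℝ) × ℝ) × ℝ × ℝ) volume volume :=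
          volume_preserving_prodAssoc
      exact q3.comp (q2.comp q1)
    have e1 : volume Good = volume Z := by
      rw [← mp.measure_preimage mZ.nullMeasurableSet]; rfl
    set Bd : ℝ := (3 / (s / (2 * P.K))) * (3 / (s / (2 * P.K))) *
      ((P.K / s) ^ 2 * ((2 * (κ * ε ^ σ)) * (2 * P.K ^ 6))) with hBd
    have mbase : MeasurableSet (st ×ˢ P.I2) := mst.prod P.mI2
    have vZ : volume Z ≤ ENNReal.ofReal Bd * volume (st ×ˢ P.I2) := by
      refine prod_upper mZ mbase ?_ ?_
      · rintro ⟨⟨⟨x1, x1'⟩, d⟩, ⟨a, b⟩⟩ ⟨hw, _⟩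
        have := hpf hw
        exact ⟨⟨this.1, this.2.2.2.2.2.1⟩, this.2.2.2.2.1⟩
      · rintro ⟨⟨x1, x1'⟩, d⟩ -
        by_cases hne : x1 = x1'
        · have : Prod.mk ((x1, x1'), d) ⁻¹' Z = ∅ := by
            ext ⟨a, b⟩; simp only [mem_preimage, mem_empty_iff_false, iff_false]
            rintro ⟨hw, _⟩
            exact (hpf hw).2.2.2.2.2.2.1 hne
          rw [this]; simp
        have hδ := P.hδ
        have hδ1 := P.hδ1
        have ht : x1' - x1 ≠ 0 := sub_ne_zero.2 (Ne.symm hne)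
        set D : ℝ × ℝ → ℝ := fun z =>
          P.ξ (P.ζ (P.ξ (x1', P.φ (x1, z.1)), P.φ (z.2, z.1)), P.φ (z.2, d)) with hD
        set Ψ : ℝ × ℝ → ℝ := fun z => P.A1 (x1, z.1) / P.A2 (x1, z.1) *
          (P.A1 (z.2, d) / P.A2 (z.2, d)) / (P.A1 (z.2, z.1) / P.A2 (z.2, z.1)) with hΨ
        have hdt : ∀ z, d + (x1' - x1) * ((D z - d) / (x1' - x1)) = D z := by
          intro z; field_simp; ring
        have hc := count2 (α := P.c2 - P.δ) (β := P.c2 + P.δ) (α' := P.c1 - P.δ) (β' := P.c1 + P.δ)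
          (ρ := s / (2 * P.K)) (by positivity) (by
            rw [div_le_one (by positivity)]; linarith) (by linarith) (by linarith) (by linarith)
          (by linarith) (Prod.mk ((x1, x1'), d) ⁻¹' Z) (by
            rintro ⟨a, b⟩ ⟨hw, _⟩
            have := hpf hw
            exact ⟨this.2.2.1, this.2.2.2.1⟩)
          (fun z => ((D z - d) / (x1' - x1), Ψ z)) (P.K / s) (by positivity) (by
            rintro ⟨a, b⟩ ⟨hw, hJ⟩ ⟨u, v⟩ ⟨hw', hJ'⟩ hdist
            have g1 := hpf hw
            have g2 := hpf hw'
            have hJ : s ≤ |P.J (((x1, a), b), d)| := hJ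
            have hk : P.K * (|x1' - x1| + dist (a, b) (u, v)) ≤ s := by
              have h1 : |x1' - x1| ≤ s / (2 * P.K) := by
                rw [abs_sub_comm, le_div_iff₀ (by positivity)]
                calc _ ≤ ε * (2 * P.K) := by
                      have := g1.2.2.2.2.2.1
                      gcongr
                  _ ≤ _ := by linarith
              calc _ ≤ P.K * (s / (2 * P.K) + s / (2 * P.K)) := by gcongr
                _ = s := by field_simp; ring
            have := P.tlip x1 g1.1 x1' g1.2.1 hne d g1.2.2.2.2.1 a g1.2.2.1 b g1.2.2.2.1
              u g2.2.2.1 v g2.2.2.2.1 s hs hJ hk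
            have hF : dist ((D (a, b) - d) / (x1' - x1), Ψ (a, b))
                ((D (u, v) - d) / (x1' - x1), Ψ (u, v)) =
                max (|D (a, b) - D (u, v)| / |x1' - x1|) |Ψ (a, b) - Ψ (u, v)| := by
              rw [Prod.dist_eq, Real.dist_eq, Real.dist_eq, ← sub_div, abs_div]
              congr 3; ring
            rw [hF, div_mul_eq_mul_div, le_div_iff₀ hs, mul_comm]
            exact this)
          (fun h => -(f2 (d + (x1' - x1) * h) - f2 d) / (f1 x1' - f1 x1)) (by fun_prop)
          (P.K ^ 6) (κ * ε ^ σ) (by positivity) (by positivity) (by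
            rintro ⟨a, b⟩ ⟨hw, _⟩
            have g := hpf hw
            constructor
            · simp only
              rw [abs_div, div_le_iff₀ (abs_pos.2 ht)]
              exact g.2.2.2.2.2.2.2.1
            · simp only
              rw [hdt]
              exact g.2.2.2.2.2.2.2.2)
        refine hc.trans (le_of_eq ?_)
        have e2 : ENNReal.ofReal (P.K / s) ^ (2 : ℝ) = ENNReal.ofReal ((P.K / s) ^ 2) := by
          rw [ENNReal.ofReal_pow (by positivity)]; norm_num
        rw [e2, hBd, ← ENNReal.ofReal_mul (by positivity), ← ENNReal.ofReal_mul (by positivity),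
          ← ENNReal.ofReal_mul (by positivity), ← ENNReal.ofReal_mul (by positivity)]
    rw [e1]
    refine vZ.trans ?_
    have vb : volume (st ×ˢ P.I2) ≤ ENNReal.ofReal (2 * ε) := by
      rw [Measure.volume_eq_prod, Measure.prod_prod]
      calc _ ≤ ENNReal.ofReal (2 * ε) * 1 := by
            gcongr
            exact P.vI2
        _ = _ := mul_one _
    calc _ ≤ ENNReal.ofReal Bd * ENNReal.ofReal (2 * ε) := by gcongr
      _ = _ := by
        rw [← ENNReal.ofReal_mul (by positivity)]
        congr 1
        rw [hBd]; field_simp; ring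

end Pkg

theorem pow_conv {p q X : ℝ} (hp : 0 < p) (hX : 0 ≤ X) {C η ε : ℝ} (hη : 0 ≤ η)
    (hε : 0 < ε) (hε1 : ε ≤ 1) (hC : 0 < C) (hC1 : X ^ (1 / p) ≤ C) (hC2 : p / q ≤ C) (hq : 0 < q)
    (h : η ^ p ≤ X * ε ^ q) : η ≤ C * ε ^ (1 / C) := by
  have h1 : η = (η ^ p) ^ (1 / p) := by
    rw [← Real.rpow_mul hη]; field_simp; simp
  rw [h1]
  calc (η ^ p) ^ (1 / p) ≤ (X * ε ^ q) ^ (1 / p) := by gcongr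
    _ = X ^ (1 / p) * ε ^ (q / p) := by
      rw [Real.mul_rpow hX (by positivity), ← Real.rpow_mul hε.le]; congr 2; ring
    _ ≤ C * ε ^ (1 / C) := by
      gcongr ?_ * ?_
      apply Real.rpow_le_rpow_of_exponent_ge hε hε1
      rw [div_le_iff₀ hq] at hC2
      rw [div_le_div_iff₀ hC hp]; linarith

namespace Pkg
variable (P : Pkg)

set_option maxHeartbeats 1000000 in
theorem comb {K0 σ : ℝ} (hK00 : 0 ≤ K0) (hσ : 0 < σ) : ∃ C : ℝ, 1 ≤ C ∧ ∀ ε : ℝ, 0 < ε → ε ≤ 1 →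
    ∀ f1 f2 f3 : ℝ → ℝ, Measurable f1 → Measurable f2 → (∀ y, |f1 y| ≤ 2) → (∀ y, |f2 y| ≤ 2) →
    ∀ S : Set (ℝ × ℝ), MeasurableSet S → S ⊆ P.I1 ×ˢ P.I2 →
    (∀ x ∈ S, |P.A1 x * f1 x.1 + P.A2 x * f2 x.2 + f3 (P.φ x)| ≤ K0 * ε) →
    volume S ≤ ENNReal.ofReal (C * ε ^ (1 / C)) ∨ ∃ y : ℤ → ℝ,
      ENNReal.ofReal (C⁻¹ * (volume S).toReal ^ C) ≤
        volume {x ∈ S | |f1 (y ⌊x.1 / ε⌋) - f1 x.1| ≤ ε ^ (1 - σ)} := by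
  have hK := P.hK
  have hK0 : 0 < P.K := by linarith
  have hγ := P.hγ
  set c5 : ℝ := 1 / (48 ^ 3 * 128 * P.K ^ 20) with hc5
  have c5pos : 0 < c5 := by positivity
  have c5le : c5 ≤ 1 := by
    rw [hc5, div_le_one (by positivity)]
    have : 1 ≤ P.K ^ 20 := one_le_pow₀ hK
    linarith
  set X := 288 * P.K ^ 10 * ((2 * P.K ^ 4 + 1) * (P.K * (4 * P.K ^ 3 + 2 * K0))) with hX
  have hX0 : 0 ≤ X := by positivity
  set pB := 6 + 24 / P.γ with hpB
  have hpB0 : 0 < pB := by positivity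
  set XB := 2 * X / c5 / (c5 / (4 * P.K)) ^ (4 / P.γ) with hXB
  have hXB0 : 0 ≤ XB := by positivity
  set XA := (4 * P.K / c5) * (2 * P.K) ^ P.γ with hXA
  have hXA0 : 0 ≤ XA := by positivity
  set C := 48 * P.K ^ 4 + 2 + XA ^ (1 / (6 : ℝ)) + 6 / P.γ + XB ^ (1 / pB) + pB / σ with hC
  have hk4 : 1 ≤ P.K ^ 4 := one_le_pow₀ hK
  have n1 : 0 ≤ XA ^ (1 / (6 : ℝ)) := by positivity
  have n2 : 0 ≤ 6 / P.γ := by positivity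
  have n3 : 0 ≤ XB ^ (1 / pB) := by positivity
  have n4 : 0 ≤ pB / σ := by positivity
  have hC1 : 1 ≤ C := by linarith
  have hC0 : 0 < C := by linarith
  refine ⟨C, hC1, ?_⟩
  intro ε hε hε1 f1 f2 f3 m1 m2 b1 b2 S mS hSQ hS
  have hvS : volume S ≤ 1 := by
    refine (measure_mono hSQ).trans ?_
    rw [Measure.volume_eq_prod, Measure.prod_prod]
    calc _ ≤ (1 : ℝ≥0∞) * 1 := mul_le_mul' P.vI1 P.vI2
      _ = 1 := mul_one _
  have hfS : volume S ≠ ∞ := ne_top_of_le_ne_top ENNReal.one_ne_top hvS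
  set η := (volume S).toReal with hη
  have hηS : volume S = ENNReal.ofReal η := (ENNReal.ofReal_toReal hfS).symm
  have hη0 : 0 ≤ η := ENNReal.toReal_nonneg
  have hη1 : η ≤ 1 := by
    have := ENNReal.toReal_mono ENNReal.one_ne_top hvS
    simpa using this
  rcases hη0.eq_or_lt with h0 | hηp
  · left; rw [hηS, ← h0]; simp
  have hE0 := P.step1 mS hSQ hε hε1 hη0 hηS.ge
  set M : ℝ := η ^ 2 / (48 * P.K ^ 4) with hM
  have hM0 : 0 ≤ M := by positivity
  have hEfin : volume (P.E0 S ε) ≠ ∞ := by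
    have : volume (P.E0 S ε) ≤ volume ((P.I1 ×ˢ P.I1) ×ˢ P.I2) := by
      apply measure_mono
      rintro ⟨⟨x, x'⟩, a⟩ he
      have := P.e0facts hSQ hε he
      exact ⟨⟨this.1, this.2.1⟩, this.2.2.1⟩
    refine ne_top_of_le_ne_top ?_ this
    rw [Measure.volume_eq_prod, Measure.prod_prod, Measure.volume_eq_prod, Measure.prod_prod]
    have h1 := ne_top_of_le_ne_top ENNReal.one_ne_top P.vI1
    exact ENNReal.mul_ne_top (ENNReal.mul_ne_top h1 h1)
      (ne_top_of_le_ne_top ENNReal.one_ne_top P.vI2)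
  set G : Set ((ℝ × ℝ) × ℝ) := P.E0 S ε ∩ {e | |f1 e.1.1 - f1 e.1.2| ≤ ε ^ (1 - σ)} with hG
  have mG : MeasurableSet G := (P.mE0 mS ε).inter (measurableSet_le
    (f := fun e : (ℝ × ℝ) × ℝ => |f1 e.1.1 - f1 e.1.2|) (by fun_prop) measurable_const)
  by_cases hcase : ENNReal.ofReal (M * ε) ≤ volume G
  · right
    obtain ⟨y, hy⟩ := choose_reps hε S G mG f1 (ε ^ (1 - σ))
      (fun e he => ⟨he.1.1, he.1.2.2.2, he.2⟩)
      (ne_top_of_le_ne_top hEfin (measure_mono inter_subset_left)) mS m1 hcase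
    refine ⟨y, le_trans (ENNReal.ofReal_le_ofReal ?_) hy⟩
    have h1 : η ^ C ≤ η ^ (2 : ℝ) := Real.rpow_le_rpow_of_exponent_ge hηp hη1 (by linarith)
    have h2 : C⁻¹ ≤ (48 * P.K ^ 4)⁻¹ := by gcongr; linarith
    calc _ ≤ (48 * P.K ^ 4)⁻¹ * η ^ (2 : ℝ) := by gcongr
      _ = M := by rw [hM, Real.rpow_two]; field_simp
  left
  push Not at hcase
  have hEL : ENNReal.ofReal (M * ε) ≤ volume (P.EL S ε f1 σ) := by
    have hsub : P.E0 S ε ⊆ P.EL S ε f1 σ ∪ G := by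
      intro e he
      rcases lt_or_ge (ε ^ (1 - σ)) |f1 e.1.1 - f1 e.1.2| with h | h
      · exact Or.inl ⟨he, h⟩
      · exact Or.inr ⟨he, h⟩
    have h1 := hE0.trans ((measure_mono hsub).trans (measure_union_le _ _))
    have h2 : ENNReal.ofReal (M * ε) + ENNReal.ofReal (M * ε) ≤
        volume (P.EL S ε f1 σ) + ENNReal.ofReal (M * ε) := by
      rw [← ENNReal.ofReal_add (by positivity) (by positivity)]
      refine le_trans (le_of_eq ?_) (h1.trans (by gcongr))
      congr 1; rw [hM]; field_simp; ring
    exact (ENNReal.add_le_add_iff_right ENNReal.ofReal_ne_top).1 h2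
  have hp := P.step3 hSQ hε hM0 (P.mEL mS ε m1 σ) (fun e he => he.1) hEL
  have hpe : M ^ 3 * ε / (128 * P.K ^ 8) = c5 * η ^ 6 * ε := by
    rw [hM, hc5]; field_simp
  rw [hpe] at hp
  rw [hηS]
  apply ENNReal.ofReal_le_ofReal
  set s0 := c5 * η ^ 6 / (4 * P.K) with hs0
  have hs00 : 0 < s0 := by positivity
  have hs01 : s0 ≤ 1 := by
    rw [hs0, div_le_one (by positivity)]
    have : η ^ 6 ≤ 1 := pow_le_one₀ hη0 hη1
    have : c5 * η ^ 6 ≤ 1 := mul_le_one₀ c5le (by positivity) this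
    linarith
  set s := s0 ^ (1 / P.γ) with hs
  have hsp : 0 < s := by positivity
  have hs1 : s ≤ 1 := Real.rpow_le_one hs00.le hs01 (by positivity)
  have hsγ : s ^ P.γ = s0 := by
    rw [hs, ← Real.rpow_mul hs00.le]; field_simp; simp
  have hη6 : η ^ (6 : ℝ) = η ^ 6 := by
    rw [← Real.rpow_natCast]; norm_num
  rcases le_or_gt (2 * P.K * ε) s with hle | hlt
  · have h4 := hp.trans (P.step4 mS hSQ hε hK00 m1 m2 b1 b2 hS hsp hs1 hle (σ := σ))
    rw [← ENNReal.ofReal_add (by positivity) (by positivity),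
      ENNReal.ofReal_le_ofReal_iff (by positivity), hsγ, ← hX] at h4
    have h5 : c5 * η ^ 6 * ε ≤ (2 * P.K * s0 + X * ε ^ σ / s ^ 4) * ε := by linarith
    have h6 := le_of_mul_le_mul_right h5 hε
    have h7 : 2 * P.K * s0 = c5 * η ^ 6 / 2 := by rw [hs0]; field_simp; ring
    rw [h7] at h6
    have h8 : c5 * η ^ 6 / 2 ≤ X * ε ^ σ / s ^ 4 := by linarith
    rw [le_div_iff₀ (by positivity)] at h8
    have h9 : s ^ 4 = (c5 / (4 * P.K)) ^ (4 / P.γ) * η ^ (24 / P.γ) := by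
      rw [hs, ← Real.rpow_natCast, ← Real.rpow_mul hs00.le, hs0]
      rw [show c5 * η ^ 6 / (4 * P.K) = c5 / (4 * P.K) * η ^ 6 by ring,
        Real.mul_rpow (by positivity) (by positivity), ← hη6, ← Real.rpow_mul hη0]
      congr 2
      · push_cast; ring
      · push_cast; ring
    refine pow_conv hpB0 hXB0 (q := σ) hη0 hε hε1 hC0 (by linarith) (by linarith) hσ ?_
    rw [hpB, Real.rpow_add hηp, hη6]
    rw [h9] at h8
    set V := (c5 / (4 * P.K)) ^ (4 / P.γ) with hV
    have hVp : 0 < V := by positivity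
    rw [hXB]
    rw [div_div, div_mul_eq_mul_div, le_div_iff₀ (by positivity)]
    linarith
  · refine pow_conv (by norm_num : (0 : ℝ) < 6) hXA0 (q := P.γ) hη0 hε hε1 hC0
      (by linarith) (by linarith) hγ ?_
    rw [hη6, hXA]
    have h1 : s0 ≤ (2 * P.K * ε) ^ P.γ := by
      rw [← hsγ]; gcongr
    rw [Real.mul_rpow (by positivity) hε.le] at h1
    have h2 : η ^ 6 = (4 * P.K / c5) * s0 := by rw [hs0]; field_simp
    rw [h2, mul_assoc]
    gcongr

end Pkg

section an
variable {E F : Type*} [NormedAddCommGroup E] [NormedSpace ℝ E]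
  [NormedAddCommGroup F] [NormedSpace ℝ F]

theorem fderiv_dir_an {f : E → ℝ} {x : E} (h : AnalyticAt ℝ f x) (e : E) :
    AnalyticAt ℝ (fun y => fderiv ℝ f y e) x :=
  ((ContinuousLinearMap.apply ℝ ℝ e).analyticAt _).comp h.fderiv

theorem an_lip [CompleteSpace F] {f : E → F} {x : E} (h : AnalyticAt ℝ f x) :
    ∃ K r : ℝ, 0 < K ∧ 0 < r ∧ ∀ y ∈ Metric.ball x r, ∀ z ∈ Metric.ball x r,
      ‖f y - f z‖ ≤ K * ‖y - z‖ := by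
  obtain ⟨K, t, ht, hK⟩ := (h.contDiffAt (n := 1)).exists_lipschitzOnWith
  obtain ⟨r, hr, hrt⟩ := Metric.mem_nhds_iff.1 ht
  refine ⟨K + 1, r, by positivity, hr, fun y hy z hz => ?_⟩
  have := hK.norm_sub_le (hrt hy) (hrt hz)
  refine this.trans ?_
  gcongr; linarith

theorem an_ball {f : E → ℝ} {x : E} (h : AnalyticAt ℝ f x) :
    ∃ r : ℝ, 0 < r ∧ ∀ y ∈ Metric.ball x r, AnalyticAt ℝ f y := by
  obtain ⟨r, hr, hrt⟩ := Metric.mem_nhds_iff.1 h.eventually_analyticAt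
  exact ⟨r, hr, fun y hy => hrt hy⟩

/-- second order Taylor -/
theorem lemB {f : E → ℝ} {x : E} (h : AnalyticAt ℝ f x) :
    ∃ K r : ℝ, 0 < K ∧ 0 < r ∧ ∀ y ∈ Metric.ball x r, ∀ z ∈ Metric.ball x r,
      ‖f z - f y - fderiv ℝ f y (z - y)‖ ≤ K * ‖z - y‖ ^ 2 := by
  obtain ⟨K, r1, hK, hr1, h1⟩ := an_lip h.fderiv
  obtain ⟨r2, hr2, h2⟩ := an_ball h
  refine ⟨K, min r1 r2, hK, lt_min hr1 hr2, fun y hy z hz => ?_⟩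
  have hseg : segment ℝ y z ⊆ Metric.ball x (min r1 r2) :=
    (convex_ball x _).segment_subset hy hz
  have := (convex_segment y z).norm_image_sub_le_of_norm_hasFDerivWithin_le' (f := f)
    (f' := fderiv ℝ f) (φ := fderiv ℝ f y) (C := K * ‖z - y‖) (x := y) (y := z) (𝕜 := ℝ)
    (fun u hu => ((h2 u (Metric.ball_subset_ball (min_le_right _ _) (hseg hu))).differentiableAt.hasFDerivAt).hasFDerivWithinAt)
    (fun u hu => by
      refine (h1 u (Metric.ball_subset_ball (min_le_left _ _) (hseg hu)) y
        (Metric.ball_subset_ball (min_le_left _ _) hy)).trans ?_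
      have : ‖u - y‖ ≤ ‖z - y‖ := by
        obtain ⟨θ, hθ, rfl⟩ := (segment_eq_image' ℝ y z) ▸ hu
        simp only [add_sub_cancel_left, norm_smul, Real.norm_eq_abs, abs_of_nonneg hθ.1]
        exact mul_le_of_le_one_left (norm_nonneg _) hθ.2
      gcongr)
    (left_mem_segment ℝ y z) (right_mem_segment ℝ y z)
  refine this.trans (le_of_eq ?_)
  ring

theorem hasDeriv_t {T : E × ℝ → ℝ} {w : E} {t : ℝ} (h : AnalyticAt ℝ T (w, t)) :
    HasDerivAt (fun τ => T (w, τ)) (fderiv ℝ T (w, t) (0, 1)) t := by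
  have h1 : HasFDerivAt T (fderiv ℝ T (w, t)) (w, t) := h.differentiableAt.hasFDerivAt
  have h2 : HasDerivAt (fun τ : ℝ => (w, τ)) ((0 : E), (1 : ℝ)) t :=
    (hasDerivAt_const t w).prodMk (hasDerivAt_id t)
  exact h1.comp_hasDerivAt t h2

theorem mvt0 {g g' : ℝ → ℝ} {t C : ℝ} (hC : 0 ≤ C) (h0 : g 0 = 0)
    (hd : ∀ τ, |τ| ≤ |t| → HasDerivAt g (g' τ) τ) (hb : ∀ τ, |τ| ≤ |t| → |g' τ| ≤ C) :
    |g t| ≤ C * |t| := by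
  have hm : ∀ τ, τ ∈ Icc (-|t|) |t| ↔ |τ| ≤ |t| := fun τ => by rw [abs_le]; rfl
  have := (convex_Icc (-|t|) |t|).norm_image_sub_le_of_norm_hasDerivWithin_le (f := g) (f' := g')
    (C := C) (x := 0) (y := t)
    (fun τ hτ => (hd τ ((hm τ).1 hτ)).hasDerivWithinAt) (fun τ hτ => hb τ ((hm τ).1 hτ))
    (by rw [hm]; simp) (by rw [hm])
  simpa [h0] using this

theorem lemA {T : E × ℝ → ℝ} {w0 : E} (h : AnalyticAt ℝ T (w0, 0))
    (h0 : ∀ᶠ w in nhds w0, T (w, 0) = 0) :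
    ∃ K r : ℝ, 0 < K ∧ 0 < r ∧ ∀ w ∈ Metric.ball w0 r, ∀ w' ∈ Metric.ball w0 r, ∀ t, |t| < r →
      |T (w, t) - T (w', t) - t * (fderiv ℝ T (w, 0) (0, 1) - fderiv ℝ T (w', 0) (0, 1))| ≤
        K * |t| ^ 2 * ‖w - w'‖ := by
  set h1 : E × ℝ → ℝ := fun p => fderiv ℝ T p (0, 1) with hh1
  have a1 : AnalyticAt ℝ h1 (w0, 0) := fderiv_dir_an h _
  set h2 : E × ℝ → ℝ := fun p => fderiv ℝ h1 p (0, 1) with hh2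
  have a2 : AnalyticAt ℝ h2 (w0, 0) := fderiv_dir_an a1 _
  obtain ⟨K, r1, hK, hr1, l2⟩ := an_lip a2
  obtain ⟨r2, hr2, b1⟩ := an_ball h
  obtain ⟨r3, hr3, b2⟩ := an_ball a1
  obtain ⟨r4, hr4, b4⟩ := Metric.mem_nhds_iff.1 h0
  refine ⟨K, min (min r1 r2) (min r3 r4), hK, by positivity, ?_⟩
  intro w hw w' hw' t ht
  simp only [Metric.mem_ball, lt_min_iff] at hw hw' ht
  have hball : ∀ (v : E) (r : ℝ), dist v w0 < r → ∀ τ, |τ| ≤ |t| → |t| < r → (v, τ) ∈ Metric.ball (w0, (0:ℝ)) r := by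
    intro v r hv τ hτ ht
    rw [Metric.mem_ball, Prod.dist_eq, max_lt_iff]
    exact ⟨hv, by simpa [Real.dist_eq] using hτ.trans_lt ht⟩
  have s1 : ∀ τ, |τ| ≤ |t| → |h1 (w, τ) - h1 (w', τ) - (h1 (w, 0) - h1 (w', 0))| ≤
      K * ‖w - w'‖ * |t| := by
    intro τ hτ
    have := mvt0 (g := fun τ => h1 (w, τ) - h1 (w', τ) - (h1 (w, 0) - h1 (w', 0)))
      (g' := fun τ => h2 (w, τ) - h2 (w', τ)) (t := τ) (C := K * ‖w - w'‖) (by positivity)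
      (by simp) (fun u hu => by
        have hu := hu.trans hτ
        exact ((hasDeriv_t (b2 _ (hball w r3 hw.2.1 u hu ht.2.1))).sub
          (hasDeriv_t (b2 _ (hball w' r3 hw'.2.1 u hu ht.2.1)))).sub_const _)
      (fun u hu => by
        have hu := hu.trans hτ
        have := l2 _ (hball w r1 hw.1.1 u hu ht.1.1) _ (hball w' r1 hw'.1.1 u hu ht.1.1)
        simpa [Prod.norm_def] using this)
    exact this.trans (by gcongr)
  have := mvt0 (g := fun τ => T (w, τ) - T (w', τ) - τ * (h1 (w, 0) - h1 (w', 0)))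
      (g' := fun τ => h1 (w, τ) - h1 (w', τ) - 1 * (h1 (w, 0) - h1 (w', 0))) (t := t)
      (C := K * ‖w - w'‖ * |t|) (by positivity)
      (by simp only [zero_mul, sub_zero]; rw [b4 hw.2.2, b4 hw'.2.2]; simp) (fun u hu => by
        exact ((hasDeriv_t (b1 _ (hball w r2 hw.1.2 u hu ht.1.2))).sub
          (hasDeriv_t (b1 _ (hball w' r2 hw'.1.2 u hu ht.1.2)))).sub
            ((hasDerivAt_id u).mul_const _))
      (fun u hu => by rw [one_mul]; exact s1 u hu)
  refine this.trans (le_of_eq ?_)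
  ring

end an

abbrev W4 := ((ℝ × ℝ) × ℝ) × ℝ

def ea : W4 := (((0, 1), 0), 0)
def eb : W4 := (((0, 0), 1), 0)

/-- Jacobian in the `(a,b)` variables -/
def jac (R Ψ : W4 → ℝ) (w : W4) : ℝ :=
  fderiv ℝ R w ea * fderiv ℝ Ψ w eb - fderiv ℝ R w eb * fderiv ℝ Ψ w ea

theorem jac_an {R Ψ : W4 → ℝ} {w : W4} (hR : AnalyticAt ℝ R w) (hΨ : AnalyticAt ℝ Ψ w) :
    AnalyticAt ℝ (jac R Ψ) w :=
  ((fderiv_dir_an hR _).mul (fderiv_dir_an hΨ _)).sub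
    ((fderiv_dir_an hR _).mul (fderiv_dir_an hΨ _))

theorem dir_bd {f : W4 → ℝ} {x : W4} (h : AnalyticAt ℝ f x) (e : W4) :
    ∃ K r : ℝ, 0 < K ∧ 0 < r ∧ ∀ y ∈ Metric.ball x r, |fderiv ℝ f y e| ≤ K := by
  have h1 : AnalyticAt ℝ (fun y => fderiv ℝ f y e) x := fderiv_dir_an h _
  have h2 : ∀ᶠ y in nhds x, |fderiv ℝ f y e| < |fderiv ℝ f x e| + 1 :=
    (h1.continuousAt.abs).eventually_lt continuousAt_const (by simp)
  obtain ⟨r, hr, hrt⟩ := Metric.mem_nhds_iff.1 h2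
  exact ⟨_, r, by positivity, hr, fun y hy => (hrt hy).le⟩


theorem tlip_real {K1 K2 K3 k L t ρ α β Ra Rb Ya Yb ΔT ΔR ΔΨ μ s : ℝ}
    (hK1 : 0 < K1) (hK2 : 0 < K2) (hK3 : 0 < K3) (hk0 : 0 < k) (hL : L = K1 + K2 + K3)
    (hρ0 : 0 ≤ ρ) (hρm : ρ = max |α| |β|) (htp : 0 < |t|)
    (i1 : |ΔT - t * ΔR| ≤ K1 * |t| ^ 2 * ρ)
    (i2 : |-ΔR - (α * Ra + β * Rb)| ≤ K2 * ρ ^ 2)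
    (i3 : |-ΔΨ - (α * Ya + β * Yb)| ≤ K3 * ρ ^ 2)
    (j1 : |Ra| ≤ k) (j2 : |Rb| ≤ k) (j3 : |Ya| ≤ k) (j4 : |Yb| ≤ k)
    (hμ1 : |ΔT| / |t| ≤ μ) (m2 : |ΔΨ| ≤ μ)
    (hJ : s ≤ |Ra * Yb - Rb * Ya|)
    (hKs : (1 + 4 * k + 4 * k * L) * (|t| + ρ) ≤ s) :
    s * ρ ≤ 4 * k * μ := by
  have hL0 : 0 < L := by rw [hL]; positivity
  have m1 : |ΔR| ≤ μ + K1 * |t| * ρ := by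
    have h1 : |t| * |ΔR| ≤ |ΔT| + K1 * |t| ^ 2 * ρ := by
      rw [← abs_mul]
      have e : t * ΔR = ΔT - (ΔT - t * ΔR) := by ring
      rw [e]
      exact (abs_sub _ _).trans (by gcongr)
    have h2 : |ΔT| ≤ |t| * μ := by
      rw [div_le_iff₀ htp] at hμ1
      linarith
    have h3 : |t| * |ΔR| ≤ |t| * (μ + K1 * |t| * ρ) := by nlinarith
    exact le_of_mul_le_mul_left h3 htp
  have hμ0 : 0 ≤ μ := (abs_nonneg _).trans m2
  have hB : |t| * ρ + ρ ^ 2 = (|t| + ρ) * ρ := by ring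
  obtain ⟨Q, hQ⟩ : ∃ Q, Q = (|t| + ρ) * ρ := ⟨_, rfl⟩
  have hQ0 : 0 ≤ Q := by rw [hQ]; positivity
  have hQ1 : |t| * ρ ≤ Q := by rw [hQ, ← hB]; nlinarith [sq_nonneg ρ]
  have hQ2 : ρ ^ 2 ≤ Q := by rw [hQ, ← hB]; nlinarith [mul_nonneg htp.le hρ0]
  have n1 : |α * Ra + β * Rb| ≤ μ + L * Q := by
    rw [abs_le] at i2 m1 ⊢
    have : K1 * |t| * ρ ≤ K1 * Q := by rw [mul_assoc]; gcongr
    have : K2 * ρ ^ 2 ≤ K2 * Q := by gcongr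
    have : 0 ≤ K3 * Q := by positivity
    have : L * Q = K1 * Q + K2 * Q + K3 * Q := by rw [hL]; ring
    constructor <;> linarith
  have n2 : |α * Ya + β * Yb| ≤ μ + L * Q := by
    rw [abs_le] at i3 m2 ⊢
    have : K3 * ρ ^ 2 ≤ K3 * Q := by gcongr
    have : 0 ≤ K1 * Q := by positivity
    have : 0 ≤ K2 * Q := by positivity
    have : L * Q = K1 * Q + K2 * Q + K3 * Q := by rw [hL]; ring
    constructor <;> linarith
  obtain ⟨N, hN⟩ : ∃ N, N = μ + L * Q := ⟨_, rfl⟩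
  rw [← hN] at n1 n2
  have hN0 : 0 ≤ N := by rw [hN]; positivity
  have o1 : |Ra * Yb - Rb * Ya| * |α| ≤ 2 * k * N := by
    have e : (Ra * Yb - Rb * Ya) * α = (α * Ra + β * Rb) * Yb - (α * Ya + β * Yb) * Rb := by ring
    rw [← abs_mul, e]
    calc _ ≤ |(α * Ra + β * Rb) * Yb| + |(α * Ya + β * Yb) * Rb| := abs_sub _ _
      _ ≤ N * k + N * k := by
        rw [abs_mul, abs_mul]; gcongr
      _ = _ := by ring
  have o2 : |Ra * Yb - Rb * Ya| * |β| ≤ 2 * k * N := by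
    have e : (Ra * Yb - Rb * Ya) * β = (α * Ya + β * Yb) * Ra - (α * Ra + β * Rb) * Ya := by ring
    rw [← abs_mul, e]
    calc _ ≤ |(α * Ya + β * Yb) * Ra| + |(α * Ra + β * Rb) * Ya| := abs_sub _ _
      _ ≤ N * k + N * k := by
        rw [abs_mul, abs_mul]; gcongr
      _ = _ := by ring
  have o3 : s * ρ ≤ 2 * k * N := by
    calc s * ρ ≤ |Ra * Yb - Rb * Ya| * ρ := by gcongr
      _ ≤ _ := by
        rw [hρm]
        rcases max_choice |α| |β| with h | h <;> rw [h] <;> assumption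
  have o4 : 4 * k * L * Q ≤ s * ρ := by
    have h1 : 4 * k * L * (|t| + ρ) ≤ s := by
      refine le_trans ?_ hKs
      gcongr
      linarith
    calc 4 * k * L * Q = (4 * k * L * (|t| + ρ)) * ρ := by rw [hQ]; ring
      _ ≤ _ := by gcongr
  have : 2 * k * N = 2 * k * μ + 2 * k * L * Q := by rw [hN]; ring
  linarith

theorem w4_norm (x1 a b d u v : ℝ) :
    ‖((((x1, u), v), d) : W4) - (((x1, a), b), d)‖ = dist (a, b) (u, v) := by
  rw [← dist_eq_norm, dist_comm]
  simp only [Prod.dist_eq, dist_self]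
  rw [max_eq_right (a := (0:ℝ)) dist_nonneg, max_eq_left]
  exact le_max_of_le_left dist_nonneg

theorem w4_dec (x1 a b d u v : ℝ) :
    ((((x1, u), v), d) : W4) - (((x1, a), b), d) = (u - a) • ea + (v - b) • eb := by
  simp [ea, eb]

theorem tlip_an {T : W4 × ℝ → ℝ} {w0 : W4} (hT : AnalyticAt ℝ T (w0, 0)) :
    AnalyticAt ℝ (fun w => fderiv ℝ T (w, 0) (0, 1)) w0 := by
  have h1 : AnalyticAt ℝ (fun p => fderiv ℝ T p (0, 1)) (w0, (0:ℝ)) := fderiv_dir_an hT _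
  exact AnalyticAt.fun_comp (f := fun w : W4 => (w, (0:ℝ))) h1 (analyticAt_id.prod analyticAt_const)

theorem tlip_core0 {T : W4 × ℝ → ℝ} {R Ψ : W4 → ℝ} {w0 : W4} (aR : AnalyticAt ℝ R w0)
    (hΨ : AnalyticAt ℝ Ψ w0)
    (hq : ∃ K r : ℝ, 0 < K ∧ 0 < r ∧ ∀ w ∈ Metric.ball w0 r, ∀ w' ∈ Metric.ball w0 r, ∀ t, |t| < r →
      |T (w, t) - T (w', t) - t * (R w - R w')| ≤ K * |t| ^ 2 * ‖w - w'‖) :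
    ∃ K r : ℝ, 1 ≤ K ∧ 0 < r ∧ ∀ x1 a b d u v t s : ℝ,
      (((x1, a), b), d) ∈ Metric.ball w0 r → (((x1, u), v), d) ∈ Metric.ball w0 r → |t| < r → t ≠ 0 →
      0 < s → s ≤ |jac R Ψ (((x1, a), b), d)| →
      K * (|t| + dist (a, b) (u, v)) ≤ s →
      s * dist (a, b) (u, v) ≤ K * max
        (|T ((((x1, a), b), d), t) - T ((((x1, u), v), d), t)| / |t|)
        |Ψ (((x1, a), b), d) - Ψ (((x1, u), v), d)| := by
  obtain ⟨K1, r1, hK1, hr1, q1⟩ := hq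
  obtain ⟨K2, r2, hK2, hr2, q2⟩ := lemB aR
  obtain ⟨K3, r3, hK3, hr3, q3⟩ := lemB hΨ
  obtain ⟨k1, s1, hk1, hs1, p1⟩ := dir_bd aR ea
  obtain ⟨k2, s2, hk2, hs2, p2⟩ := dir_bd aR eb
  obtain ⟨k3, s3, hk3, hs3, p3⟩ := dir_bd hΨ ea
  obtain ⟨k4, s4, hk4, hs4, p4⟩ := dir_bd hΨ eb
  obtain ⟨k, hk⟩ : ∃ k, k = k1 + k2 + k3 + k4 := ⟨_, rfl⟩
  have hk0 : 0 < k := by rw [hk]; positivity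
  obtain ⟨L, hL⟩ : ∃ L, L = K1 + K2 + K3 := ⟨_, rfl⟩
  have hL0 : 0 < L := by rw [hL]; positivity
  have hkL := mul_pos hk0 hL0
  refine ⟨1 + 4 * k + 4 * k * L, min (min r1 (min r2 r3)) (min (min s1 s2) (min s3 s4)), ?_,
    lt_min (lt_min hr1 (lt_min hr2 hr3)) (lt_min (lt_min hs1 hs2) (lt_min hs3 hs4)), ?_⟩
  · nlinarith
  intro x1 a b d u v t s hw hw' ht ht0 hs hJ hKs
  rw [Metric.mem_ball, lt_min_iff, lt_min_iff, lt_min_iff, lt_min_iff, lt_min_iff, lt_min_iff] at hw hw'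
  rw [lt_min_iff, lt_min_iff] at ht
  have hnw := w4_norm x1 a b d u v
  have hdec := w4_dec x1 a b d u v
  have hρ0 : 0 ≤ dist (a, b) (u, v) := dist_nonneg
  have hρm : dist (a, b) (u, v) = max |u - a| |v - b| := by
    rw [Prod.dist_eq, Real.dist_eq, Real.dist_eq, abs_sub_comm a, abs_sub_comm b]
  revert hρ0 hρm hnw hKs hdec hJ hw hw'
  generalize dist (a, b) (u, v) = ρ
  generalize ((((x1, a), b), d) : W4) = w
  generalize ((((x1, u), v), d) : W4) = w'
  intro hw hw' hJ hKs hnw hdec hρ0 hρm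
  have i1 := q1 w hw.1.1 w' hw'.1.1 t ht.1.1
  have i2 := q2 w hw.1.2.1 w' hw'.1.2.1
  have i3 := q3 w hw.1.2.2 w' hw'.1.2.2
  rw [norm_sub_rev, hnw] at i1
  rw [hnw, hdec, map_add, map_smul, map_smul, smul_eq_mul, smul_eq_mul, Real.norm_eq_abs] at i2 i3
  rw [← neg_sub] at i2 i3
  have j1 := p1 w hw.2.1.1
  have j2 := p2 w hw.2.1.2
  have j3 := p3 w hw.2.2.1
  have j4 := p4 w hw.2.2.2
  have := tlip_real hK1 hK2 hK3 hk0 hL hρ0 hρm (abs_pos.2 ht0) i1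
    (by rw [neg_sub] at i2 ⊢; simpa using i2) (by rw [neg_sub] at i3 ⊢; simpa using i3)
    (j1.trans (by linarith)) (j2.trans (by linarith))
    (j3.trans (by linarith)) (j4.trans (by linarith)) (le_max_left _ _) (le_max_right _ _) hJ hKs
  refine this.trans ?_
  gcongr
  linarith

theorem tlip_core {T : W4 × ℝ → ℝ} {Ψ : W4 → ℝ} {w0 : W4} (hT : AnalyticAt ℝ T (w0, 0))
    (h0 : ∀ᶠ w in nhds w0, T (w, 0) = 0) (hΨ : AnalyticAt ℝ Ψ w0) :
    ∃ K r : ℝ, 1 ≤ K ∧ 0 < r ∧ ∀ x1 a b d u v t s : ℝ,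
      (((x1, a), b), d) ∈ Metric.ball w0 r → (((x1, u), v), d) ∈ Metric.ball w0 r → |t| < r → t ≠ 0 →
      0 < s → s ≤ |jac (fun w => fderiv ℝ T (w, 0) (0, 1)) Ψ (((x1, a), b), d)| →
      K * (|t| + dist (a, b) (u, v)) ≤ s →
      s * dist (a, b) (u, v) ≤ K * max
        (|T ((((x1, a), b), d), t) - T ((((x1, u), v), d), t)| / |t|)
        |Ψ (((x1, a), b), d) - Ψ (((x1, u), v), d)| :=
  tlip_core0 (tlip_an hT) hΨ (lemA hT h0)

theorem an_fst {E F G : Type*} [NormedAddCommGroup E] [NormedSpace ℝ E] [NormedAddCommGroup F]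
    [NormedSpace ℝ F] [NormedAddCommGroup G] [NormedSpace ℝ G] {f : E → F × G} {x : E}
    (h : AnalyticAt ℝ f x) : AnalyticAt ℝ (fun p => (f p).1) x := analyticAt_fst.fun_comp h

theorem an_snd {E F G : Type*} [NormedAddCommGroup E] [NormedSpace ℝ E] [NormedAddCommGroup F]
    [NormedSpace ℝ F] [NormedAddCommGroup G] [NormedSpace ℝ G] {f : E → F × G} {x : E}
    (h : AnalyticAt ℝ f x) : AnalyticAt ℝ (fun p => (f p).2) x := analyticAt_snd.fun_comp h

/-- analytic local inverse -/
theorem an_inv {E F : Type*} [NormedAddCommGroup E] [NormedSpace ℝ E] [CompleteSpace E]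
    [NormedAddCommGroup F] [NormedSpace ℝ F] [CompleteSpace F] {f : E → F} {x : E} (h : AnalyticAt ℝ f x)
    (e : E ≃L[ℝ] F) (he : fderiv ℝ f x = e) :
    ∃ g : F → E, AnalyticAt ℝ g (f x) ∧ g (f x) = x ∧ (∀ᶠ z in nhds x, g (f z) = z) ∧
      (∀ᶠ y in nhds (f x), f (g y) = y) := by
  have hs : HasStrictFDerivAt f (e : E →L[ℝ] F) x := by
    rw [← he]; exact h.hasStrictFDerivAt
  set P := hs.toOpenPartialHomeomorph f with hP
  have hx : x ∈ P.source := hs.mem_toOpenPartialHomeomorph_source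
  have hfx : f x ∈ P.target := hs.image_mem_toOpenPartialHomeomorph_target
  have hPf : ∀ z, P z = f z := fun z => rfl
  have hsx : P.symm (f x) = x := P.left_inv hx
  refine ⟨P.symm, ?_, hsx, ?_, ?_⟩
  · exact OpenPartialHomeomorph.analyticAt_symm' (i := e) P hx h he
  · filter_upwards [P.open_source.mem_nhds hx] with z hz using P.left_inv hz
  · filter_upwards [P.open_target.mem_nhds hfx] with y hy using P.right_inv hy

theorem meas_germ {E : Type*} [NormedAddCommGroup E] [NormedSpace ℝ E] [MeasurableSpace E] [BorelSpace E]
    {f : E → ℝ} {x : E} (h : AnalyticAt ℝ f x) :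
    ∃ g : E → ℝ, Measurable g ∧ g =ᶠ[nhds x] f := by
  obtain ⟨r, hr, hb⟩ := an_ball h
  refine ⟨(Metric.ball x r).indicator f, ?_, ?_⟩
  · have : ContinuousOn f (Metric.ball x r) := fun y hy => (hb y hy).continuousAt.continuousWithinAt
    classical
    have h2 := this.measurable_piecewise (g := (0 : E → ℝ)) continuousOn_const measurableSet_ball
    rwa [Set.piecewise_eq_indicator] at h2
  · filter_upwards [Metric.ball_mem_nhds x hr] with y hy
    simp [hy]

theorem ift2 {φ : ℝ × ℝ → ℝ} {c : ℝ × ℝ} (h : AnalyticAt ℝ φ c) (h2 : fderiv ℝ φ c (0, 1) ≠ 0) :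
    ∃ ξ : ℝ × ℝ → ℝ, AnalyticAt ℝ ξ (c.1, φ c) ∧ ξ (c.1, φ c) = c.2 ∧
      (∀ᶠ x in nhds c, ξ (x.1, φ x) = x.2) ∧
      (∀ᶠ q in nhds (c.1, φ c), φ (q.1, ξ q) = q.2) := by
  set F : ℝ × ℝ → ℝ × ℝ := fun x => (x.1, φ x) with hF
  have aF : AnalyticAt ℝ F c := analyticAt_fst.prod h
  set D : ℝ × ℝ →L[ℝ] ℝ × ℝ := (ContinuousLinearMap.fst ℝ ℝ ℝ).prod (fderiv ℝ φ c) with hD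
  have hDF : fderiv ℝ F c = D := by
    exact (hasFDerivAt_fst.prodMk h.differentiableAt.hasFDerivAt).fderiv
  have hinj : Function.Injective D := by
    rw [injective_iff_map_eq_zero]
    rintro ⟨u, v⟩ huv
    simp only [hD, ContinuousLinearMap.prod_apply, ContinuousLinearMap.coe_fst', Prod.mk_eq_zero] at huv
    obtain ⟨rfl, hv⟩ := huv
    have : ((0:ℝ), v) = v • ((0:ℝ), (1:ℝ)) := by simp
    rw [this, map_smul, smul_eq_mul, mul_eq_zero] at hv
    rcases hv with rfl | hv
    · rfl
    · exact absurd hv h2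
  let e : (ℝ × ℝ) ≃L[ℝ] (ℝ × ℝ) := (LinearEquiv.ofInjectiveEndo (D : ℝ × ℝ →ₗ[ℝ] ℝ × ℝ) hinj).toContinuousLinearEquiv
  have he : fderiv ℝ F c = e := by
    rw [hDF]; rfl
  obtain ⟨g, ga, gx, g1, g2⟩ := an_inv aF e he
  refine ⟨fun q => (g q).2, analyticAt_snd.fun_comp ga, congrArg Prod.snd gx, ?_, ?_⟩
  · filter_upwards [g1] with x hx
    exact congrArg Prod.snd hx
  · filter_upwards [g2] with q hq
    have hq' : F (g q) = q := hq
    have h1 : (g q).1 = q.1 := (Prod.ext_iff.1 hq').1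
    have h2 : φ (g q) = q.2 := (Prod.ext_iff.1 hq').2
    rw [← h1]; exact h2

def TT (φ ξ ζ : ℝ × ℝ → ℝ) (p : W4 × ℝ) : ℝ :=
  ξ (ζ (ξ (p.1.1.1.1 + p.2, φ (p.1.1.1.1, p.1.1.1.2)), φ (p.1.1.2, p.1.1.1.2)), φ (p.1.1.2, p.1.2)) - p.1.2

def PP (A1 A2 : ℝ × ℝ → ℝ) (w : W4) : ℝ :=
  A1 (w.1.1.1, w.1.1.2) / A2 (w.1.1.1, w.1.1.2) * (A1 (w.1.2, w.2) / A2 (w.1.2, w.2)) /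
    (A1 (w.1.2, w.1.1.2) / A2 (w.1.2, w.1.1.2))

/-- analytic data at a base point -/
structure Base (φ ξ ζ A1 A2 : ℝ × ℝ → ℝ) (c : ℝ × ℝ) : Prop where
  aφ : AnalyticAt ℝ φ c
  aξ : AnalyticAt ℝ ξ (c.1, φ c)
  aζ : AnalyticAt ℝ ζ (c.2, φ c)
  aA1 : AnalyticAt ℝ A1 c
  aA2 : AnalyticAt ℝ A2 c
  nA1 : A1 c ≠ 0
  nA2 : A2 c ≠ 0
  ξc : ξ (c.1, φ c) = c.2
  ζc : ζ (c.2, φ c) = c.1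
  hξ : ∀ᶠ x in nhds c, ξ (x.1, φ x) = x.2
  hζ : ∀ᶠ x in nhds c, ζ (x.2, φ x) = x.1
  hζ2 : ∀ᶠ q in nhds (c.2, φ c), φ (ζ q, q.1) = q.2

theorem an_comp2 {E : Type*} [NormedAddCommGroup E] [NormedSpace ℝ E] {f : ℝ × ℝ → ℝ}
    {u v : E → ℝ} {w : E} {y z : ℝ} (hf : AnalyticAt ℝ f (y, z)) (hu : AnalyticAt ℝ u w)
    (hv : AnalyticAt ℝ v w) (hy : u w = y) (hz : v w = z) :
    AnalyticAt ℝ (fun w => f (u w, v w)) w := by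
  subst hy hz
  exact AnalyticAt.fun_comp (g := f) (f := fun w => (u w, v w)) hf (hu.prod hv)

theorem abs_eq_bound {A : ℝ × ℝ → ℝ} {c : ℝ × ℝ} (h : AnalyticAt ℝ A c) (h0 : A c ≠ 0) :
    ∃ K r : ℝ, 1 ≤ K ∧ 0 < r ∧ (∀ x ∈ Metric.ball c r, |A x| ≤ K ∧ K⁻¹ ≤ |A x|) ∧
     ∀ x ∈ Metric.ball c r, ∀ y ∈ Metric.ball c r, |A x - A y| ≤ K * dist x y := by
  obtain ⟨K, r1, hK, hr1, h1⟩ := an_lip h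
  have hp : 0 < |A c| := abs_pos.2 h0
  have e1 : ∀ᶠ x in nhds c, |A x| < |A c| + 1 :=
    (h.continuousAt.abs).eventually_lt continuousAt_const (by simp)
  have e2 : ∀ᶠ x in nhds c, |A c| / 2 < |A x| :=
    continuousAt_const.eventually_lt (h.continuousAt.abs) (by linarith)
  obtain ⟨r2, hr2, h2⟩ := Metric.mem_nhds_iff.1 (e1.and e2)
  refine ⟨1 + K + |A c| + 2 / |A c|, min r1 r2, ?_, lt_min hr1 hr2, ?_, ?_⟩
  · have : 0 < 2 / |A c| := by positivity
    linarith
  · intro x hx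
    have h3 := h2 (Metric.ball_subset_ball (min_le_right _ _) hx)
    have : 0 < 2 / |A c| := by positivity
    refine ⟨by linarith [h3.1], ?_⟩
    refine le_trans ?_ h3.2.le
    rw [inv_le_comm₀ (by positivity) (by positivity)]
    rw [inv_div]; linarith
  · intro x hx y hy
    have := h1 x (Metric.ball_subset_ball (min_le_left _ _) hx) y (Metric.ball_subset_ball (min_le_left _ _) hy)
    rw [Real.norm_eq_abs, ← dist_eq_norm] at this
    refine this.trans ?_
    have : 0 < 2 / |A c| := by positivity
    gcongr; linarith

theorem Base.aT {φ ξ ζ A1 A2 : ℝ × ℝ → ℝ} {c1 c2 : ℝ} (B : Base φ ξ ζ A1 A2 (c1, c2)) :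
    AnalyticAt ℝ (TT φ ξ ζ) ((((c1, c2), c1), c2), 0) := by
  unfold TT
  have f1 : AnalyticAt ℝ (fun p : W4 × ℝ => p.1.1.1.1) ((((c1, c2), c1), c2), 0) := (an_fst (an_fst (an_fst (an_fst analyticAt_id))))
  have f2 : AnalyticAt ℝ (fun p : W4 × ℝ => p.1.1.1.2) ((((c1, c2), c1), c2), 0) := (an_snd (an_fst (an_fst (an_fst analyticAt_id))))
  have f3 : AnalyticAt ℝ (fun p : W4 × ℝ => p.1.1.2) ((((c1, c2), c1), c2), 0) := (an_snd (an_fst (an_fst analyticAt_id)))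
  have f4 : AnalyticAt ℝ (fun p : W4 × ℝ => p.1.2) ((((c1, c2), c1), c2), 0) := (an_snd (an_fst analyticAt_id))
  have f5 : AnalyticAt ℝ (fun p : W4 × ℝ => p.2) ((((c1, c2), c1), c2), 0) := (an_snd analyticAt_id)
  have e1 : (fun p : W4 × ℝ => p.1.1.1.1 + p.2) ((((c1, c2), c1), c2), 0) = c1 := by simp
  have B1 := B.aξ
  have B2 := B.aζ
  have B3 := B.aφ
  have c3 := B.ξc
  have c4 := B.ζc
  simp only at B1 B2 B3 c3 c4
  refine AnalyticAt.fun_sub ?_ f4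
  refine an_comp2 B1 (an_comp2 B2 (an_comp2 B1 (f1.add f5) (an_comp2 B3 f1 f2 rfl rfl) ?_ rfl)
    (an_comp2 B3 f3 f2 rfl rfl) ?_ rfl) (an_comp2 B3 f3 f4 rfl rfl) ?_ rfl
  · simp
  · simpa using c3
  · simp [c3, c4]

theorem Base.T0 {φ ξ ζ A1 A2 : ℝ × ℝ → ℝ} {c1 c2 : ℝ} (B : Base φ ξ ζ A1 A2 (c1, c2)) :
    ∀ᶠ w in nhds ((((c1, c2), c1), c2) : W4), TT φ ξ ζ (w, 0) = 0 := by
  have t1 : Filter.Tendsto (fun w : W4 => (w.1.1.1, w.1.1.2)) (nhds ((((c1, c2), c1), c2) : W4)) (nhds (c1, c2)) :=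
    (by fun_prop : Continuous (fun w : W4 => (w.1.1.1, w.1.1.2))).tendsto' _ _ rfl
  have t2 : Filter.Tendsto (fun w : W4 => (w.1.2, w.1.1.2)) (nhds ((((c1, c2), c1), c2) : W4)) (nhds (c1, c2)) :=
    (by fun_prop : Continuous (fun w : W4 => (w.1.2, w.1.1.2))).tendsto' _ _ rfl
  have t3 : Filter.Tendsto (fun w : W4 => (w.1.2, w.2)) (nhds ((((c1, c2), c1), c2) : W4)) (nhds (c1, c2)) :=
    (by fun_prop : Continuous (fun w : W4 => (w.1.2, w.2))).tendsto' _ _ rfl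
  filter_upwards [t1.eventually B.hξ, t2.eventually B.hζ, t3.eventually B.hξ] with w h1 h2 h3
  simp only [TT, add_zero, h1, h2, h3, sub_self]

theorem Base.aP {φ ξ ζ A1 A2 : ℝ × ℝ → ℝ} {c1 c2 : ℝ} (B : Base φ ξ ζ A1 A2 (c1, c2)) :
    AnalyticAt ℝ (PP A1 A2) (((c1, c2), c1), c2) := by
  have f1 : AnalyticAt ℝ (fun p : W4 => p.1.1.1) (((c1, c2), c1), c2) := (an_fst (an_fst (an_fst analyticAt_id)))
  have f2 : AnalyticAt ℝ (fun p : W4 => p.1.1.2) (((c1, c2), c1), c2) := (an_snd (an_fst (an_fst analyticAt_id)))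
  have f3 : AnalyticAt ℝ (fun p : W4 => p.1.2) (((c1, c2), c1), c2) := (an_snd (an_fst analyticAt_id))
  have f4 : AnalyticAt ℝ (fun p : W4 => p.2) (((c1, c2), c1), c2) := (an_snd analyticAt_id)
  have n1 := B.nA1
  have n2 := B.nA2
  exact (((an_comp2 B.aA1 f1 f2 rfl rfl).div (an_comp2 B.aA2 f1 f2 rfl rfl) n2).mul
    ((an_comp2 B.aA1 f3 f4 rfl rfl).div (an_comp2 B.aA2 f3 f4 rfl rfl) n2)).div
    ((an_comp2 B.aA1 f3 f2 rfl rfl).div (an_comp2 B.aA2 f3 f2 rfl rfl) n2) (div_ne_zero n1 n2)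

def JJ (φ ξ ζ A1 A2 : ℝ × ℝ → ℝ) : W4 → ℝ :=
  jac (fun w => fderiv ℝ (TT φ ξ ζ) (w, 0) (0, 1)) (PP A1 A2)

theorem JJ_meas (φ ξ ζ A1 A2 : ℝ × ℝ → ℝ) : Measurable (JJ φ ξ ζ A1 A2) := by
  unfold JJ jac
  exact ((measurable_fderiv_apply_const ℝ _ _).mul (measurable_fderiv_apply_const ℝ _ _)).sub
    ((measurable_fderiv_apply_const ℝ _ _).mul (measurable_fderiv_apply_const ℝ _ _))

theorem mem_ball2 {c1 c2 x1 x2 δ r : ℝ} (h : δ < r) (h1 : x1 ∈ Icc (c1 - δ) (c1 + δ))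
    (h2 : x2 ∈ Icc (c2 - δ) (c2 + δ)) : (x1, x2) ∈ Metric.ball (c1, c2) r := by
  rw [Metric.mem_ball, Prod.dist_eq, max_lt_iff, Real.dist_eq, Real.dist_eq, abs_lt, abs_lt]
  simp only [mem_Icc] at h1 h2
  refine ⟨⟨?_, ?_⟩, ?_, ?_⟩ <;> dsimp only <;> linarith

theorem mem_ball4 {c1 c2 x1 x2 x3 x4 δ r : ℝ} (h : δ < r) (h1 : x1 ∈ Icc (c1 - δ) (c1 + δ))
    (h2 : x2 ∈ Icc (c2 - δ) (c2 + δ)) (h3 : x3 ∈ Icc (c1 - δ) (c1 + δ))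
    (h4 : x4 ∈ Icc (c2 - δ) (c2 + δ)) :
    ((((x1, x2), x3), x4) : W4) ∈ Metric.ball ((((c1, c2), c1), c2) : W4) r := by
  have a1 := mem_ball2 h h1 h2
  have a2 := mem_ball2 h h3 h4
  rw [Metric.mem_ball, Prod.dist_eq, max_lt_iff] at a1 a2 ⊢
  refine ⟨?_, a2.2⟩
  dsimp only at a1 a2 ⊢
  rw [Prod.dist_eq, max_lt_iff]
  refine ⟨?_, a2.1⟩
  dsimp only at a1 a2 ⊢
  rw [Prod.dist_eq, max_lt_iff]
  exact a1

theorem haarW4 : (volume : Measure W4).IsAddHaarMeasure := by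
  haveI h2 : (volume : Measure (ℝ × ℝ)).IsAddHaarMeasure := by
    rw [Measure.volume_eq_prod]; infer_instance
  haveI h3 : (volume : Measure ((ℝ × ℝ) × ℝ)).IsAddHaarMeasure := by
    rw [Measure.volume_eq_prod]; infer_instance
  rw [Measure.volume_eq_prod]; infer_instance

theorem pkg_exists {φ ξ ζ A1 A2 : ℝ × ℝ → ℝ} {c1 c2 : ℝ} (B : Base φ ξ ζ A1 A2 (c1, c2))
    (mφ : Measurable φ) (mξ : Measurable ξ) (mζ : Measurable ζ)
    (hJ : ¬ ∀ᶠ w in nhds ((((c1, c2), c1), c2) : W4), JJ φ ξ ζ A1 A2 w = 0) (δ0 : ℝ) (hδ0 : 0 < δ0) :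
    ∃ P : Pkg, P.c1 = c1 ∧ P.c2 = c2 ∧ P.φ = φ ∧ P.A1 = A1 ∧ P.A2 = A2 ∧ P.δ < δ0 := by
  obtain ⟨Kφ, r1, hKφ, hr1, l1⟩ := an_lip B.aφ
  obtain ⟨Kξ, r2, hKξ, hr2, l2⟩ := an_lip B.aξ
  obtain ⟨Kζ, r3, hKζ, hr3, l3⟩ := an_lip B.aζ
  obtain ⟨KA, r4, hKA, hr4, l4, l4'⟩ := abs_eq_bound B.aA1 B.nA1
  obtain ⟨KB, r5, hKB, hr5, l5, l5'⟩ := abs_eq_bound B.aA2 B.nA2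
  obtain ⟨KT, r6, hKT, hr6, l6⟩ := tlip_core B.aT B.T0 B.aP
  have aJ : AnalyticAt ℝ (JJ φ ξ ζ A1 A2) (((c1, c2), c1), c2) := jac_an (tlip_an B.aT) B.aP
  haveI := haarW4
  obtain ⟨r7, KJ, γ, hr7, hKJ, hγ, l7⟩ := sublevel_analytic volume aJ hJ
  have e1 : ∀ᶠ x in nhds (c1, c2), (x.1, φ x) ∈ Metric.ball (c1, φ (c1, c2)) r2 :=
    (continuousAt_fst.prodMk B.aφ.continuousAt).preimage_mem_nhds (Metric.ball_mem_nhds _ hr2)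
  have e2 : ∀ᶠ x in nhds (c1, c2), (x.2, φ x) ∈ Metric.ball (c2, φ (c1, c2)) r3 :=
    (continuousAt_snd.prodMk B.aφ.continuousAt).preimage_mem_nhds (Metric.ball_mem_nhds _ hr3)
  obtain ⟨r8, hr8, l8⟩ := Metric.mem_nhds_iff.1 B.hζ2
  have e3 : ∀ᶠ x in nhds (c1, c2), φ x ∈ Metric.ball (φ (c1, c2)) r8 :=
    (B.aφ.continuousAt).preimage_mem_nhds (Metric.ball_mem_nhds _ hr8)
  obtain ⟨r9, hr9, l9⟩ := Metric.mem_nhds_iff.1 (e1.and (e2.and (e3.and (B.hξ.and B.hζ))))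
  have pos : 0 < min (min (min r1 (min r4 r5)) (min (r6 / 2) r7)) (min (min r8 r9) (min δ0 (1/2))) := by
    refine lt_min (lt_min (lt_min hr1 (lt_min hr4 hr5)) (lt_min (by positivity) hr7))
      (lt_min (lt_min hr8 hr9) (lt_min hδ0 (by norm_num)))
  obtain ⟨δ, hδ, hδm⟩ := exists_between pos
  simp only [lt_min_iff] at hδm
  obtain ⟨⟨⟨d1, d4, d5⟩, d6, d7⟩, ⟨d8, d9⟩, d0, dh⟩ := hδm
  obtain ⟨K, hK⟩ : ∃ K, K = Kφ + Kξ + Kζ + KA + KB + KT + KJ := ⟨_, rfl⟩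
  have kφ : Kφ ≤ K := by linarith
  have kξ : Kξ ≤ K := by linarith
  have kζ : Kζ ≤ K := by linarith
  have kA : KA ≤ K := by linarith
  have kB : KB ≤ K := by linarith
  have kT : KT ≤ K := by linarith
  have kJ : KJ ≤ K := by linarith
  have k1 : 1 ≤ K := by linarith
  refine ⟨{ c1 := c1, c2 := c2, δ := δ, K := K, γ := γ, φ := φ, ξ := ξ, ζ := ζ, A1 := A1, A2 := A2,
            J := JJ φ ξ ζ A1 A2, hδ := hδ, hδ1 := dh.le, hK := k1, hγ := hγ,
            mφ := mφ, mξ := mξ, mζ := mζ, mJ := JJ_meas _ _ _ _ _, lip1 := ?_, lip2 := ?_, hξ := ?_, hζ := ?_,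
            hζ2 := ?_, hA1 := ?_, hA2 := ?_, lA1 := ?_, lA2 := ?_, tlip := ?_, sub := ?_ },
          rfl, rfl, rfl, rfl, rfl, d0⟩
  · intro x1 h1 x1' h1' x2 h2
    constructor
    · refine (l1 _ (mem_ball2 d1 h1 h2) _ (mem_ball2 d1 h1' h2)).trans ?_
      simp only [Prod.mk_sub_mk, sub_self, Prod.norm_def, norm_zero, Real.norm_eq_abs]
      rw [max_eq_left (abs_nonneg _)]; gcongr
    · have m := l9 (mem_ball2 d9 h1 h2)
      have m' := l9 (mem_ball2 d9 h1' h2)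
      have := l3 _ m.2.1 _ m'.2.1
      rw [m.2.2.2.2, m'.2.2.2.2] at this
      simp only [Prod.mk_sub_mk, sub_self, Prod.norm_def, norm_zero, Real.norm_eq_abs] at this
      rw [max_eq_right (abs_nonneg _)] at this
      exact this.trans (by gcongr)
  · intro x1 h1 x2 h2 x2' h2'
    constructor
    · refine (l1 _ (mem_ball2 d1 h1 h2) _ (mem_ball2 d1 h1 h2')).trans ?_
      simp only [Prod.mk_sub_mk, sub_self, Prod.norm_def, norm_zero, Real.norm_eq_abs]
      rw [max_eq_right (abs_nonneg _)]; gcongr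
    · have m := l9 (mem_ball2 d9 h1 h2)
      have m' := l9 (mem_ball2 d9 h1 h2')
      have := l2 _ m.1 _ m'.1
      rw [m.2.2.2.1, m'.2.2.2.1] at this
      simp only [Prod.mk_sub_mk, sub_self, Prod.norm_def, norm_zero, Real.norm_eq_abs] at this
      rw [max_eq_right (abs_nonneg _)] at this
      exact this.trans (by gcongr)
  · intro x1 h1 x2 h2
    exact (l9 (mem_ball2 d9 h1 h2)).2.2.2.1
  · intro x1 h1 x2 h2
    exact (l9 (mem_ball2 d9 h1 h2)).2.2.2.2
  · intro x1 h1 x2 h2 x2' h2'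
    have m := (l9 (mem_ball2 d9 h1 h2)).2.2.1
    have : (x2', φ (x1, x2)) ∈ Metric.ball (c2, φ (c1, c2)) r8 := by
      have h3 := mem_ball2 d8 h1 h2'
      rw [Metric.mem_ball, Prod.dist_eq, max_lt_iff] at h3 ⊢
      exact ⟨h3.2, m⟩
    exact l8 this
  · rintro ⟨x1, x2⟩ ⟨h1, h2⟩
    have := l4 _ (mem_ball2 d4 h1 h2)
    exact ⟨this.1.trans kA, le_trans (by gcongr) this.2⟩
  · rintro ⟨x1, x2⟩ ⟨h1, h2⟩
    have := l5 _ (mem_ball2 d5 h1 h2)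
    exact ⟨this.1.trans kB, le_trans (by gcongr) this.2⟩
  · rintro ⟨x1, x2⟩ ⟨h1, h2⟩ ⟨y1, y2⟩ ⟨h3, h4⟩
    exact (l4' _ (mem_ball2 d4 h1 h2) _ (mem_ball2 d4 h3 h4)).trans (by gcongr)
  · rintro ⟨x1, x2⟩ ⟨h1, h2⟩ ⟨y1, y2⟩ ⟨h3, h4⟩
    exact (l5' _ (mem_ball2 d5 h1 h2) _ (mem_ball2 d5 h3 h4)).trans (by gcongr)
  · intro x1 h1 x1' h1' hne d hd a ha b hb u hu v hv s hs hsJ hKs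
    have ht : |x1' - x1| < r6 := by
      rw [abs_lt]; simp only [mem_Icc] at h1 h1'; constructor <;> linarith
    have := l6 x1 a b d u v (x1' - x1) s (mem_ball4 (by linarith) h1 ha hb hd)
      (mem_ball4 (by linarith) h1 hu hv hd) ht (sub_ne_zero.2 (Ne.symm hne)) hs hsJ
      (le_trans (by gcongr) hKs)
    simp only [TT, PP, add_sub_cancel, sub_sub_sub_cancel_right] at this
    refine this.trans ?_
    gcongr
  · intro s hs
    refine le_trans (measure_mono ?_) ((l7 s hs).trans (ENNReal.ofReal_le_ofReal (by gcongr)))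
    rintro ⟨⟨⟨x1, x2⟩, x3⟩, x4⟩ ⟨h1, h2, h3, h4, h5⟩
    exact ⟨mem_ball4 d7 h1 h2 h3 h4, h5⟩

def e1 : ℝ × ℝ := (1, 0)
def e2 : ℝ × ℝ := (0, 1)
/-- partial derivatives -/
def pd1 (f : ℝ × ℝ → ℝ) (x : ℝ × ℝ) : ℝ := fderiv ℝ f x e1
def pd2 (f : ℝ × ℝ → ℝ) (x : ℝ × ℝ) : ℝ := fderiv ℝ f x e2

theorem pd1_an {f : ℝ × ℝ → ℝ} {x : ℝ × ℝ} (h : AnalyticAt ℝ f x) : AnalyticAt ℝ (pd1 f) x :=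
  fderiv_dir_an h _
theorem pd2_an {f : ℝ × ℝ → ℝ} {x : ℝ × ℝ} (h : AnalyticAt ℝ f x) : AnalyticAt ℝ (pd2 f) x :=
  fderiv_dir_an h _

/-- general chain rule along a plane curve -/
theorem chain2 {f : ℝ × ℝ → ℝ} {u v : ℝ → ℝ} {t y z u' v' : ℝ} (h : DifferentiableAt ℝ f (y, z))
    (hu : HasDerivAt u u' t) (hv : HasDerivAt v v' t) (hy : u t = y) (hz : v t = z) :
    HasDerivAt (fun s => f (u s, v s)) (u' * pd1 f (y, z) + v' * pd2 f (y, z)) t := by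
  subst hy hz
  have h1 := h.hasFDerivAt.comp_hasDerivAt t (hu.prodMk hv)
  have : (u', v') = u' • e1 + v' • e2 := by simp [e1, e2]
  rw [this, map_add, map_smul, map_smul] at h1
  exact h1

theorem pd1_deriv {f : ℝ × ℝ → ℝ} {y z : ℝ} (h : DifferentiableAt ℝ f (y, z)) :
    HasDerivAt (fun s => f (s, z)) (pd1 f (y, z)) y := by
  have := chain2 h (hasDerivAt_id y) (hasDerivAt_const y z) rfl rfl
  simpa using this

theorem pd2_deriv {f : ℝ × ℝ → ℝ} {y z : ℝ} (h : DifferentiableAt ℝ f (y, z)) :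
    HasDerivAt (fun s => f (y, s)) (pd2 f (y, z)) z := by
  have := chain2 h (hasDerivAt_const z y) (hasDerivAt_id z) rfl rfl
  simpa using this

theorem xi_deriv {φ ξ : ℝ × ℝ → ℝ} {x1 x2 : ℝ} (hφ : DifferentiableAt ℝ φ (x1, x2))
    (hξ : DifferentiableAt ℝ ξ (x1, φ (x1, x2)))
    (h : ∀ᶠ x in nhds (x1, x2), ξ (x.1, φ x) = x.2) (h2 : pd2 φ (x1, x2) ≠ 0) :
    pd1 ξ (x1, φ (x1, x2)) = - (pd1 φ (x1, x2) / pd2 φ (x1, x2)) := by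
  have d1 := chain2 hξ (hasDerivAt_id x1) (pd1_deriv hφ) rfl rfl
  have d2 := chain2 hξ (hasDerivAt_const x2 x1) (pd2_deriv hφ) rfl rfl
  have t1 : Filter.Tendsto (fun s : ℝ => (s, x2)) (nhds x1) (nhds (x1, x2)) :=
    (by fun_prop : Continuous (fun s : ℝ => (s, x2))).tendsto' _ _ rfl
  have t2 : Filter.Tendsto (fun s : ℝ => (x1, s)) (nhds x2) (nhds (x1, x2)) :=
    (by fun_prop : Continuous (fun s : ℝ => (x1, s))).tendsto' _ _ rfl
  have q1 := (hasDerivAt_const x1 x2).congr_of_eventuallyEq (t1.eventually h)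
  have q2 := (hasDerivAt_id x2).congr_of_eventuallyEq (t2.eventually h)
  have u1 := d1.unique q1
  have u2 := d2.unique q2
  rw [eq_neg_iff_add_eq_zero, ← mul_right_inj' h2]
  field_simp
  linear_combination (pd2 φ (x1, x2)) * u1 - pd1 φ (x1, x2) * u2

theorem zeta_deriv {φ ζ : ℝ × ℝ → ℝ} {x1 x2 : ℝ} (hφ : DifferentiableAt ℝ φ (x1, x2))
    (hζ : DifferentiableAt ℝ ζ (x2, φ (x1, x2)))
    (h : ∀ᶠ x in nhds (x1, x2), ζ (x.2, φ x) = x.1) (h1 : pd1 φ (x1, x2) ≠ 0) :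
    pd1 ζ (x2, φ (x1, x2)) = - (pd2 φ (x1, x2) / pd1 φ (x1, x2)) := by
  have d1 := chain2 hζ (hasDerivAt_const x1 x2) (pd1_deriv hφ) rfl rfl
  have d2 := chain2 hζ (hasDerivAt_id x2) (pd2_deriv hφ) rfl rfl
  have t1 : Filter.Tendsto (fun s : ℝ => (s, x2)) (nhds x1) (nhds (x1, x2)) :=
    (by fun_prop : Continuous (fun s : ℝ => (s, x2))).tendsto' _ _ rfl
  have t2 : Filter.Tendsto (fun s : ℝ => (x1, s)) (nhds x2) (nhds (x1, x2)) :=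
    (by fun_prop : Continuous (fun s : ℝ => (x1, s))).tendsto' _ _ rfl
  have q1 := (hasDerivAt_id x1).congr_of_eventuallyEq (t1.eventually h)
  have q2 := (hasDerivAt_const x2 x1).congr_of_eventuallyEq (t2.eventually h)
  have u1 := d1.unique q1
  have u2 := d2.unique q2
  rw [eq_neg_iff_add_eq_zero, ← mul_right_inj' h1]
  field_simp
  linear_combination (pd1 φ (x1, x2)) * u2 - pd2 φ (x1, x2) * u1

/-- the basic quotient -/
def QQ (g : ℝ × ℝ → ℝ) (w : W4) : ℝ :=
  g (w.1.1.1, w.1.1.2) * g (w.1.2, w.2) / g (w.1.2, w.1.1.2)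

def lg (g : ℝ × ℝ → ℝ) (x : ℝ × ℝ) : ℝ := Real.log (g x)

theorem lg_an {g : ℝ × ℝ → ℝ} {x : ℝ × ℝ} (h : AnalyticAt ℝ g x) (h0 : g x ≠ 0) :
    AnalyticAt ℝ (lg g) x := by
  rcases lt_or_gt_of_ne h0 with h1 | h1
  · have h2 : AnalyticAt ℝ (fun y => Real.log (-g y)) x :=
      AnalyticAt.fun_comp (g := Real.log) (analyticAt_log (by simpa using h1)) h.fun_neg
    refine h2.congr (Filter.Eventually.of_forall fun y => ?_)
    simp [lg]
  · exact AnalyticAt.fun_comp (g := Real.log) (analyticAt_log h1) h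

theorem lg_pd {g : ℝ × ℝ → ℝ} {x : ℝ × ℝ} (h : DifferentiableAt ℝ g x) (h0 : g x ≠ 0) :
    pd1 g x = g x * pd1 (lg g) x ∧ pd2 g x = g x * pd2 (lg g) x := by
  have h1 : fderiv ℝ (lg g) x = (g x)⁻¹ • fderiv ℝ g x := (h.hasFDerivAt.log h0).fderiv
  constructor
  · unfold pd1; rw [h1]; simp [h0]
  · unfold pd2; rw [h1]; simp [h0]

theorem QQ_an {g : ℝ × ℝ → ℝ} {x1 a b d : ℝ} (h1 : AnalyticAt ℝ g (x1, a))
    (h2 : AnalyticAt ℝ g (b, d)) (h3 : AnalyticAt ℝ g (b, a)) (n : g (b, a) ≠ 0) :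
    AnalyticAt ℝ (QQ g) (((x1, a), b), d) := by
  have f1 : AnalyticAt ℝ (fun p : W4 => p.1.1.1) (((x1, a), b), d) := (an_fst (an_fst (an_fst analyticAt_id)))
  have f2 : AnalyticAt ℝ (fun p : W4 => p.1.1.2) (((x1, a), b), d) := (an_snd (an_fst (an_fst analyticAt_id)))
  have f3 : AnalyticAt ℝ (fun p : W4 => p.1.2) (((x1, a), b), d) := (an_snd (an_fst analyticAt_id))
  have f4 : AnalyticAt ℝ (fun p : W4 => p.2) (((x1, a), b), d) := (an_snd analyticAt_id)
  exact ((an_comp2 h1 f1 f2 rfl rfl).mul (an_comp2 h2 f3 f4 rfl rfl)).div (an_comp2 h3 f3 f2 rfl rfl) n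

theorem QQ_fderiv {g : ℝ × ℝ → ℝ} {x1 a b d : ℝ} (h1 : AnalyticAt ℝ g (x1, a))
    (h2 : AnalyticAt ℝ g (b, d)) (h3 : AnalyticAt ℝ g (b, a)) (n1 : g (x1, a) ≠ 0)
    (n2 : g (b, d) ≠ 0) (n : g (b, a) ≠ 0) :
    fderiv ℝ (QQ g) (((x1, a), b), d) ea =
      QQ g (((x1, a), b), d) * (pd2 (lg g) (x1, a) - pd2 (lg g) (b, a)) ∧
    fderiv ℝ (QQ g) (((x1, a), b), d) eb =
      QQ g (((x1, a), b), d) * (pd1 (lg g) (b, d) - pd1 (lg g) (b, a)) := by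
  have hF := (QQ_an h1 h2 h3 n).differentiableAt.hasFDerivAt
  constructor
  · have c1 : HasDerivAt (fun s : ℝ => ((((x1, s), b), d) : W4)) ea a :=
      (((hasDerivAt_const a x1).prodMk (hasDerivAt_id a)).prodMk (hasDerivAt_const a b)).prodMk
        (hasDerivAt_const a d)
    have l := hF.comp_hasDerivAt a c1
    have r := ((pd2_deriv h1.differentiableAt).mul_const (g (b, d))).div
      (pd2_deriv h3.differentiableAt) n
    rw [HasDerivAt.unique l r, (lg_pd h1.differentiableAt n1).2, (lg_pd h3.differentiableAt n).2]
    simp only [QQ]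
    field_simp
  · have c1 : HasDerivAt (fun s : ℝ => ((((x1, a), s), d) : W4)) eb b :=
      ((hasDerivAt_const b (x1, a)).prodMk (hasDerivAt_id b)).prodMk (hasDerivAt_const b d)
    have l := hF.comp_hasDerivAt b c1
    have r := ((pd1_deriv h2.differentiableAt).const_mul (g (x1, a))).div
      (pd1_deriv h3.differentiableAt) n
    rw [HasDerivAt.unique l r, (lg_pd h2.differentiableAt n2).1, (lg_pd h3.differentiableAt n).1]
    simp only [QQ]
    field_simp

theorem R0_formula {φ ξ ζ : ℝ × ℝ → ℝ} {x1 a b d : ℝ}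
    (hφ1 : DifferentiableAt ℝ φ (x1, a)) (hφ2 : DifferentiableAt ℝ φ (b, a))
    (hφ3 : DifferentiableAt ℝ φ (b, d))
    (hξ1 : DifferentiableAt ℝ ξ (x1, φ (x1, a))) (hζ2 : DifferentiableAt ℝ ζ (a, φ (b, a)))
    (hξ3 : DifferentiableAt ℝ ξ (b, φ (b, d)))
    (i1 : ∀ᶠ x in nhds (x1, a), ξ (x.1, φ x) = x.2)
    (i2 : ∀ᶠ x in nhds (b, a), ζ (x.2, φ x) = x.1)
    (i3 : ∀ᶠ x in nhds (b, d), ξ (x.1, φ x) = x.2)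
    (n1 : pd2 φ (x1, a) ≠ 0) (n2 : pd1 φ (b, a) ≠ 0) (n3 : pd2 φ (b, d) ≠ 0)
    (hT : DifferentiableAt ℝ (TT φ ξ ζ) ((((x1, a), b), d), 0)) :
    fderiv ℝ (TT φ ξ ζ) ((((x1, a), b), d), 0) (0, 1) =
      - QQ (fun x => pd1 φ x / pd2 φ x) (((x1, a), b), d) := by
  have c : HasDerivAt (fun t : ℝ => (((((x1, a), b), d), t) : W4 × ℝ)) (0, 1) 0 :=
    (hasDerivAt_const 0 _).prodMk (hasDerivAt_id 0)
  have l := hT.hasFDerivAt.comp_hasDerivAt 0 c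
  have j1 : ξ (x1, φ (x1, a)) = a := i1.self_of_nhds
  have j2 : ζ (a, φ (b, a)) = b := i2.self_of_nhds
  have r1 : HasDerivAt (fun t : ℝ => x1 + t) 1 0 := (hasDerivAt_id 0).const_add x1
  have r2 := chain2 (t := 0) hξ1 r1 (hasDerivAt_const 0 (φ (x1, a))) (by simp) rfl
  have r3 := chain2 (t := 0) hζ2 r2 (hasDerivAt_const 0 (φ (b, a))) (by simp [j1]) rfl
  have r4 := (chain2 (t := 0) hξ3 r3 (hasDerivAt_const 0 (φ (b, d))) (by simp [j1, j2]) rfl).sub_const d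
  rw [HasDerivAt.unique l r4, xi_deriv hφ1 hξ1 i1 n1, xi_deriv hφ3 hξ3 i3 n3, zeta_deriv hφ2 hζ2 i2 n2]
  simp only [QQ]
  field_simp
  ring

/-- constant functions on an interval -/
theorem const_ball {g : ℝ → ℝ} {c r x y : ℝ} (hx : x ∈ Metric.ball c r) (hy : y ∈ Metric.ball c r)
    (h : ∀ z ∈ Metric.ball c r, HasDerivAt g 0 z) : g x = g y := by
  have := (convex_ball c r).norm_image_sub_le_of_norm_hasDerivWithin_le (f := g) (f' := fun _ => 0)
    (C := 0) (fun z hz => (h z hz).hasDerivWithinAt) (by simp) hx hy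
  rw [zero_mul, norm_le_zero_iff, sub_eq_zero] at this
  exact this.symm

theorem mem_prod_ball {c1 c2 r x1 x2 : ℝ} (h1 : x1 ∈ Metric.ball c1 r) (h2 : x2 ∈ Metric.ball c2 r) :
    (x1, x2) ∈ Metric.ball (c1, c2) r := by
  rw [← ball_prod_same]; exact ⟨h1, h2⟩

theorem sep12 {G : ℝ × ℝ → ℝ} {c1 c2 r : ℝ} (hG : AnalyticOnNhd ℝ G (Metric.ball (c1, c2) r))
    (h : ∀ x ∈ Metric.ball (c1, c2) r, pd1 (pd2 G) x = 0) {x1 y1 x2 y2 : ℝ}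
    (hx1 : x1 ∈ Metric.ball c1 r) (hy1 : y1 ∈ Metric.ball c1 r) (hx2 : x2 ∈ Metric.ball c2 r)
    (hy2 : y2 ∈ Metric.ball c2 r) : G (x1, x2) = G (x1, y2) + G (y1, x2) - G (y1, y2) := by
  have s1 : ∀ z ∈ Metric.ball c2 r, pd2 G (x1, z) = pd2 G (y1, z) := by
    intro z hz
    refine const_ball (g := fun s => pd2 G (s, z)) hx1 hy1 fun s hs => ?_
    have := pd1_deriv (pd2_an (hG _ (mem_prod_ball hs hz))).differentiableAt
    rwa [h _ (mem_prod_ball hs hz)] at this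
  have := const_ball (g := fun z => G (x1, z) - G (y1, z)) hx2 hy2 fun z hz => by
    have := (pd2_deriv (hG _ (mem_prod_ball hx1 hz)).differentiableAt).sub
      (pd2_deriv (hG _ (mem_prod_ball hy1 hz)).differentiableAt)
    rwa [s1 z hz, sub_self] at this
  linarith

theorem sep21 {G : ℝ × ℝ → ℝ} {c1 c2 r : ℝ} (hG : AnalyticOnNhd ℝ G (Metric.ball (c1, c2) r))
    (h : ∀ x ∈ Metric.ball (c1, c2) r, pd2 (pd1 G) x = 0) {x1 y1 x2 y2 : ℝ}
    (hx1 : x1 ∈ Metric.ball c1 r) (hy1 : y1 ∈ Metric.ball c1 r) (hx2 : x2 ∈ Metric.ball c2 r)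
    (hy2 : y2 ∈ Metric.ball c2 r) : G (x1, x2) = G (x1, y2) + G (y1, x2) - G (y1, y2) := by
  have s1 : ∀ z ∈ Metric.ball c1 r, pd1 G (z, x2) = pd1 G (z, y2) := by
    intro z hz
    refine const_ball (g := fun s => pd1 G (z, s)) hx2 hy2 fun s hs => ?_
    have := pd2_deriv (pd1_an (hG _ (mem_prod_ball hz hs))).differentiableAt
    rwa [h _ (mem_prod_ball hz hs)] at this
  have := const_ball (g := fun z => G (z, x2) - G (z, y2)) hx1 hy1 fun z hz => by
    have := (pd1_deriv (hG _ (mem_prod_ball hz hx2)).differentiableAt).sub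
      (pd1_deriv (hG _ (mem_prod_ball hz hy2)).differentiableAt)
    rwa [s1 z hz, sub_self] at this
  linarith

theorem dicho {M N : ℝ × ℝ → ℝ} {c1 c2 r : ℝ} (hM : AnalyticOnNhd ℝ M (Metric.ball (c1, c2) r))
    (hN : AnalyticOnNhd ℝ N (Metric.ball (c1, c2) r))
    (h : ∀ x1 ∈ Metric.ball c1 r, ∀ a ∈ Metric.ball c2 r, ∀ b ∈ Metric.ball c1 r, ∀ d ∈ Metric.ball c2 r,
      (pd2 M (x1, a) - pd2 M (b, a)) * (pd1 N (b, d) - pd1 N (b, a)) =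
      (pd1 M (b, d) - pd1 M (b, a)) * (pd2 N (x1, a) - pd2 N (b, a))) :
    (∀ x1 ∈ Metric.ball c1 r, ∀ x2 ∈ Metric.ball c2 r, ∀ y1 ∈ Metric.ball c1 r, ∀ y2 ∈ Metric.ball c2 r,
      M (x1, x2) = M (x1, y2) + M (y1, x2) - M (y1, y2)) ∨
    ∃ τ : ℝ, ∀ x1 ∈ Metric.ball c1 r, ∀ x2 ∈ Metric.ball c2 r, ∀ y1 ∈ Metric.ball c1 r, ∀ y2 ∈ Metric.ball c2 r,
      (N (x1, x2) - τ * M (x1, x2)) = (N (x1, y2) - τ * M (x1, y2)) +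
        (N (y1, x2) - τ * M (y1, x2)) - (N (y1, y2) - τ * M (y1, y2)) := by
  have k1 : ∀ x1 ∈ Metric.ball c1 r, ∀ a ∈ Metric.ball c2 r, ∀ b ∈ Metric.ball c1 r, ∀ d ∈ Metric.ball c2 r,
      pd1 (pd2 M) (x1, a) * (pd1 N (b, d) - pd1 N (b, a)) =
      (pd1 M (b, d) - pd1 M (b, a)) * pd1 (pd2 N) (x1, a) := by
    intro x1 hx1 a ha b hb d hd
    have l := ((pd1_deriv (pd2_an (hM _ (mem_prod_ball hx1 ha))).differentiableAt).sub_const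
      (pd2 M (b, a))).mul_const (pd1 N (b, d) - pd1 N (b, a))
    have rr := ((pd1_deriv (pd2_an (hN _ (mem_prod_ball hx1 ha))).differentiableAt).sub_const
      (pd2 N (b, a))).const_mul (pd1 M (b, d) - pd1 M (b, a))
    refine HasDerivAt.unique l (rr.congr_of_eventuallyEq ?_)
    filter_upwards [Metric.isOpen_ball.mem_nhds hx1] with z hz using h z hz a ha b hb d hd
  have k2 : ∀ x1 ∈ Metric.ball c1 r, ∀ a ∈ Metric.ball c2 r, ∀ b ∈ Metric.ball c1 r, ∀ d ∈ Metric.ball c2 r,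
      pd1 (pd2 M) (x1, a) * pd2 (pd1 N) (b, d) = pd2 (pd1 M) (b, d) * pd1 (pd2 N) (x1, a) := by
    intro x1 hx1 a ha b hb d hd
    have l := ((pd2_deriv (pd1_an (hN _ (mem_prod_ball hb hd))).differentiableAt).sub_const
      (pd1 N (b, a))).const_mul (pd1 (pd2 M) (x1, a))
    have rr := ((pd2_deriv (pd1_an (hM _ (mem_prod_ball hb hd))).differentiableAt).sub_const
      (pd1 M (b, a))).mul_const (pd1 (pd2 N) (x1, a))
    refine HasDerivAt.unique l (rr.congr_of_eventuallyEq ?_)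
    filter_upwards [Metric.isOpen_ball.mem_nhds hd] with z hz using k1 x1 hx1 a ha b hb z hz
  by_cases hk : ∀ x ∈ Metric.ball (c1, c2) r, pd1 (pd2 M) x = 0
  · left
    intro x1 hx1 x2 hx2 y1 hy1 y2 hy2
    exact sep12 hM hk hx1 hy1 hx2 hy2
  · right
    push Not at hk
    obtain ⟨⟨p1, p2⟩, hp, hpn⟩ := hk
    rw [← ball_prod_same] at hp
    refine ⟨pd1 (pd2 N) (p1, p2) / pd1 (pd2 M) (p1, p2), ?_⟩
    generalize hτ : pd1 (pd2 N) (p1, p2) / pd1 (pd2 M) (p1, p2) = τ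
    have k3 : ∀ b ∈ Metric.ball c1 r, ∀ d ∈ Metric.ball c2 r, pd2 (pd1 N) (b, d) = τ * pd2 (pd1 M) (b, d) := by
      intro b hb d hd
      have := k2 p1 hp.1 p2 hp.2 b hb d hd
      rw [← hτ]; field_simp; linarith
    intro x1 hx1 x2 hx2 y1 hy1 y2 hy2
    have hG : AnalyticOnNhd ℝ (fun x => N x - τ * M x) (Metric.ball (c1, c2) r) := fun x hx =>
      (hN x hx).sub (analyticAt_const.mul (hM x hx))
    refine sep21 (G := fun x => N x - τ * M x) hG ?_ hx1 hy1 hx2 hy2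
    rintro ⟨b, d⟩ hbd
    have e : pd1 (fun x => N x - τ * M x) =ᶠ[nhds (b, d)] fun x => pd1 N x - τ * pd1 M x := by
      filter_upwards [Metric.isOpen_ball.mem_nhds hbd] with x hx
      have := ((hN x hx).differentiableAt.hasFDerivAt.sub
        ((hM x hx).differentiableAt.hasFDerivAt.const_mul τ)).fderiv
      unfold pd1
      erw [this]
      simp
    unfold pd2
    rw [e.fderiv_eq]
    have := ((pd1_an (hN _ hbd)).differentiableAt.hasFDerivAt.sub
        ((pd1_an (hM _ hbd)).differentiableAt.hasFDerivAt.const_mul τ)).fderiv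
    erw [this]
    rw [← ball_prod_same] at hbd
    have := k3 b hbd.1 d hbd.2
    unfold pd2 at this
    simp [this]

structure Good (φ ξ ζ A1 A2 : ℝ × ℝ → ℝ) (x : ℝ × ℝ) : Prop where
  aφ : AnalyticAt ℝ φ x
  n1 : pd1 φ x ≠ 0
  n2 : pd2 φ x ≠ 0
  aξ : AnalyticAt ℝ ξ (x.1, φ x)
  aζ : AnalyticAt ℝ ζ (x.2, φ x)
  aA1 : AnalyticAt ℝ A1 x
  aA2 : AnalyticAt ℝ A2 x
  nA1 : A1 x ≠ 0
  nA2 : A2 x ≠ 0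
  hξ : ∀ᶠ x in nhds x, ξ (x.1, φ x) = x.2
  hζ : ∀ᶠ x in nhds x, ζ (x.2, φ x) = x.1

theorem Base.good {φ ξ ζ A1 A2 : ℝ × ℝ → ℝ} {c : ℝ × ℝ} (B : Base φ ξ ζ A1 A2 c)
    (n1 : pd1 φ c ≠ 0) (n2 : pd2 φ c ≠ 0) : ∀ᶠ x in nhds c, Good φ ξ ζ A1 A2 x := by
  have t1 : Filter.Tendsto (fun x => (x.1, φ x)) (nhds c) (nhds (c.1, φ c)) :=
    (continuousAt_fst.prodMk B.aφ.continuousAt)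
  have t2 : Filter.Tendsto (fun x => (x.2, φ x)) (nhds c) (nhds (c.2, φ c)) :=
    (continuousAt_snd.prodMk B.aφ.continuousAt)
  filter_upwards [B.aφ.eventually_analyticAt, (pd1_an B.aφ).continuousAt.eventually_ne n1,
    (pd2_an B.aφ).continuousAt.eventually_ne n2, t1.eventually B.aξ.eventually_analyticAt,
    t2.eventually B.aζ.eventually_analyticAt, B.aA1.eventually_analyticAt,
    B.aA2.eventually_analyticAt, B.aA1.continuousAt.eventually_ne B.nA1,
    B.aA2.continuousAt.eventually_ne B.nA2, B.hξ.eventually_nhds, B.hζ.eventually_nhds]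
    with x h1 h2 h3 h4 h5 h6 h7 h8 h9 h10 h11
  exact ⟨h1, h2, h3, h4, h5, h6, h7, h8, h9, h10, h11⟩

def mm (φ : ℝ × ℝ → ℝ) (x : ℝ × ℝ) : ℝ := pd1 φ x / pd2 φ x
def rr (A1 A2 : ℝ × ℝ → ℝ) (x : ℝ × ℝ) : ℝ := A1 x / A2 x

theorem J_dicho {φ ξ ζ A1 A2 : ℝ × ℝ → ℝ} {c1 c2 : ℝ} (B : Base φ ξ ζ A1 A2 (c1, c2))
    (n1 : pd1 φ (c1, c2) ≠ 0) (n2 : pd2 φ (c1, c2) ≠ 0)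
    (hJ : ∀ᶠ w in nhds ((((c1, c2), c1), c2) : W4), JJ φ ξ ζ A1 A2 w = 0) :
    ∃ r : ℝ, 0 < r ∧ (∀ x ∈ Metric.ball (c1, c2) r, Good φ ξ ζ A1 A2 x) ∧
    ((∀ x1 ∈ Metric.ball c1 r, ∀ x2 ∈ Metric.ball c2 r, ∀ y1 ∈ Metric.ball c1 r, ∀ y2 ∈ Metric.ball c2 r,
      lg (mm φ) (x1, x2) = lg (mm φ) (x1, y2) + lg (mm φ) (y1, x2) - lg (mm φ) (y1, y2)) ∨
    ∃ τ : ℝ, ∀ x1 ∈ Metric.ball c1 r, ∀ x2 ∈ Metric.ball c2 r, ∀ y1 ∈ Metric.ball c1 r, ∀ y2 ∈ Metric.ball c2 r,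
      (lg (rr A1 A2) (x1, x2) - τ * lg (mm φ) (x1, x2)) = (lg (rr A1 A2) (x1, y2) - τ * lg (mm φ) (x1, y2)) +
        (lg (rr A1 A2) (y1, x2) - τ * lg (mm φ) (y1, x2)) - (lg (rr A1 A2) (y1, y2) - τ * lg (mm φ) (y1, y2))) := by
  obtain ⟨r1, hr1, h1⟩ := Metric.mem_nhds_iff.1 (B.good n1 n2)
  have ht : Filter.Tendsto (fun w : W4 => (w, (0:ℝ))) (nhds ((((c1, c2), c1), c2) : W4))
      (nhds ((((c1, c2), c1), c2), 0)) :=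
    (by fun_prop : Continuous (fun w : W4 => (w, (0:ℝ)))).tendsto _
  obtain ⟨r2, hr2, h2⟩ := Metric.mem_nhds_iff.1 (hJ.and (ht.eventually B.aT.eventually_analyticAt))
  refine ⟨min r1 r2, lt_min hr1 hr2, ?_, ?_⟩
  · intro x hx
    exact h1 (Metric.ball_subset_ball (min_le_left _ _) hx)
  have hg : ∀ x ∈ Metric.ball (c1, c2) (min r1 r2), Good φ ξ ζ A1 A2 x := fun x hx =>
    h1 (Metric.ball_subset_ball (min_le_left _ _) hx)
  have am : ∀ x ∈ Metric.ball (c1, c2) (min r1 r2), AnalyticAt ℝ (mm φ) x := fun x hx =>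
    (pd1_an (hg x hx).aφ).div (pd2_an (hg x hx).aφ) (hg x hx).n2
  have nm : ∀ x ∈ Metric.ball (c1, c2) (min r1 r2), mm φ x ≠ 0 := fun x hx =>
    div_ne_zero (hg x hx).n1 (hg x hx).n2
  have ar : ∀ x ∈ Metric.ball (c1, c2) (min r1 r2), AnalyticAt ℝ (rr A1 A2) x := fun x hx =>
    (hg x hx).aA1.div (hg x hx).aA2 (hg x hx).nA2
  have nr : ∀ x ∈ Metric.ball (c1, c2) (min r1 r2), rr A1 A2 x ≠ 0 := fun x hx =>
    div_ne_zero (hg x hx).nA1 (hg x hx).nA2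
  refine dicho (fun x hx => lg_an (am x hx) (nm x hx)) (fun x hx => lg_an (ar x hx) (nr x hx)) ?_
  have mem4 : ∀ x1 ∈ Metric.ball c1 (min r1 r2), ∀ a ∈ Metric.ball c2 (min r1 r2),
      ∀ b ∈ Metric.ball c1 (min r1 r2), ∀ d ∈ Metric.ball c2 (min r1 r2),
      ((((x1, a), b), d) : W4) ∈ Metric.ball ((((c1, c2), c1), c2) : W4) (min r1 r2) := by
    intro x1 hx1 a ha b hb d hd
    rw [← ball_prod_same, ← ball_prod_same, ← ball_prod_same]
    exact ⟨⟨⟨hx1, ha⟩, hb⟩, hd⟩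
  have hR : ∀ w ∈ Metric.ball ((((c1, c2), c1), c2) : W4) (min r1 r2),
      fderiv ℝ (TT φ ξ ζ) (w, 0) (0, 1) = - QQ (mm φ) w := by
    rintro ⟨⟨⟨x1, a⟩, b⟩, d⟩ hw
    have hT := (h2 (Metric.ball_subset_ball (min_le_right _ _) hw)).2.differentiableAt
    rw [← ball_prod_same, ← ball_prod_same, ← ball_prod_same] at hw
    obtain ⟨⟨⟨hx1, ha⟩, hb⟩, hd⟩ := hw
    have g1 := hg _ (mem_prod_ball hx1 ha)
    have g2 := hg _ (mem_prod_ball hb ha)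
    have g3 := hg _ (mem_prod_ball hb hd)
    exact R0_formula g1.aφ.differentiableAt g2.aφ.differentiableAt g3.aφ.differentiableAt
      g1.aξ.differentiableAt g2.aζ.differentiableAt g3.aξ.differentiableAt g1.hξ g2.hζ g3.hξ
      g1.n2 g2.n1 g3.n2 hT
  intro x1 hx1 a ha b hb d hd
  have hw := mem4 x1 hx1 a ha b hb d hd
  have hJ0 := (h2 (Metric.ball_subset_ball (min_le_right _ _) hw)).1
  have eR : (fun w => fderiv ℝ (TT φ ξ ζ) (w, 0) (0, 1)) =ᶠ[nhds ((((x1, a), b), d) : W4)]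
      fun w => - QQ (mm φ) w := by
    filter_upwards [Metric.isOpen_ball.mem_nhds hw] with w hw using hR w hw
  have p1 := mem_prod_ball hx1 ha
  have p2 := mem_prod_ball hb hd
  have p3 := mem_prod_ball hb ha
  have q1 := QQ_fderiv (am _ p1) (am _ p2) (am _ p3) (nm _ p1) (nm _ p2) (nm _ p3)
  have q2 := QQ_fderiv (ar _ p1) (ar _ p2) (ar _ p3) (nr _ p1) (nr _ p2) (nr _ p3)
  have eP : PP A1 A2 = QQ (rr A1 A2) := rfl
  have z1 : QQ (mm φ) (((x1, a), b), d) ≠ 0 :=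
    div_ne_zero (mul_ne_zero (nm _ p1) (nm _ p2)) (nm _ p3)
  have z2 : QQ (rr A1 A2) (((x1, a), b), d) ≠ 0 :=
    div_ne_zero (mul_ne_zero (nr _ p1) (nr _ p2)) (nr _ p3)
  unfold JJ jac at hJ0
  rw [eR.fderiv_eq, eP, fderiv_fun_neg, ContinuousLinearMap.neg_apply, ContinuousLinearMap.neg_apply,
    q1.1, q1.2, q2.1, q2.2] at hJ0
  have := mul_ne_zero z1 z2
  rw [← sub_eq_zero, ← mul_right_inj' this]
  linear_combination -hJ0

theorem antideriv {g : ℝ → ℝ} {c : ℝ} (h : AnalyticAt ℝ g c) :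
    ∃ P : ℝ → ℝ, AnalyticAt ℝ P c ∧ ∀ᶠ x in nhds c, HasDerivAt P (g x) x := by
  obtain ⟨p, hp⟩ := h
  set co : ℕ → ℝ := fun n => p.coeff (n - 1) / n with hco
  set q : FormalMultilinearSeries ℝ ℝ ℝ := fun n => ContinuousMultilinearMap.mkPiRing ℝ (Fin n) (co n) with hq
  have hqc : ∀ n, q.coeff n = co n := by
    intro n
    simp [FormalMultilinearSeries.coeff, hq]
  have hqn : ∀ n, ‖q n‖ = |co n| := by
    intro n; rw [FormalMultilinearSeries.norm_apply_eq_norm_coef, hqc]; rfl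
  have hrad : 0 < q.radius := by
    obtain ⟨C, r, hC, hr, hb⟩ := p.le_mul_pow_of_radius_pos hp.radius_pos
    have hpos : 0 < min (1/r) 1 := by positivity
    have := q.le_radius_of_bound C (r := ⟨min (1/r) 1, hpos.le⟩) (fun n => by
      rw [hqn, hco]
      rcases n with _ | n
      · simp; exact hC.le
      · have h1 := hb n
        rw [FormalMultilinearSeries.norm_apply_eq_norm_coef, Real.norm_eq_abs] at h1
        rw [abs_div, Nat.add_sub_cancel]
        have h2 : |p.coeff n| / |((n+1 : ℕ) : ℝ)| ≤ |p.coeff n| := by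
          apply div_le_self (abs_nonneg _)
          rw [Nat.abs_cast]; push_cast; linarith [Nat.cast_nonneg (α := ℝ) n]
        have h3 : (min (1/r) 1) ^ (n+1) ≤ (1/r)^n := by
          rw [pow_succ]
          calc _ ≤ (min (1/r) 1)^n * 1 := by gcongr; exact min_le_right _ _
            _ ≤ (1/r)^n := by rw [mul_one]; gcongr; exact min_le_left _ _
        calc _ ≤ (C * r ^ n) * (1/r)^n := by
              gcongr
              · exact h2.trans h1
              · exact h3
          _ = C := by rw [mul_assoc, ← mul_pow]; field_simp; simp)
    refine lt_of_lt_of_le ?_ this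
    exact ENNReal.coe_pos.2 (show (0:NNReal) < _ from hpos)
  have h1 := (q.hasFPowerSeriesOnBall hrad).comp_sub c
  rw [zero_add] at h1
  refine ⟨fun x => q.sum (x - c), h1.analyticAt, ?_⟩
  have h2 := h1.fderiv.hasFPowerSeriesAt
  have e1 := hasFPowerSeriesAt_iff.1 h2
  have e2 := hasFPowerSeriesAt_iff.1 hp
  have e3 : ∀ᶠ z in nhds (0:ℝ), HasDerivAt (fun x => q.sum (x - c)) (g (c + z)) (c + z) := by
    have ht : Filter.Tendsto (fun z : ℝ => c + z) (nhds 0) (nhds c) :=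
      (by fun_prop : Continuous (fun z : ℝ => c + z)).tendsto' _ _ (by simp)
    filter_upwards [e1, e2, ht.eventually h1.analyticAt.eventually_analyticAt] with z hz1 hz2 hz3
    have := hz1.mapL (ContinuousLinearMap.apply ℝ ℝ (1:ℝ))
    have e : (fun n => (ContinuousLinearMap.apply ℝ ℝ (1:ℝ)) (z ^ n • q.derivSeries.coeff n)) =
        fun n => z ^ n • p.coeff n := by
      funext n
      rw [map_smul, ContinuousLinearMap.apply_apply, FormalMultilinearSeries.derivSeries_coeff_one, hqc]
      simp only [hco, Nat.add_sub_cancel]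
      congr 1
      rw [nsmul_eq_mul]
      have : ((n + 1 : ℕ) : ℝ) ≠ 0 := by positivity
      field_simp
    rw [e] at this
    have h5 := this.unique hz2
    rw [← h5]
    exact hz3.differentiableAt.hasDerivAt
  have ht : Filter.Tendsto (fun x : ℝ => x - c) (nhds c) (nhds 0) :=
    (by fun_prop : Continuous (fun z : ℝ => z - c)).tendsto' _ _ (by simp)
  filter_upwards [ht.eventually e3] with x hx
  simpa using hx

theorem sep_mul {g : ℝ × ℝ → ℝ} {c1 c2 r : ℝ} (hr : 0 < r) (hg : ContinuousAt g (c1, c2)) (h0 : g (c1, c2) ≠ 0)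
    (h : ∀ x1 ∈ Metric.ball c1 r, ∀ x2 ∈ Metric.ball c2 r, ∀ y1 ∈ Metric.ball c1 r, ∀ y2 ∈ Metric.ball c2 r,
      lg g (x1, x2) = lg g (x1, y2) + lg g (y1, x2) - lg g (y1, y2)) :
    ∀ᶠ x in nhds (c1, c2), g x * g (c1, c2) = g (x.1, c2) * g (c1, x.2) ∧ 0 < g x / g (c1, c2) ∧
      g (x.1, c2) ≠ 0 ∧ g (c1, x.2) ≠ 0 := by
  have hp : ∀ᶠ x in nhds (c1, c2), 0 < g x / g (c1, c2) := by
    have : ContinuousAt (fun x => g x / g (c1, c2)) (c1, c2) := hg.div_const _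
    exact continuousAt_const.eventually_lt this (by rw [div_self h0]; exact one_pos)
  have t1 : Filter.Tendsto (fun x : ℝ × ℝ => (x.1, c2)) (nhds (c1, c2)) (nhds (c1, c2)) :=
    (by fun_prop : Continuous (fun x : ℝ × ℝ => (x.1, c2))).tendsto' _ _ rfl
  have t2 : Filter.Tendsto (fun x : ℝ × ℝ => (c1, x.2)) (nhds (c1, c2)) (nhds (c1, c2)) :=
    (by fun_prop : Continuous (fun x : ℝ × ℝ => (c1, x.2))).tendsto' _ _ rfl
  filter_upwards [hp, t1.eventually hp, t2.eventually hp, Metric.ball_mem_nhds (c1, c2) hr] with x h1 h2 h3 h4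
  rw [← ball_prod_same] at h4
  have n1 : g x ≠ 0 := fun e => by simp [e] at h1
  have n2 : g (x.1, c2) ≠ 0 := fun e => by simp [e] at h2
  have n3 : g (c1, x.2) ≠ 0 := fun e => by simp [e] at h3
  refine ⟨?_, h1, n2, n3⟩
  have h5 := h x.1 h4.1 x.2 h4.2 c1 (Metric.mem_ball_self hr) c2 (Metric.mem_ball_self hr)
  unfold lg at h5
  have h6 : g x / g (c1, c2) = (g (x.1, c2) / g (c1, c2)) * (g (c1, x.2) / g (c1, c2)) := by
    apply Real.log_injOn_pos h1 (mul_pos h2 h3 : (0:ℝ) < _)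
    rw [Real.log_mul h2.ne' h3.ne', Real.log_div n1 h0, Real.log_div n2 h0, Real.log_div n3 h0]
    rw [Prod.mk.eta] at h5
    linarith
  field_simp at h6
  linarith

theorem flat_of_sep {φ ξ : ℝ × ℝ → ℝ} {c1 c2 r : ℝ} (hr : 0 < r) (aφ : AnalyticAt ℝ φ (c1, c2))
    (aξ : AnalyticAt ℝ ξ (c1, φ (c1, c2))) (n1 : pd1 φ (c1, c2) ≠ 0) (n2 : pd2 φ (c1, c2) ≠ 0)
    (hξ : ∀ᶠ x in nhds (c1, c2), ξ (x.1, φ x) = x.2)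
    (hξ2 : ∀ᶠ q in nhds (c1, φ (c1, c2)), φ (q.1, ξ q) = q.2)
    (h : ∀ x1 ∈ Metric.ball c1 r, ∀ x2 ∈ Metric.ball c2 r, ∀ y1 ∈ Metric.ball c1 r, ∀ y2 ∈ Metric.ball c2 r,
      lg (mm φ) (x1, x2) = lg (mm φ) (x1, y2) + lg (mm φ) (y1, x2) - lg (mm φ) (y1, y2)) :
    ∃ P Q ψ : ℝ → ℝ, AnalyticAt ℝ P c1 ∧ AnalyticAt ℝ Q c2 ∧ AnalyticAt ℝ ψ (φ (c1, c2)) ∧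
      deriv P c1 ≠ 0 ∧ deriv Q c2 ≠ 0 ∧ deriv ψ (φ (c1, c2)) ≠ 0 ∧
      ∀ᶠ x in nhds (c1, c2), P x.1 + Q x.2 = ψ (φ x) := by
  have am : AnalyticAt ℝ (mm φ) (c1, c2) := (pd1_an aφ).div (pd2_an aφ) n2
  have nm : mm φ (c1, c2) ≠ 0 := div_ne_zero n1 n2
  have hs := sep_mul hr am.continuousAt nm h
  have hξc : ξ (c1, φ (c1, c2)) = c2 := hξ.self_of_nhds
  have ap : AnalyticAt ℝ (fun s => mm φ (s, c2)) c1 :=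
    an_comp2 am analyticAt_id analyticAt_const rfl rfl
  have aq : AnalyticAt ℝ (fun t => mm φ (c1, c2) / mm φ (c1, t)) c2 :=
    analyticAt_const.div (an_comp2 am analyticAt_const analyticAt_id rfl rfl) nm
  obtain ⟨P, aP, hP⟩ := antideriv ap
  obtain ⟨Q, aQ, hQ⟩ := antideriv aq
  have aψ : AnalyticAt ℝ (fun y => P c1 + Q (ξ (c1, y))) (φ (c1, c2)) := by
    refine analyticAt_const.add ?_
    refine AnalyticAt.fun_comp (g := Q) ?_ (an_comp2 aξ analyticAt_const analyticAt_id rfl rfl)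
    rw [hξc]; exact aQ
  -- key identity
  have tA : Filter.Tendsto (fun q : ℝ × ℝ => (q.1, ξ q)) (nhds (c1, φ (c1, c2))) (nhds (c1, c2)) := by
    have := (continuousAt_fst (p := (c1, φ (c1, c2)))).prodMk aξ.continuousAt
    unfold ContinuousAt at this
    simpa [hξc] using this
  have tB : Filter.Tendsto (fun q : ℝ × ℝ => q.1) (nhds (c1, φ (c1, c2))) (nhds c1) :=
    continuousAt_fst
  have tC : Filter.Tendsto (fun q : ℝ × ℝ => ξ q) (nhds (c1, φ (c1, c2))) (nhds c2) := by
    have := aξ.continuousAt; unfold ContinuousAt at this; rwa [hξc] at this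
  have ev : ∀ᶠ q in nhds (c1, φ (c1, c2)),
      HasDerivAt (fun s => P s + Q (ξ (s, q.2))) 0 q.1 := by
    filter_upwards [tB.eventually hP, tC.eventually hQ, tA.eventually hs, hξ2,
      tA.eventually aφ.eventually_analyticAt, aξ.eventually_analyticAt, tA.eventually hξ.eventually_nhds,
      tA.eventually ((pd2_an aφ).continuousAt.eventually_ne n2)] with q h1 h2 h3 h4 h5 h6 h7 h8
    obtain ⟨s, y⟩ := q
    simp only at h1 h2 h3 h4 h5 h6 h7 h8 ⊢
    have e1 := xi_deriv h5.differentiableAt (by rw [h4]; exact h6.differentiableAt) h7 h8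
    rw [h4] at e1
    have e2 := h1.add (h2.comp s (pd1_deriv h6.differentiableAt))
    rw [e1] at e2
    obtain ⟨k1, k2, k3, k4⟩ := h3
    have k5 : pd1 φ (s, ξ (s, y)) / pd2 φ (s, ξ (s, y)) = mm φ (s, ξ (s, y)) := rfl
    rw [k5] at e2
    have k6 : mm φ (s, c2) + mm φ (c1, c2) / mm φ (c1, ξ (s, y)) * -mm φ (s, ξ (s, y)) = 0 := by
      field_simp
      linarith
    rw [k6] at e2
    exact e2
  obtain ⟨ρ, hρ, hb⟩ := Metric.mem_nhds_iff.1 ev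
  have key : ∀ᶠ x in nhds (c1, c2), P x.1 + Q x.2 = P c1 + Q (ξ (c1, φ x)) := by
    have t : Filter.Tendsto (fun x => (x.1, φ x)) (nhds (c1, c2)) (nhds (c1, φ (c1, c2))) :=
      continuousAt_fst.prodMk aφ.continuousAt
    filter_upwards [t.eventually (Metric.ball_mem_nhds _ hρ), hξ] with x hx hx2
    replace hx : (x.1, φ x) ∈ Metric.ball (c1, φ (c1, c2)) ρ := hx
    rw [← ball_prod_same] at hx
    have := const_ball (g := fun s => P s + Q (ξ (s, φ x))) hx.1 (Metric.mem_ball_self hρ) (fun z hz =>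
      hb (mem_prod_ball hz hx.2 : (z, φ x) ∈ _))
    simp only [hx2] at this
    exact this
  have dP := hP.self_of_nhds
  have dQ := hQ.self_of_nhds
  refine ⟨P, Q, _, aP, aQ, aψ, by rw [dP.deriv]; exact nm,
    by rw [dQ.deriv]; exact div_ne_zero nm nm, ?_, key⟩
  intro h0
  have t1 : Filter.Tendsto (fun s : ℝ => (s, c2)) (nhds c1) (nhds (c1, c2)) :=
    (by fun_prop : Continuous (fun s : ℝ => (s, c2))).tendsto' _ _ rfl
  have d0 := aψ.differentiableAt.hasDerivAt
  rw [h0] at d0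
  have d1' : HasDerivAt (fun s => P c1 + Q (ξ (c1, φ (s, c2)))) _ c1 :=
    HasDerivAt.comp (h₂ := fun y => P c1 + Q (ξ (c1, y))) c1 d0 (pd1_deriv aφ.differentiableAt)
  have d1 : HasDerivAt (fun s => P s + Q c2) _ c1 := d1'.congr_of_eventuallyEq (t1.eventually key)
  have d2 : HasDerivAt (fun s => P s + Q c2) _ c1 := dP.add_const (Q c2)
  have := d2.unique d1
  rw [zero_mul] at this
  exact nm this

theorem aux_of_sep {m R : ℝ × ℝ → ℝ} {c1 c2 r τ : ℝ} (hr : 0 < r) (am : AnalyticAt ℝ m (c1, c2))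
    (aR : AnalyticAt ℝ R (c1, c2)) (nm : m (c1, c2) ≠ 0) (nR : R (c1, c2) ≠ 0)
    (h : ∀ x1 ∈ Metric.ball c1 r, ∀ x2 ∈ Metric.ball c2 r, ∀ y1 ∈ Metric.ball c1 r, ∀ y2 ∈ Metric.ball c2 r,
      (lg R (x1, x2) - τ * lg m (x1, x2)) = (lg R (x1, y2) - τ * lg m (x1, y2)) +
        (lg R (y1, x2) - τ * lg m (y1, x2)) - (lg R (y1, y2) - τ * lg m (y1, y2))) :
    ∃ h1 h2 : ℝ → ℝ, AnalyticAt ℝ h1 c1 ∧ AnalyticAt ℝ h2 c2 ∧ (∀ s, h1 s ≠ 0) ∧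
      ∀ᶠ x in nhds (c1, c2), R x * h1 x.1 + |m x| ^ τ * h2 x.2 = 0 := by
  have aL : AnalyticAt ℝ (fun x => lg R x - τ * lg m x) (c1, c2) :=
    (lg_an aR nR).sub (analyticAt_const.mul (lg_an am nm))
  generalize hL : (fun x => lg R x - τ * lg m x) = L at aL
  have hLx : ∀ x, L x = lg R x - τ * lg m x := fun x => by rw [← hL]
  refine ⟨fun s => Real.exp (- L (s, c2)), fun t => - (R (c1, c2) * Real.exp (- lg R (c1, c2))) *
    Real.exp (L (c1, t) - L (c1, c2)), ?_, ?_, fun s => (Real.exp_pos _).ne', ?_⟩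
  · exact AnalyticAt.fun_comp (g := Real.exp) analyticAt_rexp
      (an_comp2 aL analyticAt_id analyticAt_const rfl rfl).fun_neg
  · exact analyticAt_const.mul (AnalyticAt.fun_comp (g := Real.exp) analyticAt_rexp
      ((an_comp2 aL analyticAt_const analyticAt_id rfl rfl).fun_sub analyticAt_const))
  · have hp : ∀ᶠ x in nhds (c1, c2), 0 < R x / R (c1, c2) := by
      have : ContinuousAt (fun x => R x / R (c1, c2)) (c1, c2) := aR.continuousAt.div_const _
      exact continuousAt_const.eventually_lt this (by rw [div_self nR]; exact one_pos)
    filter_upwards [hp, am.continuousAt.eventually_ne nm, Metric.ball_mem_nhds (c1, c2) hr] with x h1 h2 h4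
    rw [← ball_prod_same] at h4
    have n1 : R x ≠ 0 := fun e => by simp [e] at h1
    have h5 := h x.1 h4.1 x.2 h4.2 c1 (Metric.mem_ball_self hr) c2 (Metric.mem_ball_self hr)
    simp only [← hLx] at h5
    rw [Prod.mk.eta] at h5
    have e1 : R x / R (c1, c2) = Real.exp (lg R x - lg R (c1, c2)) := by
      rw [lg, lg, ← Real.log_div n1 nR, Real.exp_log h1]
    have e2 : |m x| ^ τ = Real.exp (τ * lg m x) := by
      rw [Real.rpow_def_of_pos (abs_pos.2 h2), Real.log_abs, lg, mul_comm]
    have e3 : R x = R (c1, c2) * Real.exp (lg R x - lg R (c1, c2)) := by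
      rw [← e1]; field_simp
    have e4 := hLx x
    rw [e3, e2]
    have : Real.exp (lg R x - lg R (c1, c2)) * Real.exp (- L (x.1, c2)) =
      Real.exp (τ * lg m x) * (Real.exp (- lg R (c1, c2)) * Real.exp (L (c1, x.2) - L (c1, c2))) := by
      rw [← Real.exp_add, ← Real.exp_add, ← Real.exp_add]
      congr 1
      linarith
    linear_combination R (c1, c2) * this

theorem loc_homeo {E F : Type*} [NormedAddCommGroup E] [NormedSpace ℝ E] [CompleteSpace E]
    [NormedAddCommGroup F] [NormedSpace ℝ F] {f : E → F} {x : E} {e : E ≃L[ℝ] F}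
    (hs : HasStrictFDerivAt f (e : E →L[ℝ] F) x) :
    ∃ N ∈ nhds x, InjOn f N ∧ ∀ V ⊆ N, IsOpen V → IsOpen (f '' V) := by
  set P := hs.toOpenPartialHomeomorph f with hP
  have hx : x ∈ P.source := hs.mem_toOpenPartialHomeomorph_source
  refine ⟨P.source, P.open_source.mem_nhds hx, P.injOn, fun V hV hVo => ?_⟩
  exact P.isOpen_image_of_subset_source hVo hV

theorem loc_inj {f : ℝ → ℝ} {x : ℝ} (h : AnalyticAt ℝ f x) (h0 : deriv f x ≠ 0) :
    ∃ N ∈ nhds x, InjOn f N := by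
  have := h.hasStrictDerivAt.hasStrictFDerivAt_equiv h0
  obtain ⟨N, hN, hi, _⟩ := loc_homeo this
  exact ⟨N, hN, hi⟩

abbrev E2 := EuclideanSpace ℝ (Fin 2)

theorem funct_zero (L : E2 →L[ℝ] ℝ) {v : E2} (hv : v ≠ 0) (h1 : L v = 0) (h2 : L !₂[-(v 1), v 0] = 0) :
    L = 0 := by
  have hx : ∀ x : E2, L x = x 0 * L !₂[1, 0] + x 1 * L !₂[0, 1] := by
    intro x
    have : x = x 0 • (!₂[1, 0] : E2) + x 1 • (!₂[0, 1] : E2) := by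
      ext i; fin_cases i <;> simp
    conv_lhs => rw [this]
    simp
  have hn : v 0 ^ 2 + v 1 ^ 2 ≠ 0 := by
    intro h0
    apply hv
    ext i
    fin_cases i
    · simp; nlinarith [sq_nonneg (v 0), sq_nonneg (v 1)]
    · simp; nlinarith [sq_nonneg (v 0), sq_nonneg (v 1)]
  rw [hx] at h1 h2
  simp at h2
  have a0 : L !₂[1, 0] = 0 := by
    have : (v 0 ^ 2 + v 1 ^ 2) * L !₂[1, 0] = 0 := by linear_combination v 0 * h1 - v 1 * h2
    exact (mul_eq_zero.1 this).resolve_left hn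
  have a1 : L !₂[0, 1] = 0 := by
    have : (v 0 ^ 2 + v 1 ^ 2) * L !₂[0, 1] = 0 := by linear_combination v 1 * h1 + v 0 * h2
    exact (mul_eq_zero.1 this).resolve_left hn
  ext x
  rw [hx, a0, a1]; simp

theorem pair_inj {f g : E2 →L[ℝ] ℝ} (h : LinearIndependent ℝ ![f, g]) {v : E2} (hf : f v = 0) (hg : g v = 0) :
    v = 0 := by
  by_contra hv
  rw [LinearIndependent.pair_iff] at h
  have h1 := funct_zero (g !₂[-(v 1), v 0] • f + (- f !₂[-(v 1), v 0]) • g) hv (by simp [hf, hg]) (by simp; ring)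
  obtain ⟨_, h3⟩ := h _ _ h1
  have h4 := funct_zero f hv hf (by simpa using h3)
  have := (h 1 0 (by simp [h4])).1
  exact one_ne_zero this

theorem pair_equiv {f g : E2 →L[ℝ] ℝ} (h : LinearIndependent ℝ ![f, g]) :
    ∃ e : E2 ≃L[ℝ] ℝ × ℝ, (e : E2 →L[ℝ] ℝ × ℝ) = f.prod g := by
  have hinj : Function.Injective (f.prod g : E2 →ₗ[ℝ] ℝ × ℝ) := by
    rw [injective_iff_map_eq_zero]
    intro v hv
    have hv' : (f v, g v) = 0 := hv
    exact pair_inj h (Prod.ext_iff.1 hv').1 (Prod.ext_iff.1 hv').2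
  refine ⟨(LinearMap.linearEquivOfInjective _ hinj (by simp)).toContinuousLinearEquiv, ?_⟩
  ext v <;> rfl

theorem ball_point {x₀ x : E2} {r : ℝ} (hr : 0 < r) (hx : x ∈ Metric.closedBall x₀ r) {N : Set E2} (hN : N ∈ nhds x) :
    ∃ y s, 0 < s ∧ Metric.ball y s ⊆ N ∧ Metric.ball y s ⊆ Metric.closedBall x₀ r := by
  rw [← closure_ball x₀ hr.ne'] at hx
  rw [mem_closure_iff_nhds] at hx
  obtain ⟨y, hy1, hy2⟩ := hx (interior N) (interior_mem_nhds.2 hN)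
  have : interior N ∩ Metric.ball x₀ r ∈ nhds y :=
    (isOpen_interior.inter Metric.isOpen_ball).mem_nhds ⟨hy1, hy2⟩
  obtain ⟨s, hs, h⟩ := Metric.mem_nhds_iff.1 this
  exact ⟨y, s, hs, fun z hz => interior_subset (h hz).1, fun z hz => Metric.ball_subset_closedBall (h hz).2⟩

theorem chainT {f0 f1 f2 : E2 → ℝ} {p : ℝ × ℝ → ℝ} {z : E2} (h0 : DifferentiableAt ℝ f0 z)
    (h1 : DifferentiableAt ℝ f1 z) (hp : DifferentiableAt ℝ p (f0 z, f1 z))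
    (he : ∀ᶠ y in nhds z, p (f0 y, f1 y) = f2 y) :
    fderiv ℝ f2 z = pd1 p (f0 z, f1 z) • fderiv ℝ f0 z + pd2 p (f0 z, f1 z) • fderiv ℝ f1 z := by
  have h := (HasFDerivAt.comp z (f := fun y => (f0 y, f1 y)) hp.hasFDerivAt (h0.hasFDerivAt.prodMk h1.hasFDerivAt)).congr_of_eventuallyEq
    (f₁ := f2) (he.mono fun y hy => hy.symm)
  rw [h.fderiv]
  ext v
  have : (fderiv ℝ f0 z v, fderiv ℝ f1 z v) = fderiv ℝ f0 z v • e1 + fderiv ℝ f1 z v • e2 := by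
    simp [e1, e2]
  simp only [ContinuousLinearMap.comp_apply, ContinuousLinearMap.prod_apply, ContinuousLinearMap.add_apply,
    ContinuousLinearMap.smul_apply]
  rw [this, map_add, map_smul, map_smul]
  simp only [smul_eq_mul, pd1, pd2]
  ring

/-- measurable local data -/
theorem base_exists {φ0 A1 A2 : ℝ × ℝ → ℝ} {c1 c2 : ℝ} (h : AnalyticAt ℝ φ0 (c1, c2))
    (n1 : pd1 φ0 (c1, c2) ≠ 0) (n2 : pd2 φ0 (c1, c2) ≠ 0) (aA1 : AnalyticAt ℝ A1 (c1, c2))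
    (aA2 : AnalyticAt ℝ A2 (c1, c2)) (nA1 : A1 (c1, c2) ≠ 0) (nA2 : A2 (c1, c2) ≠ 0) :
    ∃ φ ξ ζ : ℝ × ℝ → ℝ, Measurable φ ∧ Measurable ξ ∧ Measurable ζ ∧ φ =ᶠ[nhds (c1, c2)] φ0 ∧
      Base φ ξ ζ A1 A2 (c1, c2) ∧ (∀ᶠ q in nhds (c1, φ (c1, c2)), φ (q.1, ξ q) = q.2) := by
  obtain ⟨φ, mφ, hφ⟩ := meas_germ h
  have aφ : AnalyticAt ℝ φ (c1, c2) := h.congr hφ.symm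
  have fd := hφ.fderiv_eq (𝕜 := ℝ)
  have n1' : pd1 φ (c1, c2) ≠ 0 := by unfold pd1; rw [fd]; exact n1
  have n2' : pd2 φ (c1, c2) ≠ 0 := by unfold pd2; rw [fd]; exact n2
  obtain ⟨ξ0, aξ0, ξc0, hξ0, hξ20⟩ := ift2 aφ n2'
  have aS : AnalyticAt ℝ (fun q : ℝ × ℝ => φ (q.2, q.1)) (c2, c1) :=
    an_comp2 aφ analyticAt_snd analyticAt_fst rfl rfl
  have nS : fderiv ℝ (fun q : ℝ × ℝ => φ (q.2, q.1)) (c2, c1) (0, 1) ≠ 0 := by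
    have t := pd2_deriv aS.differentiableAt
    have t2 : HasDerivAt (fun s => φ (s, c2)) (pd2 (fun q : ℝ × ℝ => φ (q.2, q.1)) (c2, c1)) c1 := t
    have := t2.unique (pd1_deriv aφ.differentiableAt)
    intro h0
    exact n1' (this.symm.trans h0)
  obtain ⟨ζ0, aζ0, ζc0, hζ0, hζ20⟩ := ift2 aS nS
  simp only at aξ0 ξc0 hξ0 hξ20 aζ0 ζc0 hζ0 hζ20
  obtain ⟨ξ, mξ, gξ⟩ := meas_germ aξ0
  obtain ⟨ζ, mζ, gζ⟩ := meas_germ aζ0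
  have t1 : Filter.Tendsto (fun x => (x.1, φ x)) (nhds (c1, c2)) (nhds (c1, φ (c1, c2))) :=
    (continuousAt_fst.prodMk aφ.continuousAt)
  have t2 : Filter.Tendsto (fun x => (x.2, φ x)) (nhds (c1, c2)) (nhds (c2, φ (c1, c2))) :=
    (continuousAt_snd.prodMk aφ.continuousAt)
  have ts : Filter.Tendsto (fun x : ℝ × ℝ => (x.2, x.1)) (nhds (c1, c2)) (nhds (c2, c1)) :=
    (by fun_prop : Continuous (fun x : ℝ × ℝ => (x.2, x.1))).tendsto' _ _ rfl
  refine ⟨φ, ξ, ζ, mφ, mξ, mζ, hφ, ⟨aφ, aξ0.congr gξ.symm, aζ0.congr gζ.symm, aA1, aA2, nA1, nA2, ?_, ?_, ?_, ?_, ?_⟩, ?_⟩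
  · exact gξ.self_of_nhds.trans ξc0
  · exact gζ.self_of_nhds.trans ζc0
  · filter_upwards [t1.eventually gξ, hξ0] with x h1 h2
    exact h1.trans h2
  · filter_upwards [t2.eventually gζ, ts.eventually hζ0] with x h1 h2
    exact h1.trans h2
  · filter_upwards [gζ, hζ20] with q h1 h2
    rw [h1]; exact h2
  · filter_upwards [gξ, hξ20] with q h1 h2
    rw [h1]; exact h2

/-- a locally additive web is flat -/
theorem flat_witness {φ : Fin 3 → E2 → ℝ} {x : E2} (hφ : ∀ j, AnalyticAt ℝ (φ j) x)
    (hI : LinearIndependent ℝ ![fderiv ℝ (φ 0) x, fderiv ℝ (φ 1) x]) {P Q ψ : ℝ → ℝ}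
    (aP : AnalyticAt ℝ P (φ 0 x)) (aQ : AnalyticAt ℝ Q (φ 1 x)) (aψ : AnalyticAt ℝ ψ (φ 2 x))
    (dP : deriv P (φ 0 x) ≠ 0) (dQ : deriv Q (φ 1 x) ≠ 0) (dψ : deriv ψ (φ 2 x) ≠ 0)
    (he : ∀ᶠ y in nhds x, P (φ 0 y) + Q (φ 1 y) = ψ (φ 2 y)) :
    ∃ N ∈ nhds x, ∀ V ⊆ N, IsOpen V →
      ∃ (Φ : EuclideanSpace ℝ (Fin 2) → EuclideanSpace ℝ (Fin 2)) (ψ : Fin 3 → ℝ → ℝ)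
        (L : Fin 3 → (EuclideanSpace ℝ (Fin 2) →L[ℝ] ℝ)) (c : Fin 3 → ℝ),
        AnalyticOnNhd ℝ Φ V ∧ Set.InjOn Φ V ∧ IsOpen (Φ '' V) ∧
        (∀ j, AnalyticOnNhd ℝ (ψ j) (φ j '' V) ∧ Set.InjOn (ψ j) (φ j '' V)) ∧
        ∀ j, ∀ x ∈ V, ψ j (φ j x) = L j (Φ x) + c j := by
  obtain ⟨j, hj⟩ := pair_equiv hI
  have a0 : AnalyticAt ℝ (fun y => P (φ 0 y)) x := AnalyticAt.fun_comp (g := P) aP (hφ 0)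
  have a1 : AnalyticAt ℝ (fun y => Q (φ 1 y)) x := AnalyticAt.fun_comp (g := Q) aQ (hφ 1)
  have d0 : fderiv ℝ (fun y => P (φ 0 y)) x = deriv P (φ 0 x) • fderiv ℝ (φ 0) x :=
    (aP.differentiableAt.hasDerivAt.comp_hasFDerivAt x (hφ 0).differentiableAt.hasFDerivAt).fderiv
  have d1 : fderiv ℝ (fun y => Q (φ 1 y)) x = deriv Q (φ 1 x) • fderiv ℝ (φ 1) x :=
    (aQ.differentiableAt.hasDerivAt.comp_hasFDerivAt x (hφ 1).differentiableAt.hasFDerivAt).fderiv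
  have hI' : LinearIndependent ℝ ![fderiv ℝ (fun y => P (φ 0 y)) x, fderiv ℝ (fun y => Q (φ 1 y)) x] := by
    rw [LinearIndependent.pair_iff] at hI ⊢
    intro s t hst
    rw [d0, d1, smul_smul, smul_smul] at hst
    obtain ⟨h1, h2⟩ := hI _ _ hst
    exact ⟨(mul_eq_zero.1 h1).resolve_right dP, (mul_eq_zero.1 h2).resolve_right dQ⟩
  obtain ⟨e, he2⟩ := pair_equiv hI'
  have aT : AnalyticAt ℝ (fun y => (P (φ 0 y), Q (φ 1 y))) x := a0.prod a1
  have sT : HasStrictFDerivAt (fun y => j.symm (P (φ 0 y), Q (φ 1 y))) ((e.trans j.symm : E2 ≃L[ℝ] E2) : E2 →L[ℝ] E2) x := by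
    have h1 := aT.hasStrictFDerivAt
    have h2 : fderiv ℝ (fun y => (P (φ 0 y), Q (φ 1 y))) x = (e : E2 →L[ℝ] ℝ × ℝ) := by
      rw [he2]
      exact (a0.differentiableAt.hasFDerivAt.prodMk a1.differentiableAt.hasFDerivAt).fderiv
    rw [h2] at h1
    exact (j.symm.hasStrictFDerivAt).comp x h1
  obtain ⟨N0, hN0, inj0, open0⟩ := loc_homeo sT
  obtain ⟨NP, hNP, iP⟩ := loc_inj aP dP
  obtain ⟨NQ, hNQ, iQ⟩ := loc_inj aQ dQ
  obtain ⟨Nψ, hNψ, iψ⟩ := loc_inj aψ dψ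
  have ev : ∀ᶠ y in nhds x, P (φ 0 y) + Q (φ 1 y) = ψ (φ 2 y) ∧ y ∈ N0 ∧ φ 0 y ∈ NP ∧ φ 1 y ∈ NQ ∧
      φ 2 y ∈ Nψ ∧ AnalyticAt ℝ (fun y => (P (φ 0 y), Q (φ 1 y))) y ∧ AnalyticAt ℝ P (φ 0 y) ∧
      AnalyticAt ℝ Q (φ 1 y) ∧ AnalyticAt ℝ ψ (φ 2 y) := by
    filter_upwards [he, hN0, (hφ 0).continuousAt.eventually hNP, (hφ 1).continuousAt.eventually hNQ,
      (hφ 2).continuousAt.eventually hNψ, aT.eventually_analyticAt,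
      (hφ 0).continuousAt.eventually aP.eventually_analyticAt,
      (hφ 1).continuousAt.eventually aQ.eventually_analyticAt,
      (hφ 2).continuousAt.eventually aψ.eventually_analyticAt] with y h1 h2 h3 h4 h5 h6 h7 h8 h9
    exact ⟨h1, h2, h3, h4, h5, h6, h7, h8, h9⟩
  refine ⟨_, ev, fun V hV hVo => ?_⟩
  refine ⟨fun y => j.symm (P (φ 0 y), Q (φ 1 y)), ![P, Q, ψ],
    ![(ContinuousLinearMap.fst ℝ ℝ ℝ).comp (j : E2 →L[ℝ] ℝ × ℝ), (ContinuousLinearMap.snd ℝ ℝ ℝ).comp (j : E2 →L[ℝ] ℝ × ℝ),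
      (ContinuousLinearMap.fst ℝ ℝ ℝ).comp (j : E2 →L[ℝ] ℝ × ℝ) + (ContinuousLinearMap.snd ℝ ℝ ℝ).comp (j : E2 →L[ℝ] ℝ × ℝ)],
    fun _ => 0, ?_, ?_, ?_, ?_, ?_⟩
  · intro y hy
    exact ((j.symm : ℝ × ℝ →L[ℝ] E2).analyticAt _).fun_comp (hV hy).2.2.2.2.2.1
  · exact inj0.mono fun y hy => (hV hy).2.1
  · exact open0 V (fun y hy => (hV hy).2.1) hVo
  · intro i
    fin_cases i
    · refine ⟨?_, ?_⟩
      · rintro _ ⟨y, hy, rfl⟩; exact (hV hy).2.2.2.2.2.2.1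
      · refine iP.mono ?_; rintro _ ⟨y, hy, rfl⟩; exact (hV hy).2.2.1
    · refine ⟨?_, ?_⟩
      · rintro _ ⟨y, hy, rfl⟩; exact (hV hy).2.2.2.2.2.2.2.1
      · refine iQ.mono ?_; rintro _ ⟨y, hy, rfl⟩; exact (hV hy).2.2.2.1
    · refine ⟨?_, ?_⟩
      · rintro _ ⟨y, hy, rfl⟩; exact (hV hy).2.2.2.2.2.2.2.2
      · refine iψ.mono ?_; rintro _ ⟨y, hy, rfl⟩; exact (hV hy).2.2.2.2.1
  · intro i y hy
    fin_cases i
    · simp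
    · simp
    · simp; exact (hV hy).1.symm

theorem chart_main
    (x₀ : EuclideanSpace ℝ (Fin 2)) (r : ℝ) (hr : 0 < r)
    (Bt : Set (EuclideanSpace ℝ (Fin 2))) (hBtOpen : IsOpen Bt)
    (hBBt : Metric.closedBall x₀ r ⊆ Bt)
    (a φ : Fin 3 → EuclideanSpace ℝ (Fin 2) → ℝ)
    (ha : ∀ j, AnalyticOnNhd ℝ (a j) Bt)
    (hφ : ∀ j, AnalyticOnNhd ℝ (φ j) Bt)
    (haNz : ∀ j, ∀ x ∈ Bt, a j x ≠ 0)
    (hInd : ∀ i j : Fin 3, i ≠ j → ∀ x ∈ Bt,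
      LinearIndependent ℝ ![fderiv ℝ (φ i) x, fderiv ℝ (φ j) x])
    (hcurv : ¬ ∃ V : Set (EuclideanSpace ℝ (Fin 2)),
      V ⊆ Metric.closedBall x₀ r ∧ IsOpen V ∧ V.Nonempty ∧ IsConnected V ∧
      ∃ (Φ : EuclideanSpace ℝ (Fin 2) → EuclideanSpace ℝ (Fin 2)) (ψ : Fin 3 → ℝ → ℝ)
        (L : Fin 3 → (EuclideanSpace ℝ (Fin 2) →L[ℝ] ℝ)) (c : Fin 3 → ℝ),
        AnalyticOnNhd ℝ Φ V ∧ Set.InjOn Φ V ∧ IsOpen (Φ '' V) ∧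
        (∀ j, AnalyticOnNhd ℝ (ψ j) (φ j '' V) ∧ Set.InjOn (ψ j) (φ j '' V)) ∧
        ∀ j, ∀ x ∈ V, ψ j (φ j x) = L j (Φ x) + c j)
    (W₃ : EuclideanSpace ℝ (Fin 2) → EuclideanSpace ℝ (Fin 2))
    (hW₃nz : ∀ x ∈ Bt, W₃ x ≠ 0)
    (hW₃φ : ∀ x ∈ Bt, fderiv ℝ (φ 2) x (W₃ x) = 0)
    (hAux : ∀ τ : ℝ, ∀ U : Set (EuclideanSpace ℝ (Fin 2)),
      U ⊆ Metric.closedBall x₀ r → IsOpen U → U.Nonempty →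
      ∀ h₁ h₂ : ℝ → ℝ, AnalyticOnNhd ℝ h₁ (φ 0 '' U) → AnalyticOnNhd ℝ h₂ (φ 1 '' U) →
      (∀ x ∈ U, a 0 x * |fderiv ℝ (φ 0) x (W₃ x)| ^ τ * h₁ (φ 0 x) +
          a 1 x * |fderiv ℝ (φ 1) x (W₃ x)| ^ τ * h₂ (φ 1 x) = 0) →
      (∀ y ∈ φ 0 '' U, h₁ y = 0) ∧ (∀ y ∈ φ 1 '' U, h₂ y = 0))
    (x : E2) (hx : x ∈ Metric.closedBall x₀ r) :
    ∃ (P : Pkg) (K ρ : ℝ), 0 < K ∧ 0 < ρ ∧ Metric.ball x ρ ⊆ Bt ∧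
      (∀ y ∈ Metric.ball x ρ, (φ 0 y, φ 1 y) ∈ P.I1 ×ˢ P.I2 ∧ P.φ (φ 0 y, φ 1 y) = φ 2 y ∧
        P.A1 (φ 0 y, φ 1 y) = a 0 y / a 2 y ∧ P.A2 (φ 0 y, φ 1 y) = a 1 y / a 2 y ∧ |(a 2 y)⁻¹| ≤ K) ∧
      (∀ y ∈ Metric.ball x ρ, ∀ z ∈ Metric.ball x ρ,
        dist y z ≤ K * dist (φ 0 y, φ 1 y) (φ 0 z, φ 1 z) ∧
        dist (φ 0 y, φ 1 y) (φ 0 z, φ 1 z) ≤ K * dist y z) := by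
  have hxB := hBBt hx
  have nB : Bt ∈ nhds x := hBtOpen.mem_nhds hxB
  obtain ⟨e, he⟩ := pair_equiv (hInd 0 1 (by decide) x hxB)
  have aΘ : AnalyticAt ℝ (fun y => (φ 0 y, φ 1 y)) x := (hφ 0 x hxB).prod (hφ 1 x hxB)
  have dΘ : fderiv ℝ (fun y => (φ 0 y, φ 1 y)) x = e := by
    rw [he]
    exact ((hφ 0 x hxB).differentiableAt.hasFDerivAt.prodMk (hφ 1 x hxB).differentiableAt.hasFDerivAt).fderiv
  obtain ⟨Λ, aΛ, Λc, hΛ1, hΛ2⟩ := an_inv aΘ e dΘ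
  have tΘ : Filter.Tendsto (fun y => (φ 0 y, φ 1 y)) (nhds x) (nhds (φ 0 x, φ 1 x)) := aΘ.continuousAt
  beta_reduce at aΛ Λc hΛ2
  have cmp : ∀ g : E2 → ℝ, AnalyticAt ℝ g x → AnalyticAt ℝ (fun q => g (Λ q)) (φ 0 x, φ 1 x) := by
    intro g hg
    refine AnalyticAt.fun_comp (g := g) ?_ aΛ
    rw [Λc]; exact hg
  have aφ0 := cmp (φ 2) (hφ 2 x hxB)
  have aA1 := cmp _ ((ha 0 x hxB).div (ha 2 x hxB) (haNz 2 x hxB))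
  have aA2 := cmp _ ((ha 1 x hxB).div (ha 2 x hxB) (haNz 2 x hxB))
  have ev2 : ∀ᶠ y in nhds x, φ 2 (Λ (φ 0 y, φ 1 y)) = φ 2 y := hΛ1.mono fun y hy => by rw [hy]
  have dec := chainT (p := fun q => φ 2 (Λ q)) (hφ 0 x hxB).differentiableAt (hφ 1 x hxB).differentiableAt
    aφ0.differentiableAt ev2
  have n1 : pd1 (fun q => φ 2 (Λ q)) (φ 0 x, φ 1 x) ≠ 0 := by
    intro h0
    have hi := hInd 2 1 (by decide) x hxB
    rw [LinearIndependent.pair_iff] at hi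
    rw [h0, zero_smul, zero_add] at dec
    have := (hi 1 (- pd2 (fun q => φ 2 (Λ q)) (φ 0 x, φ 1 x)) (by rw [dec]; simp)).1
    exact one_ne_zero this
  have n2 : pd2 (fun q => φ 2 (Λ q)) (φ 0 x, φ 1 x) ≠ 0 := by
    intro h0
    have hi := hInd 2 0 (by decide) x hxB
    rw [LinearIndependent.pair_iff] at hi
    rw [h0, zero_smul, add_zero] at dec
    have := (hi 1 (- pd1 (fun q => φ 2 (Λ q)) (φ 0 x, φ 1 x)) (by rw [dec]; simp)).1
    exact one_ne_zero this
  have nA : ∀ j, a j (Λ (φ 0 x, φ 1 x)) ≠ 0 := fun j => by rw [Λc]; exact haNz j x hxB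
  obtain ⟨φp, ξ, ζ, mφ, mξ, mζ, gφ, B, hξ2⟩ := base_exists aφ0 n1 n2 aA1 aA2
    (div_ne_zero (nA 0) (nA 2)) (div_ne_zero (nA 1) (nA 2))
  have fd := gφ.fderiv_eq (𝕜 := ℝ)
  have n1' : pd1 φp (φ 0 x, φ 1 x) ≠ 0 := by unfold pd1; rw [fd]; exact n1
  have n2' : pd2 φp (φ 0 x, φ 1 x) ≠ 0 := by unfold pd2; rw [fd]; exact n2
  have evφ : ∀ᶠ y in nhds x, φp (φ 0 y, φ 1 y) = φ 2 y := by
    filter_upwards [tΘ.eventually gφ, ev2] with y h1 h2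
    exact h1.trans h2
  have hφc : φp (φ 0 x, φ 1 x) = φ 2 x := evφ.self_of_nhds
  have hJ : ¬ ∀ᶠ w in nhds ((((φ 0 x, φ 1 x), φ 0 x), φ 1 x) : W4), JJ φp ξ ζ
      (fun q => (a 0 / a 2) (Λ q)) (fun q => (a 1 / a 2) (Λ q)) w = 0 := by
    intro hJ
    obtain ⟨ρ, hρ, hgood, hd⟩ := J_dicho B n1' n2' hJ
    rcases hd with hM | ⟨τ, hN⟩
    · obtain ⟨P, Q, ψ, aP, aQ, aψ, dP, dQ, dψ, hf⟩ := flat_of_sep hρ B.aφ B.aξ n1' n2' B.hξ hξ2 hM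
      rw [hφc] at aψ dψ
      obtain ⟨N, hN, hw⟩ := flat_witness (fun j => hφ j x hxB) (hInd 0 1 (by decide) x hxB) aP aQ aψ dP dQ dψ
        (by filter_upwards [tΘ.eventually hf, evφ] with y h1 h2
            rw [h2] at h1; exact h1)
      obtain ⟨y, s, hs, h1, h2⟩ := ball_point hr hx hN
      exact hcurv ⟨Metric.ball y s, h2, Metric.isOpen_ball, ⟨y, Metric.mem_ball_self hs⟩,
        ⟨⟨y, Metric.mem_ball_self hs⟩, (convex_ball y s).isPreconnected⟩, hw _ h1 Metric.isOpen_ball⟩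
    · have am : AnalyticAt ℝ (mm φp) (φ 0 x, φ 1 x) := (pd1_an B.aφ).div (pd2_an B.aφ) n2'
      have aR : AnalyticAt ℝ (rr (fun q => (a 0 / a 2) (Λ q)) (fun q => (a 1 / a 2) (Λ q))) (φ 0 x, φ 1 x) :=
        B.aA1.div B.aA2 B.nA2
      obtain ⟨h1, h2, ah1, ah2, hn, heq⟩ := aux_of_sep hρ am aR (div_ne_zero n1' n2')
        (div_ne_zero B.nA1 B.nA2) hN
      have ev : ∀ᶠ y in nhds x, AnalyticAt ℝ h1 (φ 0 y) ∧ AnalyticAt ℝ h2 (φ 1 y) ∧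
          a 0 y * |fderiv ℝ (φ 0) y (W₃ y)| ^ τ * h1 (φ 0 y) +
          a 1 y * |fderiv ℝ (φ 1) y (W₃ y)| ^ τ * h2 (φ 1 y) = 0 := by
        filter_upwards [(hφ 0 x hxB).continuousAt.eventually ah1.eventually_analyticAt,
          (hφ 1 x hxB).continuousAt.eventually ah2.eventually_analyticAt, tΘ.eventually heq, nB,
          evφ.eventually_nhds, tΘ.eventually B.aφ.eventually_analyticAt,
          tΘ.eventually ((pd2_an B.aφ).continuousAt.eventually_ne n2'), hΛ1] with y k1 k2 k3 k4 k5 k6 k7 k8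
        refine ⟨k1, k2, ?_⟩
        have dec := chainT (hφ 0 y k4).differentiableAt (hφ 1 y k4).differentiableAt k6.differentiableAt k5
        have w0 := hW₃φ y k4
        rw [dec] at w0
        simp only [ContinuousLinearMap.add_apply, ContinuousLinearMap.smul_apply, smul_eq_mul] at w0
        have w1 : fderiv ℝ (φ 1) y (W₃ y) = - mm φp (φ 0 y, φ 1 y) * fderiv ℝ (φ 0) y (W₃ y) := by
          unfold mm; field_simp; linarith
        have a0 := haNz 0 y k4
        have a1 := haNz 1 y k4
        have a2 := haNz 2 y k4
        have w2 : rr (fun q => (a 0 / a 2) (Λ q)) (fun q => (a 1 / a 2) (Λ q)) (φ 0 y, φ 1 y) = a 0 y / a 1 y := by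
          simp only [rr, k8, Pi.div_apply]
          field_simp
        rw [w2] at k3
        rw [w1, abs_mul, abs_neg, Real.mul_rpow (abs_nonneg _) (abs_nonneg _)]
        field_simp at k3
        linear_combination |fderiv ℝ (φ 0) y (W₃ y)| ^ τ * k3
      obtain ⟨y, s, hs, b1, b2⟩ := ball_point hr hx ev
      have := (hAux τ (Metric.ball y s) b2 Metric.isOpen_ball ⟨y, Metric.mem_ball_self hs⟩ h1 h2
        (by rintro _ ⟨z, hz, rfl⟩; exact (b1 hz).1) (by rintro _ ⟨z, hz, rfl⟩; exact (b1 hz).2.1)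
        (fun z hz => (b1 hz).2.2)).1 _ ⟨y, Metric.mem_ball_self hs, rfl⟩
      exact hn _ this
  obtain ⟨P, p1, p2, p3, p4, p5, _⟩ := pkg_exists B mφ mξ mζ hJ 1 one_pos
  obtain ⟨K1, r1, hK1, hr1, l1⟩ := an_lip aΘ
  obtain ⟨K2, r2, hK2, hr2, l2⟩ := an_lip aΛ
  have a2i : ContinuousAt (fun y => |(a 2 y)⁻¹|) x :=
    ((ha 2 x hxB).continuousAt.inv₀ (haNz 2 x hxB)).abs
  have ev : ∀ᶠ y in nhds x, y ∈ Bt ∧ φp (φ 0 y, φ 1 y) = φ 2 y ∧ Λ (φ 0 y, φ 1 y) = y ∧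
      y ∈ Metric.ball x r1 ∧ (φ 0 y, φ 1 y) ∈ Metric.ball (φ 0 x, φ 1 x) r2 ∧
      (φ 0 y, φ 1 y) ∈ Metric.ball (φ 0 x, φ 1 x) P.δ ∧ |(a 2 y)⁻¹| < |(a 2 x)⁻¹| + 1 := by
    filter_upwards [nB, evφ, hΛ1, Metric.ball_mem_nhds x hr1, tΘ.eventually (Metric.ball_mem_nhds _ hr2),
      tΘ.eventually (Metric.ball_mem_nhds _ P.hδ), a2i.eventually_lt (continuousAt_const (y := |(a 2 x)⁻¹| + 1)) (by simp)] with y k1 k2 k3 k4 k5 k6 k7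
    exact ⟨k1, k2, k3, k4, k5, k6, k7⟩
  obtain ⟨ρ, hρ, hb⟩ := Metric.mem_nhds_iff.1 ev
  refine ⟨P, K1 + K2 + |(a 2 x)⁻¹| + 1, ρ, by positivity, hρ, fun y hy => (hb hy).1, ?_, ?_⟩
  · intro y hy
    obtain ⟨k1, k2, k3, k4, k5, k6, k7⟩ := hb hy
    refine ⟨?_, by rw [p3]; exact k2, by rw [p4]; simp [k3], by rw [p5]; simp [k3], by linarith⟩
    rw [← ball_prod_same] at k6
    have q1 := k6.1
    have q2 := k6.2
    simp only [Metric.mem_ball, Real.dist_eq, abs_lt] at q1 q2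
    unfold Pkg.I1 Pkg.I2
    rw [p1, p2]
    exact ⟨⟨by linarith, by linarith⟩, ⟨by linarith, by linarith⟩⟩
  · intro y hy z hz
    obtain ⟨k1, k2, k3, k4, k5, k6, k7⟩ := hb hy
    obtain ⟨j1, j2, j3, j4, j5, j6, j7⟩ := hb hz
    have t1 := l1 y k4 z j4
    have t2 := l2 _ k5 _ j5
    rw [k3, j3] at t2
    rw [dist_eq_norm, dist_eq_norm]
    have := abs_nonneg (a 2 x)⁻¹
    constructor
    · refine t2.trans ?_
      gcongr; linarith
    · refine t1.trans ?_
      gcongr; linarith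

theorem const_floor {ε : ℝ} (hε : 0 < ε) (g : ℤ → ℝ) : ConstOnIntervals (fun y => g ⌊y / ε⌋) ε := by
  refine ⟨0, fun n => ⟨g n, fun y hy => ?_⟩⟩
  have : ⌊y / ε⌋ = n := by
    rw [Int.floor_eq_iff, le_div_iff₀ hε, div_lt_iff₀ hε]
    simpa using hy
  simp [this]

def uE : E2 ≃ᵐ ℝ × ℝ := (MeasurableEquiv.toLp 2 (Fin 2 → ℝ)).symm.trans MeasurableEquiv.finTwoArrow

theorem uE_apply (z : E2) : uE z = (z 0, z 1) := rfl

theorem uE_mp : MeasurePreserving uE (volume : Measure E2) (volume : Measure (ℝ × ℝ)) :=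
  (EuclideanSpace.volume_preserving_symm_measurableEquiv_toLp (Fin 2)).trans (volume_preserving_finTwoArrow ℝ)

theorem uE_image (A : Set E2) : volume (uE '' A) = volume A := by
  have := uE_mp.measure_preimage_equiv (uE '' A)
  rw [← this, Set.preimage_image_eq _ uE.injective]

theorem uE_dist (y z : E2) : dist (uE y) (uE z) ≤ dist y z ∧ dist y z ≤ 2 * dist (uE y) (uE z) := by
  rw [EuclideanSpace.dist_eq, uE_apply, uE_apply, Prod.dist_eq]
  simp only [Fin.sum_univ_two]
  have h0 := dist_nonneg (x := y 0) (y := z 0)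
  have h1 := dist_nonneg (x := y 1) (y := z 1)
  constructor
  · apply max_le
    · apply Real.le_sqrt_of_sq_le; nlinarith
    · apply Real.le_sqrt_of_sq_le; nlinarith
  · rw [Real.sqrt_le_left (by positivity)]
    have a := le_max_left (dist (y 0) (z 0)) (dist (y 1) (z 1))
    have b := le_max_right (dist (y 0) (z 0)) (dist (y 1) (z 1))
    nlinarith [mul_self_le_mul_self h0 a, mul_self_le_mul_self h1 b]

theorem volB {A : Set E2} {T : E2 → ℝ × ℝ} {L : ℝ} (hL : 0 ≤ L)
    (h : ∀ s ∈ A, ∀ t ∈ A, dist s t ≤ L * dist (T s) (T t)) :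
    volume A ≤ ENNReal.ofReal L ^ (2:ℝ) * volume (T '' A) := by
  have := vol_le_image2 (A := uE '' A) (F := fun p => T (uE.symm p)) hL (by
    rintro _ ⟨s, hs, rfl⟩ _ ⟨t, ht, rfl⟩
    simp only [MeasurableEquiv.symm_apply_apply]
    exact (uE_dist s t).1.trans (h s hs t ht))
  rw [uE_image, Set.image_image] at this
  simpa using this

theorem volA {A : Set E2} {T : E2 → ℝ × ℝ} {L : ℝ} (hL : 0 ≤ L) (hi : InjOn T A)
    (h : ∀ s ∈ A, ∀ t ∈ A, dist (T s) (T t) ≤ L * dist s t) :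
    volume (T '' A) ≤ ENNReal.ofReal (2 * L) ^ (2:ℝ) * volume A := by
  have hinv : ∀ s ∈ A, Function.invFunOn T A (T s) = s := fun s hs => hi.leftInvOn_invFunOn hs
  have := vol_le_image2 (A := T '' A) (F := fun p => uE (Function.invFunOn T A p)) (L := 2 * L) (by positivity) (by
    rintro _ ⟨s, hs, rfl⟩ _ ⟨t, ht, rfl⟩
    simp only [hinv s hs, hinv t ht]
    refine (h s hs t ht).trans ?_
    nlinarith [(uE_dist s t).2])
  rw [Set.image_image] at this
  have e : (fun s => uE (Function.invFunOn T A (T s))) '' A = uE '' A := by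
    apply Set.image_congr
    intro s hs; rw [hinv s hs]
  rw [e, uE_image] at this
  exact this

theorem local_main {φ a : Fin 3 → E2 → ℝ} {P : Pkg} {K ρ : ℝ} {x : E2} (hK : 0 < K)
    (hc : ∀ j, ContinuousOn (φ j) (Metric.ball x ρ)) (ha : ∀ y ∈ Metric.ball x ρ, a 2 y ≠ 0)
    (h1 : ∀ y ∈ Metric.ball x ρ, (φ 0 y, φ 1 y) ∈ P.I1 ×ˢ P.I2 ∧ P.φ (φ 0 y, φ 1 y) = φ 2 y ∧
        P.A1 (φ 0 y, φ 1 y) = a 0 y / a 2 y ∧ P.A2 (φ 0 y, φ 1 y) = a 1 y / a 2 y ∧ |(a 2 y)⁻¹| ≤ K)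
    (h2 : ∀ y ∈ Metric.ball x ρ, ∀ z ∈ Metric.ball x ρ,
        dist y z ≤ K * dist (φ 0 y, φ 1 y) (φ 0 z, φ 1 z) ∧
        dist (φ 0 y, φ 1 y) (φ 0 z, φ 1 z) ≤ K * dist y z) {σ : ℝ} (hσ : 0 < σ) :
    ∃ C D : ℝ, 1 ≤ C ∧ 1 ≤ D ∧ ∀ ε, 0 < ε → ε ≤ 1 → ∀ f : Fin 3 → ℝ → ℝ, (∀ j, Measurable (f j)) →
      (∀ j, ∀ᵐ y ∂(volume : Measure ℝ), |f j y| ≤ 2) → ∀ S : Set E2, MeasurableSet S →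
      S ⊆ Metric.ball x ρ → (∀ z ∈ S, |∑ j, a j z * f j (φ j z)| < ε) →
      volume S ≤ ENNReal.ofReal (D * ε ^ (1 / C)) ∨ ∃ (g : ℝ → ℝ) (S' : Set E2), ConstOnIntervals g ε ∧
        MeasurableSet S' ∧ S' ⊆ S ∧ ENNReal.ofReal (D⁻¹ * (volume S).toReal ^ C) ≤ volume S' ∧
        ∀ z ∈ S', |g (φ 0 z) - f 0 (φ 0 z)| ≤ ε ^ (1 - σ) := by
  obtain ⟨C, hC, hcomb⟩ := P.comb hK.le hσ
  -- comparison constant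
  obtain ⟨κ, hκ, hκA, hκB⟩ : ∃ κ : ℝ, 1 ≤ κ ∧ ENNReal.ofReal (2 * K) ^ (2:ℝ) ≤ ENNReal.ofReal κ ∧
      ENNReal.ofReal K ^ (2:ℝ) ≤ ENNReal.ofReal κ := by
    refine ⟨(2 * K) ^ (2:ℝ) + 1, ?_, ?_, ?_⟩
    · have : (0:ℝ) ≤ (2 * K) ^ (2:ℝ) := by positivity
      linarith
    · rw [ENNReal.ofReal_rpow_of_nonneg (by positivity) (by norm_num)]
      exact ENNReal.ofReal_le_ofReal (by linarith)
    · rw [ENNReal.ofReal_rpow_of_nonneg (by positivity) (by norm_num)]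
      refine ENNReal.ofReal_le_ofReal ?_
      have : K ^ (2:ℝ) ≤ (2 * K) ^ (2:ℝ) := by gcongr; linarith
      linarith
  have hκ0 : 0 < κ := by linarith
  set T : E2 → ℝ × ℝ := fun y => (φ 0 y, φ 1 y) with hT
  have inj : InjOn T (Metric.ball x ρ) := by
    intro y hy z hz hyz
    have := (h2 y hy z hz).1
    rw [show (φ 0 y, φ 1 y) = (φ 0 z, φ 1 z) from hyz, dist_self, mul_zero] at this
    exact dist_le_zero.1 this
  have vA : ∀ A ⊆ Metric.ball x ρ, volume (T '' A) ≤ ENNReal.ofReal κ * volume A := fun A hA =>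
    (volA hK.le (inj.mono hA) fun s hs t ht => (h2 s (hA hs) t (hA ht)).2).trans (by gcongr)
  have vB : ∀ A ⊆ Metric.ball x ρ, volume A ≤ ENNReal.ofReal κ * volume (T '' A) := fun A hA =>
    (volB hK.le fun s hs t ht => (h2 s (hA hs) t (hA ht)).1).trans (by gcongr)
  have cT : ContinuousOn T (Metric.ball x ρ) := (hc 0).prodMk (hc 1)
  -- measurable extensions
  have mext : ∀ j, ∃ u : E2 → ℝ, Measurable u ∧ ∀ z ∈ Metric.ball x ρ, u z = φ j z := by
    intro j
    classical
    refine ⟨(Metric.ball x ρ).piecewise (φ j) 0,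
      (hc j).measurable_piecewise (g := (0 : E2 → ℝ)) continuousOn_const measurableSet_ball, fun z hz => ?_⟩
    simp [hz]
  obtain ⟨u0, mu0, hu0⟩ := mext 0
  obtain ⟨u1, mu1, hu1⟩ := mext 1
  refine ⟨C, κ ^ (1 + C) * C, hC, ?_, ?_⟩
  · exact one_le_mul_of_one_le_of_one_le (Real.one_le_rpow hκ (by linarith)) hC
  intro ε hε hε1 f mf bf S mS hSb hS
  set cl : ℝ → ℝ := fun t => max (-2) (min 2 t) with hcl
  have mcl : Measurable cl := by fun_prop
  have bcl : ∀ t, |cl t| ≤ 2 := fun t => by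
    rw [abs_le]; exact ⟨le_max_left _ _, max_le (by norm_num) (min_le_left _ _)⟩
  have ecl : ∀ t, |t| ≤ 2 → cl t = t := fun t ht => by
    rw [abs_le] at ht
    simp [hcl, ht.1, ht.2]
  set Z : Fin 3 → Set ℝ := fun j => {y | ¬ |f j y| ≤ 2} with hZ
  have mZ : ∀ j, MeasurableSet (Z j) := fun j =>
    (measurableSet_le (mf j).abs measurable_const).compl
  have zZ : ∀ j, volume (Z j) = 0 := fun j => bf j
  set S0 : Set E2 := S ∩ (u0 ⁻¹' (Z 0)ᶜ ∩ u1 ⁻¹' (Z 1)ᶜ) with hS0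
  have mS0 : MeasurableSet S0 := mS.inter ((mu0 (mZ 0).compl).inter (mu1 (mZ 1).compl))
  have S0b : S0 ⊆ Metric.ball x ρ := fun z hz => hSb hz.1
  have n0 : volume (S ∩ u0 ⁻¹' (Z 0)) = 0 := by
    have h3 : T '' (S ∩ u0 ⁻¹' (Z 0)) ⊆ Z 0 ×ˢ univ := by
      rintro _ ⟨z, ⟨hz1, hz2⟩, rfl⟩
      refine ⟨?_, trivial⟩
      have := hu0 z (hSb hz1)
      simp only [hT]; rw [← this]; exact hz2
    have h4 : volume (Z 0 ×ˢ (univ : Set ℝ)) = 0 := by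
      rw [Measure.volume_eq_prod, Measure.prod_prod, zZ 0, zero_mul]
    have := vB (S ∩ u0 ⁻¹' (Z 0)) (fun z hz => hSb hz.1)
    rw [measure_mono_null h3 h4, mul_zero] at this
    exact le_antisymm this zero_le
  have n1 : volume (S ∩ u1 ⁻¹' (Z 1)) = 0 := by
    have h3 : T '' (S ∩ u1 ⁻¹' (Z 1)) ⊆ univ ×ˢ Z 1 := by
      rintro _ ⟨z, ⟨hz1, hz2⟩, rfl⟩
      refine ⟨trivial, ?_⟩
      have := hu1 z (hSb hz1)
      simp only [hT]; rw [← this]; exact hz2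
    have h4 : volume ((univ : Set ℝ) ×ˢ Z 1) = 0 := by
      rw [Measure.volume_eq_prod, Measure.prod_prod, zZ 1, mul_zero]
    have := vB (S ∩ u1 ⁻¹' (Z 1)) (fun z hz => hSb hz.1)
    rw [measure_mono_null h3 h4, mul_zero] at this
    exact le_antisymm this zero_le
  have hvol : volume S ≤ volume S0 := by
    have : S ⊆ S0 ∪ ((S ∩ u0 ⁻¹' (Z 0)) ∪ (S ∩ u1 ⁻¹' (Z 1))) := by
      intro z hz
      by_cases k0 : u0 z ∈ Z 0
      · exact Or.inr (Or.inl ⟨hz, k0⟩)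
      by_cases k1 : u1 z ∈ Z 1
      · exact Or.inr (Or.inr ⟨hz, k1⟩)
      exact Or.inl ⟨hz, k0, k1⟩
    refine (measure_mono this).trans ((measure_union_le _ _).trans ?_)
    rw [measure_union_null n0 n1, add_zero]
  have b0 : ∀ z ∈ S0, |f 0 (φ 0 z)| ≤ 2 ∧ |f 1 (φ 1 z)| ≤ 2 := by
    intro z hz
    have k0 := hz.2.1
    have k1 := hz.2.2
    simp only [hZ, mem_preimage, mem_compl_iff, mem_setOf_eq, not_not, hu0 z (S0b hz), hu1 z (S0b hz)] at k0 k1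
    exact ⟨k0, k1⟩
  have mT : MeasurableSet (T '' S0) := mS0.image_of_continuousOn_injOn (cT.mono S0b) (inj.mono S0b)
  have hTs : T '' S0 ⊆ P.I1 ×ˢ P.I2 := by
    rintro _ ⟨z, hz, rfl⟩; exact (h1 z (S0b hz)).1
  have hin : ∀ p ∈ T '' S0, |P.A1 p * (fun t => cl (f 0 t)) p.1 + P.A2 p * (fun t => cl (f 1 t)) p.2 + f 2 (P.φ p)| ≤ K * ε := by
    rintro _ ⟨z, hz, rfl⟩
    obtain ⟨_, k2, k3, k4, k5⟩ := h1 z (S0b hz)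
    obtain ⟨q0, q1⟩ := b0 z hz
    have k6 := ha z (S0b hz)
    simp only [hT, k2, k3, k4, ecl _ q0, ecl _ q1]
    have k7 := hS z hz.1
    rw [Fin.sum_univ_three] at k7
    have : a 0 z / a 2 z * f 0 (φ 0 z) + a 1 z / a 2 z * f 1 (φ 1 z) + f 2 (φ 2 z) =
      (a 2 z)⁻¹ * (a 0 z * f 0 (φ 0 z) + a 1 z * f 1 (φ 1 z) + a 2 z * f 2 (φ 2 z)) := by
      field_simp
    rw [this, abs_mul]
    gcongr
  have hres := hcomb ε hε hε1 (fun t => cl (f 0 t)) (fun t => cl (f 1 t)) (f 2) (mcl.comp (mf 0)) (mcl.comp (mf 1))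
    (fun t => bcl _) (fun t => bcl _) (T '' S0) mT hTs hin
  have fin0 : volume (T '' S0) ≠ ⊤ := by
    refine ne_top_of_le_ne_top ?_ (measure_mono hTs)
    unfold Pkg.I1 Pkg.I2
    exact (isCompact_Icc.prod isCompact_Icc).measure_lt_top.ne
  rcases hres with hres | ⟨y, hy⟩
  · left
    refine (hvol.trans (vB S0 S0b)).trans ?_
    refine (mul_le_mul_right hres _).trans ?_
    rw [← ENNReal.ofReal_mul hκ0.le]
    apply ENNReal.ofReal_le_ofReal
    rw [← mul_assoc]
    gcongr
    calc κ = κ ^ (1:ℝ) := (Real.rpow_one κ).symm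
      _ ≤ κ ^ (1 + C) := Real.rpow_le_rpow_of_exponent_le hκ (by linarith)
  · right
    refine ⟨fun t => (fun n => cl (f 0 (y n))) ⌊t / ε⌋, {z ∈ S0 | |cl (f 0 (y ⌊u0 z / ε⌋)) - cl (f 0 (u0 z))| ≤ ε ^ (1 - σ)},
      const_floor hε (fun n => cl (f 0 (y n))), ?_, fun z hz => hz.1.1, ?_, ?_⟩
    · have m1 : Measurable fun z => cl (f 0 (y ⌊u0 z / ε⌋)) :=
        (measurable_from_top (f := fun n : ℤ => cl (f 0 (y n)))).comp (mu0.div_const ε).floor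
      have m2 : Measurable fun z => cl (f 0 (u0 z)) := mcl.comp ((mf 0).comp mu0)
      exact mS0.inter (measurableSet_le (m1.sub m2).abs measurable_const)
    · set G : Set E2 := {z ∈ S0 | |cl (f 0 (y ⌊u0 z / ε⌋)) - cl (f 0 (u0 z))| ≤ ε ^ (1 - σ)} with hG
      have e : {p ∈ T '' S0 | |(fun t => cl (f 0 t)) (y ⌊p.1 / ε⌋) - (fun t => cl (f 0 t)) p.1| ≤ ε ^ (1 - σ)} ⊆ T '' G := by
        rintro _ ⟨⟨z, hz, rfl⟩, hz2⟩
        refine ⟨z, ⟨hz, ?_⟩, rfl⟩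
        rw [hu0 z (S0b hz)]; exact hz2
      have k1 := (hy.trans (measure_mono e)).trans (vA G fun z hz => S0b hz.1)
      have k2 : (volume S).toReal ≤ κ * (volume (T '' S0)).toReal := by
        have := ENNReal.toReal_mono (by finiteness) (hvol.trans (vB S0 S0b))
        rwa [ENNReal.toReal_mul, ENNReal.toReal_ofReal hκ0.le] at this
      have hm0 : 0 ≤ (volume (T '' S0)).toReal := ENNReal.toReal_nonneg
      have k3 : (κ ^ (1 + C) * C)⁻¹ * (volume S).toReal ^ C ≤ κ⁻¹ * (C⁻¹ * (volume (T '' S0)).toReal ^ C) := by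
        calc _ ≤ (κ ^ (1 + C) * C)⁻¹ * (κ * (volume (T '' S0)).toReal) ^ C := by gcongr
          _ = _ := by
            rw [Real.mul_rpow hκ0.le hm0, Real.rpow_add hκ0, Real.rpow_one]
            have : κ ^ C ≠ 0 := (Real.rpow_pos_of_pos hκ0 C).ne'
            field_simp
      refine (ENNReal.ofReal_le_ofReal k3).trans ?_
      rw [ENNReal.ofReal_mul (by positivity), ENNReal.ofReal_inv_of_pos hκ0]
      refine (mul_le_mul_right k1 _).trans ?_
      rw [← mul_assoc, ENNReal.inv_mul_cancel (by simpa using hκ0) ENNReal.ofReal_ne_top, one_mul]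
    · intro z hz
      have q0 := (b0 z hz.1).1
      have := hz.2
      rw [hu0 z (S0b hz.1), ecl _ q0] at this
      exact this

/-- Lemma 6.1 (microscale, preliminary form): under nondegeneracy, nonvanishing web
curvature, and the two-term auxiliary hypothesis relative to `W₃`, for any measurable
subset `𝒮` of the sublevel set, either `|𝒮| ≲ ε^c`, or `f₁` agrees to within `C ε^{1-σ}`,
on a subset of `𝒮` of measure `≳ |𝒮|^C`, with a function constant on intervals of
length `ε`. -/
theorem microscale_preliminary
    (x₀ : EuclideanSpace ℝ (Fin 2)) (r : ℝ) (hr : 0 < r)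
    (Bt : Set (EuclideanSpace ℝ (Fin 2))) (hBtOpen : IsOpen Bt) (hBtConn : IsConnected Bt)
    (hBBt : Metric.closedBall x₀ r ⊆ Bt)
    (a φ : Fin 3 → EuclideanSpace ℝ (Fin 2) → ℝ)
    (ha : ∀ j, AnalyticOnNhd ℝ (a j) Bt)
    (hφ : ∀ j, AnalyticOnNhd ℝ (φ j) Bt)
    -- nondegeneracy
    (haNz : ∀ j, ∀ x ∈ Bt, a j x ≠ 0)
    (hInd : ∀ i j : Fin 3, i ≠ j → ∀ x ∈ Bt,
      LinearIndependent ℝ ![fderiv ℝ (φ i) x, fderiv ℝ (φ j) x])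
    -- the curvature of the web defined by Φ does not vanish identically
    (hcurv : ¬ ∃ V : Set (EuclideanSpace ℝ (Fin 2)),
      V ⊆ Metric.closedBall x₀ r ∧ IsOpen V ∧ V.Nonempty ∧ IsConnected V ∧
      ∃ (Φ : EuclideanSpace ℝ (Fin 2) → EuclideanSpace ℝ (Fin 2)) (ψ : Fin 3 → ℝ → ℝ)
        (L : Fin 3 → (EuclideanSpace ℝ (Fin 2) →L[ℝ] ℝ)) (c : Fin 3 → ℝ),
        AnalyticOnNhd ℝ Φ V ∧ Set.InjOn Φ V ∧ IsOpen (Φ '' V) ∧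
        (∀ j, AnalyticOnNhd ℝ (ψ j) (φ j '' V) ∧ Set.InjOn (ψ j) (φ j '' V)) ∧
        ∀ j, ∀ x ∈ V, ψ j (φ j x) = L j (Φ x) + c j)
    -- W₃ : nowhere vanishing real analytic vector field annihilating φ₃
    (W₃ : EuclideanSpace ℝ (Fin 2) → EuclideanSpace ℝ (Fin 2))
    (hW₃a : AnalyticOnNhd ℝ W₃ Bt) (hW₃nz : ∀ x ∈ Bt, W₃ x ≠ 0)
    (hW₃φ : ∀ x ∈ Bt, fderiv ℝ (φ 2) x (W₃ x) = 0)
    -- two-term auxiliary hypothesis (6.1)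
    (hAux : ∀ τ : ℝ, ∀ U : Set (EuclideanSpace ℝ (Fin 2)),
      U ⊆ Metric.closedBall x₀ r → IsOpen U → U.Nonempty →
      ∀ h₁ h₂ : ℝ → ℝ, AnalyticOnNhd ℝ h₁ (φ 0 '' U) → AnalyticOnNhd ℝ h₂ (φ 1 '' U) →
      (∀ x ∈ U, a 0 x * |fderiv ℝ (φ 0) x (W₃ x)| ^ τ * h₁ (φ 0 x) +
          a 1 x * |fderiv ℝ (φ 1) x (W₃ x)| ^ τ * h₂ (φ 1 x) = 0) →
      (∀ y ∈ φ 0 '' U, h₁ y = 0) ∧ (∀ y ∈ φ 1 '' U, h₂ y = 0)) :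
    ∀ σ : ℝ, 0 < σ → ∃ c C : ℝ, 0 < c ∧ 0 < C ∧
      ∀ ε : ℝ, 0 < ε → ∀ f : Fin 3 → ℝ → ℝ,
        (∀ j, Measurable (f j)) → (∀ j, ∀ᵐ y ∂(volume : Measure ℝ), |f j y| ≤ 2) →
        ∀ 𝒮 : Set (EuclideanSpace ℝ (Fin 2)), MeasurableSet 𝒮 →
        𝒮 ⊆ {x ∈ Metric.closedBall x₀ r | |∑ j, a j x * f j (φ j x)| < ε} →
        volume 𝒮 ≤ ENNReal.ofReal (C * ε ^ c) ∨
        ∃ (f₁star : ℝ → ℝ) (S' : Set (EuclideanSpace ℝ (Fin 2))),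
          ConstOnIntervals f₁star ε ∧ MeasurableSet S' ∧ S' ⊆ 𝒮 ∧
          ENNReal.ofReal c * volume 𝒮 ^ C ≤ volume S' ∧
          ∀ x ∈ S', |f₁star (φ 0 x) - f 0 (φ 0 x)| ≤ C * ε ^ (1 - σ) := by
  intro σ hσ
  have hloc : ∀ x ∈ Metric.closedBall x₀ r, ∃ ρ C D : ℝ, 0 < ρ ∧ 1 ≤ C ∧ 1 ≤ D ∧
      ∀ ε, 0 < ε → ε ≤ 1 → ∀ f : Fin 3 → ℝ → ℝ, (∀ j, Measurable (f j)) →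
      (∀ j, ∀ᵐ y ∂(volume : Measure ℝ), |f j y| ≤ 2) → ∀ S : Set E2, MeasurableSet S →
      S ⊆ Metric.ball x ρ → (∀ z ∈ S, |∑ j, a j z * f j (φ j z)| < ε) →
      volume S ≤ ENNReal.ofReal (D * ε ^ (1 / C)) ∨ ∃ (g : ℝ → ℝ) (S' : Set E2), ConstOnIntervals g ε ∧
        MeasurableSet S' ∧ S' ⊆ S ∧ ENNReal.ofReal (D⁻¹ * (volume S).toReal ^ C) ≤ volume S' ∧
        ∀ z ∈ S', |g (φ 0 z) - f 0 (φ 0 z)| ≤ ε ^ (1 - σ) := by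
    intro x hx
    obtain ⟨P, K, ρ, hK, hρ, hsub, h1, h2⟩ := chart_main x₀ r hr Bt hBtOpen hBBt a φ ha hφ haNz hInd hcurv
      W₃ hW₃nz hW₃φ hAux x hx
    obtain ⟨C, D, hC, hD, h⟩ := local_main (σ := σ) hK
      (fun j y hy => (hφ j y (hsub hy)).continuousAt.continuousWithinAt)
      (fun y hy => haNz 2 y (hsub hy)) h1 h2 hσ
    exact ⟨ρ, C, D, hρ, hC, hD, h⟩
  choose! ρ Cx Dx hρ hCx hDx hmain using hloc
  obtain ⟨t, htB, htc⟩ := (isCompact_closedBall x₀ r).elim_nhds_subcover (fun x => Metric.ball x (ρ x))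
    (fun x hx => Metric.ball_mem_nhds x (hρ x hx))
  have htne : t.Nonempty := by
    by_contra hne
    rw [Finset.not_nonempty_iff_eq_empty] at hne
    have := htc (Metric.mem_closedBall_self hr.le)
    simp [hne] at this
  set C : ℝ := 1 + ∑ x ∈ t, Cx x with hCdef
  set D : ℝ := 1 + ∑ x ∈ t, Dx x with hDdef
  set N : ℝ := (t.card : ℝ) with hN
  set V : ℝ := (volume (Metric.closedBall x₀ r)).toReal + 1 with hV
  have hN1 : 1 ≤ N := by
    rw [hN]; exact_mod_cast htne.card_pos
  have hV1 : 1 ≤ V := by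
    have : 0 ≤ (volume (Metric.closedBall x₀ r)).toReal := ENNReal.toReal_nonneg
    linarith
  have hCle : ∀ x ∈ t, Cx x ≤ C := fun x hx => by
    have := Finset.single_le_sum (f := Cx) (fun y hy => by linarith [hCx y (htB y hy)]) hx
    linarith
  have hDle : ∀ x ∈ t, Dx x ≤ D := fun x hx => by
    have := Finset.single_le_sum (f := Dx) (fun y hy => by linarith [hDx y (htB y hy)]) hx
    linarith
  have hC1 : 1 ≤ C := by
    have : 0 ≤ ∑ x ∈ t, Cx x := Finset.sum_nonneg fun y hy => by linarith [hCx y (htB y hy)]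
    linarith
  have hD1 : 1 ≤ D := by
    have : 0 ≤ ∑ x ∈ t, Dx x := Finset.sum_nonneg fun y hy => by linarith [hDx y (htB y hy)]
    linarith
  have hC0 : 0 < C := by linarith
  have hD0 : 0 < D := by linarith
  have hN0 : 0 < N := by linarith
  have hV0 : 0 < V := by linarith
  set Cf : ℝ := C + N * D + V with hCf
  have hND : 1 ≤ N * D := one_le_mul_of_one_le_of_one_le hN1 hD1
  have hCf0 : 0 < Cf := by positivity
  set c : ℝ := min (1 / C) (D⁻¹ * ((N * V) ^ Cf)⁻¹) with hc
  have hc0 : 0 < c := lt_min (by positivity) (by positivity)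
  refine ⟨c, Cf, hc0, hCf0, ?_⟩
  intro ε hε f mf bf S mS hS
  have finB : volume (Metric.closedBall x₀ r) ≠ ⊤ := (isCompact_closedBall x₀ r).measure_lt_top.ne
  have hSB : volume S ≤ volume (Metric.closedBall x₀ r) := measure_mono fun z hz => (hS hz).1
  have finS : volume S ≠ ⊤ := ne_top_of_le_ne_top finB hSB
  have hSV : (volume S).toReal ≤ V := by
    have := ENNReal.toReal_mono finB hSB
    linarith
  rcases le_total 1 ε with hε1 | hε1
  · left
    rw [← ENNReal.ofReal_toReal finS]
    apply ENNReal.ofReal_le_ofReal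
    have h1 : 1 ≤ ε ^ c := Real.one_le_rpow hε1 hc0.le
    calc (volume S).toReal ≤ V := hSV
      _ ≤ Cf := by linarith
      _ ≤ Cf * ε ^ c := le_mul_of_one_le_right hCf0.le h1
  obtain ⟨x, hxt, hxmax⟩ := Finset.exists_max_image t
    (fun x => volume (S ∩ Metric.ball x (ρ x))) htne
  have hcov : volume S ≤ ENNReal.ofReal N * volume (S ∩ Metric.ball x (ρ x)) := by
    have h1 : S ⊆ ⋃ y ∈ t, S ∩ Metric.ball y (ρ y) := by
      intro z hz
      have := htc (hS hz).1
      simp only [mem_iUnion] at this ⊢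
      obtain ⟨y, hy, hzy⟩ := this
      exact ⟨y, hy, hz, hzy⟩
    calc volume S ≤ _ := measure_mono h1
      _ ≤ ∑ y ∈ t, volume (S ∩ Metric.ball y (ρ y)) := measure_biUnion_finset_le _ _
      _ ≤ t.card • volume (S ∩ Metric.ball x (ρ x)) := Finset.sum_le_card_nsmul _ _ _ hxmax
      _ = _ := by rw [nsmul_eq_mul, hN, ENNReal.ofReal_natCast]
  have hxB := htB x hxt
  rcases hmain x hxB ε hε hε1 f mf bf (S ∩ Metric.ball x (ρ x)) (mS.inter measurableSet_ball)
    inter_subset_right (fun z hz => (hS hz.1).2) with h | ⟨g, S', hg, mS', hS'S, hS'v, hS'g⟩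
  · left
    refine hcov.trans ((mul_le_mul_right h _).trans ?_)
    rw [← ENNReal.ofReal_mul hN0.le]
    apply ENNReal.ofReal_le_ofReal
    have h1 : ε ^ (1 / Cx x) ≤ ε ^ c := by
      apply Real.rpow_le_rpow_of_exponent_ge hε hε1
      refine (min_le_left _ _).trans ?_
      exact one_div_le_one_div_of_le (by linarith [hCx x hxB]) (hCle x hxt)
    have h2 := hDle x hxt
    have h3 : 1 ≤ Dx x := hDx x hxB
    calc N * (Dx x * ε ^ (1 / Cx x)) ≤ N * (D * ε ^ c) := by gcongr
      _ = (N * D) * ε ^ c := by ring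
      _ ≤ Cf * ε ^ c := by gcongr; linarith
  · right
    refine ⟨g, S', hg, mS', fun z hz => (hS'S hz).1, ?_, ?_⟩
    · refine le_trans ?_ hS'v
      rw [← ENNReal.ofReal_toReal finS, ENNReal.ofReal_rpow_of_nonneg ENNReal.toReal_nonneg hCf0.le,
        ← ENNReal.ofReal_mul hc0.le]
      apply ENNReal.ofReal_le_ofReal
      set v := (volume S).toReal with hv
      set w := (volume (S ∩ Metric.ball x (ρ x))).toReal with hw
      have hv0 : 0 ≤ v := ENNReal.toReal_nonneg
      have hw0 : 0 ≤ w := ENNReal.toReal_nonneg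
      have finw : volume (S ∩ Metric.ball x (ρ x)) ≠ ⊤ :=
        ne_top_of_le_ne_top finS (measure_mono inter_subset_left)
      have hvw : v ≤ N * w := by
        have := ENNReal.toReal_mono (ENNReal.mul_ne_top ENNReal.ofReal_ne_top finw) hcov
        rwa [ENNReal.toReal_mul, ENNReal.toReal_ofReal hN0.le] at this
      have hNV : 0 < N * V := by positivity
      have h1 : v / (N * V) ≤ w := by
        rw [div_le_iff₀ hNV]
        have : N * w ≤ N * w * V := le_mul_of_one_le_right (by positivity) hV1
        linarith
      have h2 : v / (N * V) ≤ 1 := by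
        rw [div_le_one hNV]
        have : V ≤ N * V := le_mul_of_one_le_left hV0.le hN1
        linarith
      have h3 : 0 ≤ v / (N * V) := by positivity
      have hCx1 : 1 ≤ Cx x := hCx x hxB
      have hDx1 : 1 ≤ Dx x := hDx x hxB
      have hCC : Cx x ≤ Cf := by linarith [hCle x hxt]
      have h4 : (v / (N * V)) ^ Cf ≤ (v / (N * V)) ^ (Cx x) :=
        Real.rpow_le_rpow_of_exponent_ge_of_imp h3 h2 hCC (fun _ h => by linarith)
      calc c * v ^ Cf ≤ (D⁻¹ * ((N * V) ^ Cf)⁻¹) * v ^ Cf := by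
            gcongr
            exact min_le_right _ _
        _ = D⁻¹ * (v / (N * V)) ^ Cf := by
            rw [Real.div_rpow hv0 hNV.le]; ring
        _ ≤ D⁻¹ * (v / (N * V)) ^ (Cx x) := by gcongr
        _ ≤ D⁻¹ * w ^ (Cx x) := by gcongr
        _ ≤ (Dx x)⁻¹ * w ^ (Cx x) := by
            have := hDle x hxt
            gcongr
    · intro z hz
      refine (hS'g z hz).trans ?_
      apply le_mul_of_one_le_left (by positivity)
      linarith
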